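/- Let I ⊂ ℝ be a finite interval, N ∈ ℤ_{≥0}, and let ϑ be the Riemann–Siegel theta branch. There is a constant C depending only on I and N such that for every s = σ + it with σ ∈ I and t ≥ 2π, and all real α, β ≥ 1 with t = 2παβ, setting a := α − ⌊α⌋, b := β − ⌊β⌋, λ := √(α/β), and R(s;α,β) := e^{iϑ(s)}ζ(s) − e^{iϑ(s)}·Σ_{n ≤ α} n^{−s} − e^{iϑ(1−s)}·Σ_{n ≤ β} n^{−(1−s)}, one has |R(s;α,β) − (−1)^{⌊α⌋⌊β⌋+1}·exp(πi(2aβ − 2bα + a²λ^{−2} − b²λ²)/2)·(2π/t)^{1/4}·Σ_{n=0}^{N−1} λ^{1/2−s}·t^{−n/2}·Σ_{r=0}^{3n} G^{(r)}(aλ^{−1} + bλ; λ²)·(2π)^{−r/2}·P_{n,3n−r}(√(π/2)·(aλ^{−1} − bλ), σ)| ≤ C·λ^{1/2−σ}·(λ + λ^{−1})^{3N+1/2}·t^{−N/2 − 1/4}. -/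

import Mathlib

open Complex Real MeasureTheory

noncomputable section

def chi (s : ℂ) : ℂ := (π : ℂ) ^ (s - 1/2) * Complex.Gamma ((1 - s)/2) / Complex.Gamma (s/2)

def RSOmega : Set ℂ := {s : ℂ | s.im ≠ 0 ∨ (0 < s.re ∧ s.re < 1)}

def IsRSTheta (ϑ : ℂ → ℂ) : Prop :=
  DifferentiableOn ℂ ϑ RSOmega ∧ (∀ s ∈ RSOmega, Complex.exp (-2 * I * ϑ s) = chi s) ∧
    ϑ (1/2) = 0

def zetaSum (x : ℝ) (s : ℂ) : ℂ := ∑ n ∈ Finset.Icc 1 ⌊x⌋₊, (n : ℂ) ^ (-s)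

def Upsilon (u τ : ℂ) : ℂ :=
  ∫ v : ℝ, Complex.exp (3 * (π:ℂ) * I / 4) *
    (Complex.exp (-(π:ℂ) * I * τ * (1/2 + Complex.exp (3 * (π:ℂ) * I / 4) * v) ^ 2
        + 2 * (π:ℂ) * I * u * (1/2 + Complex.exp (3 * (π:ℂ) * I / 4) * v)) /
      (Complex.exp (2 * (π:ℂ) * I * (1/2 + Complex.exp (3 * (π:ℂ) * I / 4) * v)) - 1))

def G (u τ : ℂ) : ℂ :=
  τ ^ ((1:ℂ)/4) * Complex.exp (-(π:ℂ) * I * u ^ 2 / 2 + (π:ℂ) * I / 8) *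
    Upsilon (τ ^ ((1:ℂ)/2) * u) τ

def Gderiv (k : ℕ) (u τ : ℂ) : ℂ := iteratedDeriv k (fun w => G w τ) u

def hermiteH (n : ℕ) (x : ℂ) : ℂ :=
  (Nat.factorial n : ℂ) * ∑ j ∈ Finset.range (n / 2 + 1),
    (-1:ℂ) ^ j / ((Nat.factorial j : ℂ) * (Nat.factorial (n - 2*j) : ℂ)) * (2 * x) ^ (n - 2*j)

def obell (p : ℕ → ℂ) (i j : ℕ) : ℂ :=
  ∑ f ∈ (Finset.Nat.antidiagonalTuple j i).filter (fun f => ∀ l, 1 ≤ f l), ∏ l, p (f l)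

def bernoulliPoly (n : ℕ) (x : ℂ) : ℂ := Polynomial.aeval x (Polynomial.bernoulli n)

def fseq (σ : ℝ) (n : ℕ) : ℂ :=
  (bernoulliPoly (n+1) ((σ:ℂ)/2) + (-1:ℂ)^(n+1) * bernoulliPoly (n+1) ((1-(σ:ℂ))/2)) /
    (2*(n:ℂ)*((n:ℂ)+1))

def um (m : ℕ) (σ : ℝ) : ℂ :=
  (-2:ℂ)^m * ∑ k ∈ Finset.range (m+1), obell (fseq σ) m k / (Nat.factorial k : ℂ)

def seqA (j : ℕ) : ℂ := (-1:ℂ)^(j+1) / ((j:ℂ) + 2)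

def seqB (j : ℕ) : ℂ := (-1:ℂ)^(j+1) / (j:ℂ)

def dd (m r : ℕ) (σ : ℝ) : ℂ :=
  ∑ n ∈ Finset.Icc r m, (obell seqA n r / (Nat.factorial r : ℂ)) *
    ∑ k ∈ Finset.range (m - n + 1),
      (obell seqB (m - n) k / (Nat.factorial k : ℂ)) * ((σ:ℂ) - 1)^k

def qq (n ℓ : ℕ) (σ : ℝ) : ℂ :=
  ∑ m ∈ Finset.Icc (ℓ - n) (ℓ / 3), um m σ * dd (n - 2*m) (n + m - ℓ) σ

def PP (n k : ℕ) (x : ℂ) (σ : ℝ) : ℂ :=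
  Complex.exp (3 * (π:ℂ) * I * (k:ℂ) / 4) * ∑ ℓ ∈ Finset.range (k/2 + 1),
    (Nat.choose (3*n - 2*ℓ) (3*n - k) : ℂ) * (-1:ℂ)^(n + ℓ) * 2^(2*ℓ) / 2^k *
      qq n ℓ σ * hermiteH (k - 2*ℓ) (Complex.exp (-(π:ℂ) * I / 4) * x)

def IsAk (s : ℂ) (a : ℕ → ℂ) : Prop :=
  a 0 = 1 ∧ ∀ k : ℕ, ((k:ℂ) + 1) * (Real.sqrt s.im : ℂ) * a (k+1) =
    -((k:ℂ) + 1 - (s.re:ℂ)) * a k + I * (if 2 ≤ k then a (k-2) else 0)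

def IsPsi (Ψ : ℂ → ℂ) : Prop :=
  Differentiable ℂ Ψ ∧ ∀ u : ℂ, Complex.cos ((π:ℂ)*u) ≠ 0 →
    Ψ u = Complex.cos ((π:ℂ)*(u^2/2 - u - 1/8)) / Complex.cos ((π:ℂ)*u)

def wfun (s z : ℂ) : ℂ :=
  Complex.exp ((s - 1) * Complex.log (1 + z / (Real.sqrt s.im : ℂ))
    - I * (Real.sqrt s.im : ℂ) * z + I * z^2 / 2)

def rn (n : ℕ) (s z : ℂ) : ℂ :=
  wfun s z - ∑ k ∈ Finset.range n, (iteratedDeriv k (wfun s) 0 / (Nat.factorial k : ℂ)) * z^k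

def GammaOmega : Set ℂ := {s : ℂ | s.im ≠ 0 ∨ 0 < s.re}

def IsLogGamma (L : ℂ → ℂ) : Prop :=
  DifferentiableOn ℂ L GammaOmega ∧ (∀ s ∈ GammaOmega, Complex.exp (L s) = Complex.Gamma s) ∧
    L 1 = 0

def gseq (σ : ℝ) (n : ℕ) : ℂ := -(bernoulliPoly (n+1) (σ:ℂ)) / ((n:ℂ)*((n:ℂ)+1))

def gammam (m : ℕ) (σ : ℝ) : ℂ :=
  I^m * ∑ k ∈ Finset.range (m+1), obell (gseq σ) m k / (Nat.factorial k : ℂ)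

section
open Finset Filter


section P1

def Maj (c : ℕ → ℂ) (ρ S : ℝ) : Prop :=
  Summable (fun i => ‖c i‖ * ρ ^ i) ∧ ∑' i, ‖c i‖ * ρ ^ i ≤ S

lemma Maj.summable {c : ℕ → ℂ} {ρ S : ℝ} (h : Maj c ρ S) {x : ℂ} (hx : ‖x‖ ≤ ρ) :
    Summable (fun i => ‖c i * x ^ i‖) := by
  refine Summable.of_nonneg_of_le (fun i => norm_nonneg _) (fun i => ?_) h.1
  rw [norm_mul, norm_pow]; gcongr

lemma Maj.nonneg {c : ℕ → ℂ} {ρ S : ℝ} (h : Maj c ρ S) (hρ : 0 ≤ ρ) : 0 ≤ S :=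
  le_trans (tsum_nonneg fun i => by positivity) h.2

lemma Maj.tail {c : ℕ → ℂ} {ρ S : ℝ} (h : Maj c ρ S) (hρ : 0 < ρ) {x : ℂ} (hx : ‖x‖ ≤ ρ) (N : ℕ) :
    ‖∑' i, c i * x ^ i - ∑ i ∈ range N, c i * x ^ i‖ ≤ (‖x‖ / ρ) ^ N * S := by
  have hs := (h.summable hx).of_norm
  rw [← hs.sum_add_tsum_nat_add N, add_sub_cancel_left]
  have hr : ‖x‖ / ρ ≤ 1 := (div_le_one hρ).2 hx
  have h2 : Summable (fun i => ‖c (i + N)‖ * ρ ^ (i + N)) := (summable_nat_add_iff N).2 h.1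
  have key : ∀ i, ‖c (i + N) * x ^ (i + N)‖ ≤ (‖x‖ / ρ) ^ N * (‖c (i + N)‖ * ρ ^ (i + N)) := by
    intro i
    have e : ‖x‖ = (‖x‖ / ρ) * ρ := by field_simp
    have : ‖c (i + N) * x ^ (i + N)‖ = (‖x‖ / ρ) ^ (i + N) * (‖c (i + N)‖ * ρ ^ (i + N)) := by
      rw [norm_mul, norm_pow]
      conv_lhs => rw [e, mul_pow]
      ring
    rw [this]
    apply mul_le_mul_of_nonneg_right _ (by positivity)
    exact pow_le_pow_of_le_one (by positivity) hr (by omega)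
  refine (tsum_of_norm_bounded (h2.mul_left _).hasSum key).trans ?_
  rw [tsum_mul_left]
  apply mul_le_mul_of_nonneg_left _ (by positivity)
  refine le_trans ?_ h.2
  rw [← h.1.sum_add_tsum_nat_add N]
  have : 0 ≤ ∑ i ∈ range N, ‖c i‖ * ρ ^ i := sum_nonneg fun i _ => by positivity
  linarith

lemma Maj.coeff {c : ℕ → ℂ} {ρ S : ℝ} (h : Maj c ρ S) (hρ : 0 < ρ) (i : ℕ) : ‖c i‖ * ρ ^ i ≤ S :=
  (h.1.le_tsum i (fun j _ => by positivity)).trans h.2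

def cmul (c d : ℕ → ℂ) (n : ℕ) : ℂ := ∑ kl ∈ HasAntidiagonal.antidiagonal n, c kl.1 * d kl.2

lemma cmul_pow (c d : ℕ → ℂ) (x : ℂ) (n : ℕ) : cmul c d n * x ^ n =
    ∑ kl ∈ HasAntidiagonal.antidiagonal n, (c kl.1 * x ^ kl.1) * (d kl.2 * x ^ kl.2) := by
  rw [cmul, sum_mul]
  refine sum_congr rfl fun kl hkl => ?_
  rw [← HasAntidiagonal.mem_antidiagonal.1 hkl]; ring

lemma Maj.mul {c d : ℕ → ℂ} {ρ S T : ℝ} (hc : Maj c ρ S) (hd : Maj d ρ T) (hρ : 0 ≤ ρ) :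
    Maj (cmul c d) ρ (S * T) := by
  have h1 : Summable fun i => ‖(‖c i‖ * ρ ^ i : ℝ)‖ := hc.1.norm
  have h2 : Summable fun i => ‖(‖d i‖ * ρ ^ i : ℝ)‖ := hd.1.norm
  have hs := (summable_norm_sum_mul_antidiagonal_of_summable_norm h1 h2).of_norm
  have ht := tsum_mul_tsum_eq_tsum_sum_antidiagonal_of_summable_norm h1 h2
  have key : ∀ n, ‖cmul c d n‖ * ρ ^ n ≤
      ∑ kl ∈ HasAntidiagonal.antidiagonal n, (‖c kl.1‖ * ρ ^ kl.1) * (‖d kl.2‖ * ρ ^ kl.2) := by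
    intro n
    refine (mul_le_mul_of_nonneg_right (norm_sum_le _ _) (by positivity)).trans (le_of_eq ?_)
    rw [sum_mul]
    refine sum_congr rfl fun kl hkl => ?_
    rw [← HasAntidiagonal.mem_antidiagonal.1 hkl, norm_mul]; ring
  have hsum := Summable.of_nonneg_of_le (fun n => by positivity) key hs
  refine ⟨hsum, (hsum.tsum_le_tsum key hs).trans ?_⟩
  rw [← ht]
  exact mul_le_mul hc.2 hd.2 (tsum_nonneg fun i => by positivity) (hc.nonneg hρ)

lemma Maj.tsum_mul {c d : ℕ → ℂ} {ρ S T : ℝ} (hc : Maj c ρ S) (hd : Maj d ρ T) {x : ℂ}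
    (hx : ‖x‖ ≤ ρ) : ∑' i, cmul c d i * x ^ i = (∑' i, c i * x ^ i) * ∑' i, d i * x ^ i := by
  rw [tsum_mul_tsum_eq_tsum_sum_antidiagonal_of_summable_norm (hc.summable hx) (hd.summable hx)]
  simp_rw [cmul_pow]

lemma Maj.add {c d : ℕ → ℂ} {ρ S T : ℝ} (hc : Maj c ρ S) (hd : Maj d ρ T) (hρ : 0 ≤ ρ) :
    Maj (fun i => c i + d i) ρ (S + T) := by
  have key : ∀ n, ‖c n + d n‖ * ρ ^ n ≤ ‖c n‖ * ρ ^ n + ‖d n‖ * ρ ^ n := by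
    intro n; rw [← add_mul]; gcongr; exact norm_add_le _ _
  have hsum := Summable.of_nonneg_of_le (fun n => by positivity) key (hc.1.add hd.1)
  refine ⟨hsum, (hsum.tsum_le_tsum key (hc.1.add hd.1)).trans ?_⟩
  rw [hc.1.tsum_add hd.1]; exact add_le_add hc.2 hd.2

lemma Maj.tsum_add {c d : ℕ → ℂ} {ρ S T : ℝ} (hc : Maj c ρ S) (hd : Maj d ρ T) {x : ℂ}
    (hx : ‖x‖ ≤ ρ) : ∑' i, (c i + d i) * x ^ i = (∑' i, c i * x ^ i) + ∑' i, d i * x ^ i := by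
  rw [← (hc.summable hx).of_norm.tsum_add (hd.summable hx).of_norm]
  simp_rw [add_mul]

lemma Maj.of_le {c : ℕ → ℂ} {ρ S : ℝ} {g : ℕ → ℝ} (hρ : 0 ≤ ρ) (hg : HasSum g S)
    (h : ∀ i, ‖c i‖ * ρ ^ i ≤ g i) : Maj c ρ S := by
  have hsum := Summable.of_nonneg_of_le (fun n => by positivity) h hg.summable
  exact ⟨hsum, (hsum.tsum_le_tsum h hg.summable).trans hg.tsum_eq.le⟩

def pz (p : ℕ → ℂ) (j : ℕ) : ℂ := if j = 0 then 0 else p j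

lemma obell_zero (p : ℕ → ℂ) (i : ℕ) : obell p i 0 = if i = 0 then 1 else 0 := by
  unfold obell
  cases i with
  | zero => simp
  | succ n => simp

lemma obell_succ (p : ℕ → ℂ) (i k : ℕ) : obell p i (k+1) = cmul (pz p) (fun j => obell p j k) i := by
  unfold obell cmul
  simp_rw [sum_filter, mul_sum]
  rw [sum_sigma']
  refine sum_bij' (fun f _ => ⟨(f 0, ∑ l : Fin k, f l.succ), fun l => f l.succ⟩)
    (fun x _ => Fin.cons x.1.1 x.2) ?_ ?_ ?_ ?_ ?_
  · intro f hf
    simp only [Nat.mem_antidiagonalTuple, Fin.sum_univ_succ] at hf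
    simp [mem_sigma, Nat.mem_antidiagonalTuple, hf]
  · intro x hx
    simp only [mem_sigma, HasAntidiagonal.mem_antidiagonal, Nat.mem_antidiagonalTuple] at hx
    simp [Nat.mem_antidiagonalTuple, Fin.sum_univ_succ, hx.1, hx.2]
  · intro f hf
    exact Fin.cons_self_tail f
  · rintro ⟨⟨u, v⟩, g⟩ hx
    simp only [mem_sigma, HasAntidiagonal.mem_antidiagonal, Nat.mem_antidiagonalTuple] at hx
    simp [hx.2]
  · intro f hf
    simp only [Fin.forall_fin_succ, Fin.prod_univ_succ, pz]
    by_cases h0 : f 0 = 0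
    · simp [h0]
    · have : 1 ≤ f 0 := Nat.one_le_iff_ne_zero.2 h0
      simp [h0, this]

lemma obell_eq_zero (p : ℕ → ℂ) {i k : ℕ} (h : i < k) : obell p i k = 0 := by
  unfold obell
  rw [sum_eq_zero]
  intro f hf
  simp only [mem_filter, Nat.mem_antidiagonalTuple] at hf
  have : k ≤ ∑ l, f l := by
    calc k = ∑ l : Fin k, 1 := by simp
      _ ≤ _ := sum_le_sum fun l _ => hf.2 l
  omega

lemma obell_congr {p p' : ℕ → ℂ} {i k : ℕ} (h : ∀ j, 1 ≤ j → j ≤ i → p j = p' j) :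
    obell p i k = obell p' i k := by
  unfold obell
  refine sum_congr rfl fun f hf => prod_congr rfl fun l _ => ?_
  simp only [mem_filter, Nat.mem_antidiagonalTuple] at hf
  exact h _ (hf.2 l) (hf.1 ▸ single_le_sum (f := f) (fun _ _ => Nat.zero_le _) (mem_univ l))

lemma obell_scale (p : ℕ → ℂ) (x : ℂ) (i k : ℕ) :
    obell (fun j => p j * x ^ j) i k = obell p i k * x ^ i := by
  unfold obell
  rw [sum_mul]
  refine sum_congr rfl fun f hf => ?_
  simp only [mem_filter, Nat.mem_antidiagonalTuple] at hf
  rw [prod_mul_distrib, prod_pow_eq_pow_sum, hf.1]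

lemma obell_smul (p : ℕ → ℂ) (x : ℂ) (i k : ℕ) :
    obell (fun j => x * p j) i k = x ^ k * obell p i k := by
  unfold obell
  rw [mul_sum]
  refine sum_congr rfl fun f hf => ?_
  rw [prod_mul_distrib]; simp

lemma Maj.obell {p : ℕ → ℂ} {ρ S : ℝ} (h : Maj (pz p) ρ S) (hρ : 0 ≤ ρ) (k : ℕ) :
    Maj (fun i => obell p i k) ρ (S ^ k) ∧ ∀ x : ℂ, ‖x‖ ≤ ρ →
      ∑' i, _root_.obell p i k * x ^ i = (∑' i, pz p i * x ^ i) ^ k := by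
  induction k with
  | zero =>
    simp_rw [obell_zero, pow_zero]
    constructor
    · apply Maj.of_le hρ (hasSum_ite_eq 0 (1:ℝ))
      intro i; split_ifs with hi <;> simp [hi]
    · intro x _
      rw [tsum_eq_single 0]
      · simp
      · intro i hi; simp [hi]
  | succ k ih =>
    simp_rw [obell_succ]
    refine ⟨?_, fun x hx => ?_⟩
    · rw [pow_succ']; exact h.mul ih.1 hρ
    · rw [h.tsum_mul ih.1 hx, ih.2 x hx, pow_succ']

def ecoef (p : ℕ → ℂ) (i : ℕ) : ℂ :=
  ∑ k ∈ range (i+1), obell p i k / (Nat.factorial k : ℂ)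

lemma ecoef_eq (p : ℕ → ℂ) (i : ℕ) : HasSum (fun k => obell p i k / (Nat.factorial k : ℂ)) (ecoef p i) := by
  apply hasSum_sum_of_ne_finset_zero
  intro k hk
  rw [obell_eq_zero p (by simpa using hk), zero_div]

lemma Maj.exp {p : ℕ → ℂ} {ρ S : ℝ} (h : Maj (pz p) ρ S) (hρ : 0 ≤ ρ) :
    Maj (ecoef p) ρ (rexp S) ∧ ∀ x : ℂ, ‖x‖ ≤ ρ →
      ∑' i, ecoef p i * x ^ i = cexp (∑' i, pz p i * x ^ i) := by
  have hS := h.nonneg hρ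
  have hexp : HasSum (fun k : ℕ => S ^ k / (Nat.factorial k : ℝ)) (rexp S) := by
    rw [exp_eq_exp_ℝ]; exact NormedSpace.expSeries_div_hasSum_exp S
  have hk : ∀ k : ℕ, Summable fun i => ‖_root_.obell p i k‖ / (Nat.factorial k : ℝ) * ρ ^ i := by
    intro k
    have := (h.obell hρ k).1.1.div_const (Nat.factorial k : ℝ)
    refine this.congr fun i => by ring
  have hk2 : ∀ k : ℕ, ∑' i, ‖_root_.obell p i k‖ / (Nat.factorial k : ℝ) * ρ ^ i ≤
      S ^ k / (Nat.factorial k : ℝ) := by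
    intro k
    have : ∀ i, ‖_root_.obell p i k‖ / (Nat.factorial k : ℝ) * ρ ^ i =
      (‖_root_.obell p i k‖ * ρ ^ i) / (Nat.factorial k : ℝ) := fun i => by ring
    simp_rw [this]
    rw [tsum_div_const]
    gcongr
    exact (h.obell hρ k).1.2
  have hbig : Summable fun q : ℕ × ℕ =>
      ‖_root_.obell p q.2 q.1‖ / (Nat.factorial q.1 : ℝ) * ρ ^ q.2 := by
    rw [summable_prod_of_nonneg (fun q => by positivity)]
    exact ⟨hk, Summable.of_nonneg_of_le (fun k => tsum_nonneg fun i => by positivity) hk2 hexp.summable⟩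
  have htot : ∑' q : ℕ × ℕ, ‖_root_.obell p q.2 q.1‖ / (Nat.factorial q.1 : ℝ) * ρ ^ q.2 ≤
      rexp S := by
    rw [hbig.tsum_prod]
    have h1 := Summable.of_nonneg_of_le (fun k => tsum_nonneg fun i => by positivity) hk2 hexp.summable
    exact (h1.tsum_le_tsum hk2 hexp.summable).trans hexp.tsum_eq.le
  have hsw := (Equiv.prodComm ℕ ℕ).summable_iff.2 hbig
  have htot2 := htot
  rw [← (Equiv.prodComm ℕ ℕ).tsum_eq] at htot2
  have hle : ∀ i, ‖ecoef p i‖ * ρ ^ i ≤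
      ∑' k, ‖_root_.obell p i k‖ / (Nat.factorial k : ℝ) * ρ ^ i := by
    intro i
    rw [tsum_mul_right]
    gcongr
    rw [← (ecoef_eq p i).tsum_eq]
    have hs : Summable fun k => ‖_root_.obell p i k / (Nat.factorial k : ℂ)‖ := by
      apply summable_of_ne_finset_zero (s := range (i+1))
      intro k hk
      rw [obell_eq_zero p (by simpa using hk), zero_div, norm_zero]
    refine (norm_tsum_le_tsum_norm hs).trans (le_of_eq ?_)
    simp
  constructor
  · have hs := hsw.prod
    have hsum : Summable (fun i => ‖ecoef p i‖ * ρ ^ i) :=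
      Summable.of_nonneg_of_le (fun i => by positivity) hle hs
    refine ⟨hsum, (hsum.tsum_le_tsum hle hs).trans ?_⟩
    have h3 := hsw.tsum_prod
    simp only [Function.comp_def, Equiv.prodComm_apply, Prod.swap] at h3 htot2
    rw [h3] at htot2
    exact htot2
  · intro x hx
    have hc : Summable fun q : ℕ × ℕ => _root_.obell p q.2 q.1 / (Nat.factorial q.1 : ℂ) * x ^ q.2 := by
      apply Summable.of_norm
      refine Summable.of_nonneg_of_le (fun q => norm_nonneg _) (fun q => ?_) hbig
      rw [norm_mul, norm_div, norm_pow]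
      simp only [Complex.norm_natCast]
      gcongr
    have h1 : cexp (∑' i, pz p i * x ^ i) =
        ∑' k, ∑' i, _root_.obell p i k / (Nat.factorial k : ℂ) * x ^ i := by
      rw [exp_eq_exp_ℂ, NormedSpace.exp_eq_tsum_div]
      refine tsum_congr fun k => ?_
      rw [← (h.obell hρ k).2 x hx, ← tsum_div_const]
      exact tsum_congr fun i => by ring
    rw [h1, ← hc.tsum_prod, ← (Equiv.prodComm ℕ ℕ).tsum_eq]
    have hcs := (Equiv.prodComm ℕ ℕ).summable_iff.2 hc
    have h2 := hcs.tsum_prod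
    simp only [Function.comp_def, Equiv.prodComm_apply, Prod.swap] at h2 ⊢
    rw [h2]
    refine tsum_congr fun i => ?_
    rw [tsum_mul_right, (ecoef_eq p i).tsum_eq]

end P1

section P2
open Filter Topology

lemma hs_congr {f g : ℕ → ℂ} {a b : ℂ} (h : HasSum f a) (hf : ∀ n, g n = f n) (hb : b = a) :
    HasSum g b := by
  rw [hb, funext hf]; exact h

def bc (a : ℂ) (n : ℕ) : ℂ := (-1:ℂ)^(n+1) * bernoulliPoly (n+1) a / ((n:ℂ) * (n+1))

def lc (N : ℕ) : ℂ := (-1:ℂ)^(N+1) / (N:ℂ)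

def kap (M : ℕ) (a : ℂ) (N : ℕ) : ℂ :=
  lc (N+2) + (a + 1/2) * lc (N+1) - lc (N+1) * a^(N+1)
    + ∑ n ∈ Icc 1 M, bc a n * (if n ≤ N then (-1:ℂ)^(N+1-n) * (Nat.choose N (n-1) : ℂ) else 0)

lemma bern_sum (a : ℂ) (N : ℕ) :
    ∑ k ∈ range (N+1), (Nat.choose (N+1) k : ℂ) * bernoulliPoly k a = (N+1) * a^N := by
  have h := congrArg (Polynomial.aeval a) (Polynomial.sum_bernoulli N)
  rw [map_sum] at h
  simp only [Polynomial.aeval_monomial, map_smul] at h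
  unfold bernoulliPoly
  convert h using 1
  · refine sum_congr rfl fun k _ => ?_
    rw [Algebra.smul_def]; simp
  · simp

lemma bern_zero (a : ℂ) : bernoulliPoly 0 a = 1 := by simp [bernoulliPoly]
lemma bern_one (a : ℂ) : bernoulliPoly 1 a = a - 1/2 := by
  simp [bernoulliPoly, Polynomial.bernoulli_one]

lemma kap_zero (M : ℕ) (a : ℂ) (N : ℕ) (hN : N ≤ M) : kap M a N = 0 := by
  have hs : ∑ n ∈ Icc 1 M, bc a n *
      (if n ≤ N then (-1:ℂ)^(N+1-n) * (Nat.choose N (n-1) : ℂ) else 0)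
      = (-1:ℂ)^N / ((N+1)*(N+2)) *
        ∑ k ∈ range N, (Nat.choose (N+2) (k+2) : ℂ) * bernoulliPoly (k+2) a := by
    rw [mul_sum]
    have : ∑ n ∈ Icc 1 M, bc a n *
      (if n ≤ N then (-1:ℂ)^(N+1-n) * (Nat.choose N (n-1) : ℂ) else 0)
      = ∑ n ∈ Ico 1 (N+1), bc a n * ((-1:ℂ)^(N+1-n) * (Nat.choose N (n-1) : ℂ)) := by
      simp_rw [mul_ite, mul_zero]
      rw [← sum_filter]
      refine sum_congr ?_ fun _ _ => rfl
      ext n; simp only [mem_filter, mem_Icc, mem_Ico]; omega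
    rw [this, sum_Ico_eq_sum_range]
    refine sum_congr (by simp) fun k hk => ?_
    have hkN : k < N := by simpa using hk
    have e1 : (N+2).choose (k+2) * ((k+1) * (k+2)) = (N+2)*(N+1) * N.choose k := by
      have h1 := Nat.add_one_mul_choose_eq (N+1) (k+1)
      have h2 := Nat.add_one_mul_choose_eq N k
      have : (N+2) * ((N+1) * N.choose k) = (N+2).choose (k+2) * (k+2) * (k+1) := by
        rw [h2, ← mul_assoc, h1]
      nlinarith
    have e1c : ((N+2).choose (k+2) : ℂ) * ((k+1) * (k+2)) = (N+2)*(N+1) * N.choose k := by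
      exact_mod_cast e1
    have hN1 : (N:ℂ) + 1 ≠ 0 := Nat.cast_add_one_ne_zero N
    have hN2 : (N:ℂ) + 2 ≠ 0 := by exact_mod_cast (by omega : N + 2 ≠ 0)
    have hk1 : (k:ℂ) + 1 ≠ 0 := Nat.cast_add_one_ne_zero k
    have hk2 : (k:ℂ) + 2 ≠ 0 := by exact_mod_cast (by omega : k + 2 ≠ 0)
    have e2 : ((N+2).choose (k+2) : ℂ) = (N+2)*(N+1) * N.choose k / ((k+1) * (k+2)) := by
      rw [eq_div_iff (by positivity)]; exact e1c
    rw [e2]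
    obtain ⟨r, rfl⟩ : ∃ r, N = k + r := ⟨N - k, by omega⟩
    have e3 : k + r + 1 - (1 + k) = r := by omega
    have e4 : 1 + k + 1 = k + 2 := by omega
    have e5 : (1 + k - 1) = k := by omega
    simp only [bc, e3, e4, e5]
    push_cast at *
    have e6 : (1:ℂ) + k + 1 = k + 2 := by ring
    have e7 : (1:ℂ) + k = k + 1 := by ring
    rw [e6, e7]
    field_simp
    ring
  have hb := bern_sum a (N+1)
  rw [sum_range_succ', sum_range_succ'] at hb
  simp only [Nat.choose_zero_right, bern_zero, zero_add, Nat.choose_one_right, bern_one] at hb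
  have hb2 : ∑ k ∈ range N, (Nat.choose (N+2) (k+2) : ℂ) * bernoulliPoly (k+2) a =
     (N+2) * a^(N+1) - (N+2)*(a-1/2) - 1 := by
    have e : ∀ k, N + 1 + 1 = N + 2 ∧ k + 1 + 1 = k + 2 := fun k => ⟨rfl, rfl⟩
    push_cast at hb ⊢
    simp only [add_assoc, one_add_one_eq_two] at hb ⊢
    linear_combination hb
  rw [kap, hs, hb2]
  have hN1 : (N:ℂ) + 1 ≠ 0 := Nat.cast_add_one_ne_zero N
  have hN2 : (N:ℂ) + 2 ≠ 0 := by exact_mod_cast (by omega : N + 2 ≠ 0)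
  simp only [lc]
  push_cast
  field_simp
  ring

def phi (M : ℕ) (a x : ℂ) : ℂ :=
  (1/x + a + 1/2) * Complex.log (1+x) - 1 - Complex.log (1 + a*x)
   + ∑ n ∈ Icc 1 M, bc a n * (((1+x)⁻¹)^n * x^n - x^n)

lemma log_ser {x : ℂ} (hx : ‖x‖ < 1) : HasSum (fun N => lc (N+1) * x^(N+1)) (Complex.log (1+x)) := by
  have h := hasSum_taylorSeries_log hx
  have h2 := (hasSum_nat_add_iff' 1).2 h
  simp at h2
  refine hs_congr h2 (fun N => ?_) rfl
  simp [lc]; ring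

lemma phi_ser (M : ℕ) {a x : ℂ} (hx : ‖x‖ < 1) (hax : ‖a * x‖ < 1) (hx0 : x ≠ 0) :
    HasSum (fun N => kap M a N * x^(N+1)) (phi M a x) := by
  have h1 := log_ser hx
  have h2 : HasSum (fun N => lc (N+2) * x^(N+1)) (1/x * Complex.log (1+x) - 1) := by
    have h := ((hasSum_nat_add_iff' 1).2 h1).mul_left (1/x)
    refine hs_congr h (fun N => ?_) ?_
    · simp only [pow_succ]; field_simp
    · simp [lc]; field_simp
  have h3 := log_ser hax
  have h4 : ∀ n ∈ Icc 1 M, HasSum (fun N => bc a n * (if n ≤ N then (-1:ℂ)^(N+1-n) *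
      (Nat.choose N (n-1) : ℂ) else 0) * x^(N+1)) (bc a n * (((1+x)⁻¹)^n * x^n - x^n)) := by
    intro n hn
    simp only [mul_assoc]
    apply HasSum.mul_left
    obtain ⟨k, rfl⟩ : ∃ k, n = k + 1 := ⟨n-1, by simp at hn; omega⟩
    have h := hasSum_choose_mul_geometric_of_norm_lt_one k (r := -x) (by simpa using hx)
    have h' := ((hasSum_nat_add_iff' 1).2 h).mul_right (x^(k+1))
    rw [← hasSum_nat_add_iff' (k+1)]
    refine hs_congr h' (fun j => ?_) ?_
    · have : k + 1 ≤ j + (k+1) := by omega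
      rw [if_pos this]
      have e1 : j + (k+1) + 1 - (k+1) = j + 1 := by omega
      have e2 : k + 1 - 1 = k := by omega
      have e3 : j + (k+1) = j + 1 + k := by omega
      rw [e1, e2, e3, neg_pow x]
      ring
    · rw [sum_eq_zero]
      · simp; ring
      · intro i hi
        simp at hi
        rw [if_neg (by omega), zero_mul]
  have h5 := hasSum_sum h4
  have := ((h2.add (h1.mul_left (a+1/2))).sub h3).add h5
  refine hs_congr this (fun N => ?_) ?_
  · simp only [kap, mul_pow, add_mul, sub_mul, sum_mul]
    ring
  · simp only [phi]; ring

lemma bern_bdd (n : ℕ) (a0 : ℝ) : ∃ C, ∀ a : ℂ, ‖a‖ ≤ a0 → ‖bernoulliPoly n a‖ ≤ C := by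
  have hc : Continuous fun a : ℂ => bernoulliPoly n a := by
    unfold bernoulliPoly; exact Polynomial.continuous_aeval _
  obtain ⟨C, hC⟩ := (isCompact_closedBall (0:ℂ) a0).exists_bound_of_continuousOn hc.continuousOn
  exact ⟨C, fun a ha => hC a (by simpa using ha)⟩

lemma bc_bdd (n : ℕ) (a0 : ℝ) : ∃ C, 0 ≤ C ∧ ∀ a : ℂ, ‖a‖ ≤ a0 → ‖bc a n‖ ≤ C := by
  obtain ⟨C, hC⟩ := bern_bdd (n+1) a0
  refine ⟨|C| / ‖((n:ℂ) * (n+1))‖, by positivity, fun a ha => ?_⟩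
  rw [bc, norm_div, norm_mul, norm_pow, norm_neg, norm_one, one_pow, one_mul]
  gcongr
  exact (hC a ha).trans (le_abs_self C)

lemma lc_le (N : ℕ) : ‖lc (N+1)‖ ≤ 1 := by
  rw [lc, norm_div, norm_pow, norm_neg, norm_one, one_pow, Complex.norm_natCast]
  rw [div_le_one (by positivity)]
  push_cast; linarith [(Nat.cast_nonneg N : (0:ℝ) ≤ N)]

lemma kap_bdd (M : ℕ) (a0 : ℝ) (ha0 : 0 ≤ a0) : ∃ C, 0 ≤ C ∧ ∀ a : ℂ, ‖a‖ ≤ a0 → ∀ N, ‖kap M a N‖ ≤ C * (2 + a0)^(N+1) := by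
  choose C hC0 hC using fun n => bc_bdd n a0
  refine ⟨1 + (a0+1/2) + 1 + ∑ n ∈ Icc 1 M, C n, ?_, fun a ha N => ?_⟩
  · have : 0 ≤ ∑ n ∈ Icc 1 M, C n := sum_nonneg fun n _ => hC0 n
    positivity
  have hp : 1 ≤ (2+a0)^(N+1) := one_le_pow₀ (by linarith)
  have h1 : ‖lc (N+2)‖ ≤ 1 * (2+a0)^(N+1) := (lc_le (N+1)).trans (by linarith)
  have h2 : ‖(a + 1/2) * lc (N+1)‖ ≤ (a0+1/2) * (2+a0)^(N+1) := by
    rw [norm_mul]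
    apply mul_le_mul _ ((lc_le N).trans hp) (norm_nonneg _) (by positivity)
    refine (norm_add_le _ _).trans ?_
    norm_num; linarith
  have h3 : ‖lc (N+1) * a^(N+1)‖ ≤ 1 * (2+a0)^(N+1) := by
    rw [norm_mul, norm_pow]
    apply mul_le_mul (lc_le N) _ (by positivity) (by norm_num)
    gcongr; linarith
  have h4 : ‖∑ n ∈ Icc 1 M, bc a n * (if n ≤ N then (-1:ℂ)^(N+1-n) * (Nat.choose N (n-1) : ℂ) else 0)‖
      ≤ (∑ n ∈ Icc 1 M, C n) * (2+a0)^(N+1) := by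
    rw [sum_mul]
    refine (norm_sum_le _ _).trans (sum_le_sum fun n _ => ?_)
    rw [norm_mul]
    apply mul_le_mul (hC n a ha) _ (by positivity) (hC0 n)
    split_ifs
    · rw [norm_mul, norm_pow, norm_neg, norm_one, one_pow, one_mul, Complex.norm_natCast]
      have : (Nat.choose N (n-1) : ℝ) ≤ 2^N := by exact_mod_cast Nat.choose_le_two_pow N (n-1)
      refine this.trans ?_
      calc (2:ℝ)^N ≤ 2^(N+1) := by gcongr <;> norm_num
        _ ≤ _ := by gcongr; linarith
    · simp; positivity
  rw [kap]
  refine (norm_add_le _ _).trans ?_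
  refine (add_le_add ((norm_sub_le _ _).trans (add_le_add (norm_add_le _ _) le_rfl)) le_rfl).trans ?_
  nlinarith

lemma phi_bdd (M : ℕ) (a0 : ℝ) (ha0 : 0 ≤ a0) : ∃ C, 0 ≤ C ∧ ∀ a x : ℂ, ‖a‖ ≤ a0 →
    ‖x‖ ≤ 1/(2*(2+a0)) → x ≠ 0 → ‖phi M a x‖ ≤ C * ‖x‖^(M+2) := by
  obtain ⟨C, hC0, hC⟩ := kap_bdd M a0 ha0
  refine ⟨C * (2+a0)^(M+2) * 2, by positivity, fun a x ha hx hx0 => ?_⟩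
  have hx2 : ‖x‖ * (2+a0) ≤ 1/2 := by
    rw [le_div_iff₀ (by positivity)] at hx; linarith
  have hx1 : ‖x‖ < 1 := by nlinarith [norm_nonneg x]
  have hax : ‖a * x‖ < 1 := by
    rw [norm_mul]; nlinarith [norm_nonneg x, norm_nonneg a]
  have hs := phi_ser M hx1 hax hx0
  rw [← hasSum_nat_add_iff' (M+1)] at hs
  rw [sum_eq_zero (fun i hi => by rw [kap_zero M a i (by simp at hi; omega), zero_mul]), sub_zero] at hs
  have hg : HasSum (fun j : ℕ => C * (2+a0)^(M+2) * ‖x‖^(M+2) * (1/2:ℝ)^j) (C * (2+a0)^(M+2) * ‖x‖^(M+2) * 2) := by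
    apply HasSum.mul_left; exact hasSum_geometric_two
  have := hs.norm_le_of_bounded hg (fun j => ?_)
  · rw [← hs.tsum_eq] at this ⊢
    linarith
  · rw [norm_mul, norm_pow]
    calc ‖kap M a (j+(M+1))‖ * ‖x‖^(j+(M+1)+1) ≤ C*(2+a0)^(j+(M+1)+1) * ‖x‖^(j+(M+1)+1) := by
          gcongr; exact hC a ha _
      _ = C * (2+a0)^(M+2) * ‖x‖^(M+2) * (‖x‖*(2+a0))^j := by rw [mul_pow]; ring
      _ ≤ _ := by gcongr

end P2

section P3
open Filter Topology

lemma log_mul_rhp {w y : ℂ} (hw0 : w ≠ 0) (hw : 0 ≤ w.re) (hy : 0 < y.re) :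
    Complex.log (w * y) = Complex.log w + Complex.log y := by
  have hy0 : y ≠ 0 := by rintro rfl; simp at hy
  have h1 := abs_arg_le_pi_div_two_iff.2 hw
  have h2 := abs_arg_lt_pi_div_two_iff.2 (Or.inl hy)
  rw [abs_le] at h1
  rw [abs_lt] at h2
  apply Complex.log_mul hw0 hy0
  constructor <;> linarith

def GM (M : ℕ) (a w : ℂ) : ℂ :=
  (w + a - 1/2) * Complex.log w - w + ∑ n ∈ Icc 1 M, bc a n * (w⁻¹)^n

lemma re_one_add_pos {y : ℂ} (hy : ‖y‖ < 1) : 0 < (1 + y).re := by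
  have := abs_re_le_norm y
  rw [abs_le] at this
  simp; linarith

lemma GM_step (M : ℕ) {a w : ℂ} (hw : 0 ≤ w.re) (h1 : 1 < ‖w‖) (h2 : ‖a‖ < ‖w‖) :
    Complex.log (w + a) = GM M a (w+1) - GM M a w - phi M a w⁻¹ := by
  have hw0 : w ≠ 0 := by rintro rfl; simp at h1; linarith
  have hwn : 0 < ‖w‖ := norm_pos_iff.2 hw0
  have e1 : Complex.log (w + 1) = Complex.log w + Complex.log (1 + w⁻¹) := by
    rw [← log_mul_rhp hw0 hw]
    · congr 1; field_simp
    · apply re_one_add_pos; rw [norm_inv]; exact inv_lt_one_of_one_lt₀ h1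
  have e2 : Complex.log (w + a) = Complex.log w + Complex.log (1 + a * w⁻¹) := by
    rw [← log_mul_rhp hw0 hw]
    · congr 1; field_simp
    · apply re_one_add_pos; rw [norm_mul, norm_inv, ← div_eq_mul_inv, div_lt_one hwn]; exact h2
  have hw1 : w + 1 ≠ 0 := by
    intro h
    have := congrArg re h
    simp at this; linarith
  have e3 : ∀ n : ℕ, ((1 + w⁻¹)⁻¹)^n * (w⁻¹)^n = ((w+1)⁻¹)^n := by
    intro n
    rw [← mul_pow, ← mul_inv]; congr 2; field_simp
  simp only [GM, phi, e1, e2, e3, mul_sub, sum_sub_distrib, one_div, inv_inv]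
  ring

def dterm (z1 z2 : ℂ) (k : ℕ) : ℂ :=
  Complex.log (z2 + k) - Complex.log (z1 + k) + (z1 - z2) * (Real.log (((k:ℝ)+1)/k) : ℂ)

def DD (z1 z2 : ℂ) : ℂ := ∑' k, dterm z1 z2 k

lemma DD_swap (z1 z2 : ℂ) : DD z2 z1 = - DD z1 z2 := by
  unfold DD
  rw [← tsum_neg]
  congr 1; ext k; unfold dterm; ring

lemma dterm_sum (z1 z2 : ℂ) (n : ℕ) : ∑ k ∈ range n, dterm z1 z2 k =
    (z1 - z2) * (Real.log n : ℂ) + ∑ k ∈ range n, (Complex.log (z2 + k) - Complex.log (z1 + k)) := by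
  induction n with
  | zero => simp
  | succ n ih =>
    rw [sum_range_succ, ih, sum_range_succ, dterm]
    have : Real.log ((n+1 : ℕ):ℝ) = Real.log n + Real.log (((n:ℝ)+1)/n) := by
      rcases Nat.eq_zero_or_pos n with rfl | hn
      · simp
      · rw [log_div (by positivity) (by positivity)]; push_cast; ring
    rw [this]; push_cast; ring

lemma log_add_nat {z : ℂ} {k : ℕ} (hk : 0 < k) (hz : ‖z‖ ≤ k / 2) :
    ‖Complex.log (z + k) - (Real.log k : ℂ) - z / k‖ ≤ ‖z‖^2 / k^2 := by
  have hk' : (0:ℝ) < k := by exact_mod_cast hk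
  have hkc : (k:ℂ) ≠ 0 := by exact_mod_cast hk.ne'
  have hy : ‖z / (k:ℂ)‖ ≤ 1/2 := by
    rw [norm_div, Complex.norm_natCast, div_le_iff₀ hk']; linarith
  have e : z + k = ((k:ℝ):ℂ) * (1 + z / k) := by push_cast; field_simp; ring
  have hne : 1 + z / (k:ℂ) ≠ 0 := by
    intro h
    have := re_one_add_pos (lt_of_le_of_lt hy (by norm_num))
    rw [h] at this; simp at this
  rw [e, log_ofReal_mul hk' hne]
  have h := norm_log_one_add_sub_self_le (lt_of_le_of_lt hy (by norm_num : (1/2:ℝ) < 1))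
  have e2 : ((Real.log k:ℝ):ℂ) + Complex.log (1 + z / k) - (Real.log k : ℂ) - z / k =
    Complex.log (1 + z / k) - z / k := by ring
  rw [e2]
  refine h.trans ?_
  have : (1 - ‖z / (k:ℂ)‖)⁻¹ ≤ 2 := by
    rw [inv_le_comm₀ (by linarith) (by norm_num)]; linarith
  calc ‖z / (k:ℂ)‖^2 * (1 - ‖z / (k:ℂ)‖)⁻¹ / 2 ≤ ‖z / (k:ℂ)‖^2 * 2 / 2 := by gcongr
    _ = _ := by rw [norm_div, Complex.norm_natCast]; ring

lemma dterm_bdd {z1 z2 : ℂ} {R : ℝ} (h1 : ‖z1‖ ≤ R) (h2 : ‖z2‖ ≤ R) {k : ℕ} (hk : 2 ≤ k) (hkR : 2 * R ≤ k) :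
    ‖dterm z1 z2 k‖ ≤ (2 * R^2 + 2 * R) * (1 / (k:ℝ)^2) := by
  have hk0 : 0 < k := by omega
  have hk' : (0:ℝ) < k := by exact_mod_cast hk0
  have hkc : (k:ℂ) ≠ 0 := by exact_mod_cast hk0.ne'
  have hR : 0 ≤ R := (norm_nonneg _).trans h1
  have b1 := log_add_nat hk0 (z := z1) (by linarith)
  have b2 := log_add_nat hk0 (z := z2) (by linarith)
  have b3 := log_add_nat hk0 (z := 1) (by
    have : (2:ℝ) ≤ k := by exact_mod_cast hk
    simp; linarith)
  have e3 : Complex.log (1 + k) - (Real.log k : ℂ) = (Real.log (((k:ℝ)+1)/k) : ℂ) := by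
    rw [log_div (by positivity) (by positivity)]
    push_cast [ofReal_log (by positivity : (0:ℝ) ≤ (k:ℝ)+1)]
    rw [add_comm (1:ℂ)]
  rw [e3] at b3
  have e : dterm z1 z2 k = (Complex.log (z2 + k) - (Real.log k : ℂ) - z2 / k) -
      (Complex.log (z1 + k) - (Real.log k : ℂ) - z1 / k) +
      (z1 - z2) * ((Real.log (((k:ℝ)+1)/k) : ℂ) - 1 / k) := by
    unfold dterm; ring
  rw [e]
  refine (norm_add_le _ _).trans ((add_le_add (norm_sub_le _ _) le_rfl).trans ?_)
  rw [norm_mul]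
  have h12 : ‖z1 - z2‖ ≤ 2 * R := (norm_sub_le _ _).trans (by linarith)
  have c1 : ‖z1‖^2 / (k:ℝ)^2 ≤ R^2 / k^2 := by gcongr
  have c2 : ‖z2‖^2 / (k:ℝ)^2 ≤ R^2 / k^2 := by gcongr
  have c3 : ‖z1 - z2‖ * ‖((Real.log (((k:ℝ)+1)/k) : ℂ) - 1 / k)‖ ≤ (2 * R) * (1 / k^2) := by
    apply mul_le_mul h12 _ (norm_nonneg _) (by positivity)
    simpa using b3
  calc _ ≤ R^2 / k^2 + R^2/k^2 + (2 * R) * (1 / (k:ℝ)^2) := by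
        linarith
    _ = _ := by ring

lemma sq_summ (C : ℝ) : Summable (fun k : ℕ => C * (1 / (k:ℝ)^2)) :=
  (summable_one_div_nat_pow.2 (by norm_num)).mul_left C

lemma dterm_ev (R : ℝ) : ∀ᶠ k : ℕ in atTop, ∀ z1 z2 : ℂ, ‖z1‖ ≤ R → ‖z2‖ ≤ R →
    ‖dterm z1 z2 k‖ ≤ (2 * R^2 + 2 * R) * (1 / (k:ℝ)^2) := by
  filter_upwards [eventually_ge_atTop 2, tendsto_natCast_atTop_atTop.eventually_ge_atTop (2*R)] with k hk hkR
  intro z1 z2 h1 h2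
  exact dterm_bdd h1 h2 hk hkR

lemma dterm_summable (z1 z2 : ℂ) : Summable (dterm z1 z2) := by
  apply Summable.of_norm_bounded_eventually_nat (sq_summ (2 * (max ‖z1‖ ‖z2‖)^2 + 2 * max ‖z1‖ ‖z2‖))
  filter_upwards [dterm_ev (max ‖z1‖ ‖z2‖)] with k hk
  exact hk z1 z2 (le_max_left _ _) (le_max_right _ _)

lemma log_ratio_tendsto : Tendsto (fun n : ℕ => (Real.log (((n:ℝ)+1)/n) : ℂ)) atTop (𝓝 0) := by
  have h : Tendsto (fun n : ℕ => ((n:ℝ)+1)/n) atTop (𝓝 1) := by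
    have h0 : Tendsto (fun n : ℕ => 1 + 1/(n:ℝ)) atTop (𝓝 (1+0)) :=
      tendsto_const_nhds.add tendsto_one_div_atTop_nhds_zero_nat
    rw [add_zero] at h0
    refine h0.congr' ?_
    filter_upwards [eventually_gt_atTop 0] with n hn
    have : (n:ℝ) ≠ 0 := by exact_mod_cast hn.ne'
    field_simp
  have h2 := (continuousAt_log one_ne_zero).tendsto.comp h
  rw [Real.log_one] at h2
  have := (continuous_ofReal.tendsto 0).comp h2
  simpa [Function.comp_def] using this

lemma exp_DD {z1 z2 : ℂ} (h1 : ∀ k : ℕ, z1 + k ≠ 0) (h2 : ∀ k : ℕ, z2 + k ≠ 0) :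
    cexp (DD z1 z2) = Complex.Gamma z1 / Complex.Gamma z2 := by
  have hg2 : Complex.Gamma z2 ≠ 0 := Complex.Gamma_ne_zero fun m hm => h2 m (by rw [hm]; ring)
  have ht := (Complex.GammaSeq_tendsto_Gamma z1).div (Complex.GammaSeq_tendsto_Gamma z2) hg2
  have hs : Tendsto (fun n => ∑ k ∈ range (n+1), dterm z1 z2 k - (z1 - z2) * (Real.log (((n:ℝ)+1)/n) : ℂ))
      atTop (𝓝 (DD z1 z2)) := by
    have a1 := (tendsto_add_atTop_iff_nat 1).2 (dterm_summable z1 z2).hasSum.tendsto_sum_nat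
    have a2 := a1.sub (log_ratio_tendsto.const_mul (z1 - z2))
    simpa [DD] using a2
  have he := (Complex.continuous_exp.tendsto _).comp hs
  refine tendsto_nhds_unique (he.congr' ?_) ht
  filter_upwards [eventually_gt_atTop 0] with n hn
  have hnc : (n:ℂ) ≠ 0 := by exact_mod_cast hn.ne'
  have hnr : (0:ℝ) < n := by exact_mod_cast hn
  simp only [Function.comp, Pi.div_apply]
  rw [dterm_sum]
  have e : (z1 - z2) * (Real.log (n+1 : ℕ) : ℂ) + ∑ k ∈ range (n+1), (Complex.log (z2 + k) - Complex.log (z1 + k))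
      - (z1 - z2) * (Real.log (((n:ℝ)+1)/n) : ℂ) =
      (z1 - z2) * (Real.log n : ℂ) + ∑ k ∈ range (n+1), (Complex.log (z2 + k) - Complex.log (z1 + k)) := by
    rw [log_div (by positivity) (by positivity)]; push_cast; ring
  rw [e, Complex.exp_add, Complex.exp_sum]
  simp_rw [Complex.exp_sub, Complex.exp_log (h1 _), Complex.exp_log (h2 _)]
  rw [prod_div_distrib, Complex.GammaSeq, Complex.GammaSeq]
  have hp1 : ∏ j ∈ range (n+1), (z1 + j) ≠ 0 := prod_ne_zero_iff.2 fun j _ => h1 j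
  have hp2 : ∏ j ∈ range (n+1), (z2 + j) ≠ 0 := prod_ne_zero_iff.2 fun j _ => h2 j
  have hf : ((Nat.factorial n : ℕ) : ℂ) ≠ 0 := by exact_mod_cast Nat.factorial_ne_zero n
  rw [sub_mul, Complex.exp_sub, cpow_def_of_ne_zero hnc, cpow_def_of_ne_zero hnc,
    ← natCast_log, mul_comm z1, mul_comm z2]
  have := Complex.exp_ne_zero ((Real.log n:ℂ) * z2)
  field_simp

def DS (s : ℂ) : ℂ := DD ((1-s)/2) (s/2)

lemma slit_of {s : ℂ} (hs : s ∈ RSOmega) (k : ℕ) : s/2 + k ∈ slitPlane ∧ (1-s)/2 + k ∈ slitPlane := by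
  have hk : (0:ℝ) ≤ k := Nat.cast_nonneg k
  rcases hs with h | h
  · constructor
    · right; simp; exact h
    · right; simp; exact h
  · constructor
    · left; simp; linarith
    · left; simp; linarith

lemma DS_cont {S : Set ℂ} (hS : S ⊆ RSOmega) {R : ℝ} (hR : ∀ s ∈ S, ‖s‖ ≤ R) : ContinuousOn DS S := by
  have hu : TendstoUniformlyOn (fun N s => ∑ n ∈ range N, dterm ((1-s)/2) (s/2) n)
      (fun s => ∑' n, dterm ((1-s)/2) (s/2) n) atTop S := by
    apply tendstoUniformlyOn_tsum_nat_eventually (sq_summ (2 * (R+1)^2 + 2 * (R+1)))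
    filter_upwards [dterm_ev (R+1)] with k hk s hs
    have := hR s hs
    apply hk
    · rw [norm_div]
      have := norm_sub_le 1 s
      simp at this ⊢
      linarith [norm_nonneg s]
    · rw [norm_div]; simp; linarith [norm_nonneg s]
  apply hu.continuousOn
  refine Frequently.of_forall fun N => ?_
  apply continuousOn_finsetSum
  intro k _
  unfold dterm
  apply ContinuousOn.add
  · apply ContinuousOn.sub
    · exact ContinuousOn.clog (by fun_prop) fun s hs => (slit_of (hS hs) k).1
    · exact ContinuousOn.clog (by fun_prop) fun s hs => (slit_of (hS hs) k).2
  · fun_prop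

lemma const_of_exp {F : ℝ → ℂ} (hF : ContinuousOn F (Set.Icc 0 1)) (h0 : F 0 = 0)
    (he : ∀ x ∈ Set.Icc (0:ℝ) 1, cexp (F x) = 1) : F 1 = 0 := by
  have hint : ∀ x ∈ Set.Icc (0:ℝ) 1, ∃ n : ℤ, F x = n * (2 * π * I) := fun x hx =>
    exp_eq_one_iff.1 (he x hx)
  have hc : ContinuousOn (fun x => (F x).im) (Set.Icc 0 1) := continuous_im.comp_continuousOn hF
  obtain ⟨n, hn⟩ := hint 1 (by simp)
  have hval : (F 1).im = n * (2*π) := by rw [hn]; simp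
  have key : ∀ y : ℝ, (y ∈ Set.uIcc 0 (F 1).im) → ∃ m : ℤ, y = m * (2*π) := by
    intro y hy
    have := intermediate_value_uIcc (a := (0:ℝ)) (b := 1) (f := fun x => (F x).im) (by simpa using hc)
    simp only [h0, zero_im] at this
    obtain ⟨x, hx, hxy⟩ := this hy
    obtain ⟨m, hm⟩ := hint x (by simpa using hx)
    refine ⟨m, ?_⟩
    simp only at hxy
    rw [← hxy, hm]; simp
  have hpi := pi_pos
  rcases lt_trichotomy n 0 with h | h | h
  · exfalso
    have : (n:ℝ) ≤ -1 := by exact_mod_cast (by omega : n ≤ -1)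
    obtain ⟨m, hm⟩ := key (-π) (by rw [Set.mem_uIcc]; right; constructor <;> nlinarith)
    have h2 : (2 * m : ℝ) = -1 := by
      have : (2 * (m:ℝ) + 1) * π = 0 := by linarith
      rcases mul_eq_zero.1 this with h | h <;> linarith
    have : (2 * m : ℤ) = -1 := by exact_mod_cast h2
    omega
  · rw [hn, h]; simp
  · exfalso
    have : (1:ℝ) ≤ n := by exact_mod_cast (by omega : 1 ≤ n)
    obtain ⟨m, hm⟩ := key π (by rw [Set.mem_uIcc]; left; constructor <;> nlinarith)
    have h2 : (2 * m : ℝ) = 1 := by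
      have : (2 * (m:ℝ) - 1) * π = 0 := by linarith
      rcases mul_eq_zero.1 this with h | h <;> linarith
    have : (2 * m : ℤ) = 1 := by exact_mod_cast h2
    omega

lemma exp_DS {s : ℂ} (hs : s ∈ RSOmega) :
    cexp ((s - 1/2) * (Real.log π : ℂ) + DS s) = chi s := by
  have hpi : (π:ℂ) ≠ 0 := by exact_mod_cast pi_ne_zero
  rw [Complex.exp_add, DS, exp_DD (fun k => slitPlane_ne_zero (slit_of hs k).2)
    (fun k => slitPlane_ne_zero (slit_of hs k).1), chi, cpow_def_of_ne_zero hpi,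
    ofReal_log pi_pos.le, mul_comm (s - 1/2), mul_div_assoc]

lemma theta_eq {ϑ : ℂ → ℂ} (hϑ : IsRSTheta ϑ) {s : ℂ} (hs : s.im ≠ 0) :
    -2 * I * ϑ s = (s - 1/2) * (Real.log π : ℂ) + DS s := by
  obtain ⟨hd, he, h0⟩ := hϑ
  set γ : ℝ → ℂ := fun x => 1/2 + x * (s - 1/2) with hγ
  have hγm : ∀ x ∈ Set.Icc (0:ℝ) 1, γ x ∈ RSOmega := by
    intro x hx
    rcases eq_or_lt_of_le hx.1 with h | h
    · right; simp [hγ, ← h]; norm_num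
    · left; simp [hγ]; exact ⟨h.ne', hs⟩
  have hγc : Continuous γ := by fun_prop
  have hγb : ∃ R, ∀ z ∈ γ '' Set.Icc 0 1, ‖z‖ ≤ R := by
    obtain ⟨R, hR⟩ := (isCompact_Icc (a := (0:ℝ)) (b := 1)).exists_bound_of_continuousOn hγc.continuousOn
    exact ⟨R, by rintro _ ⟨x, hx, rfl⟩; exact hR x hx⟩
  obtain ⟨R, hR⟩ := hγb
  have hsub : γ '' Set.Icc 0 1 ⊆ RSOmega := by rintro _ ⟨x, hx, rfl⟩; exact hγm x hx
  have hDc : ContinuousOn (fun x => DS (γ x)) (Set.Icc 0 1) :=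
    (DS_cont hsub hR).comp hγc.continuousOn (Set.mapsTo_image _ _)
  have hTc : ContinuousOn (fun x => ϑ (γ x)) (Set.Icc 0 1) :=
    hd.continuousOn.comp hγc.continuousOn hγm
  have hF := const_of_exp (F := fun x => -2 * I * ϑ (γ x) - ((γ x - 1/2) * (Real.log π : ℂ) + DS (γ x))) ?_ ?_ ?_
  · have hg1 : γ 1 = s := by simp [hγ]
    simp only [hg1] at hF
    exact sub_eq_zero.1 hF
  · exact ContinuousOn.sub (continuousOn_const.mul hTc) (ContinuousOn.add (by fun_prop) hDc)
  · have hg0 : γ 0 = 1/2 := by simp [hγ]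
    simp only [hg0, h0]
    have : DS (1/2) = 0 := by
      have := DD_swap ((1 - 1/2)/2) (1/2/2)
      rw [DS]
      have e : ((1:ℂ) - 1/2)/2 = 1/2/2 := by norm_num
      rw [e] at this ⊢
      have h2 : 2 * DD (1/2/2) (1/2/2) = 0 := by linear_combination this
      simpa using h2
    rw [this]; ring
  · intro x hx
    rw [Complex.exp_sub, he _ (hγm x hx), exp_DS (hγm x hx), div_self]
    rw [← he _ (hγm x hx)]; exact Complex.exp_ne_zero _

lemma theta_neg {ϑ : ℂ → ℂ} (hϑ : IsRSTheta ϑ) {s : ℂ} (hs : s.im ≠ 0) : ϑ (1 - s) = - ϑ s := by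
  have h1 := theta_eq hϑ hs
  have h2 := theta_eq hϑ (s := 1 - s) (by simpa using hs)
  have h3 : DS (1 - s) = - DS s := by
    unfold DS
    rw [← DD_swap]; congr 2; ring
  rw [h3] at h2
  have : (-2 * I) * (ϑ (1-s) + ϑ s) = 0 := by linear_combination h1 + h2
  rcases mul_eq_zero.1 this with h | h
  · simp at h
  · linear_combination h

end P3

section P4
open Filter Topology

lemma inv_nat_tendsto (w : ℂ) : Tendsto (fun n : ℕ => (w + n)⁻¹) atTop (𝓝 0) := by
  apply tendsto_inv₀_cobounded.comp
  have : Tendsto (fun n : ℕ => (n:ℂ)) atTop (Bornology.cobounded ℂ) := by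
    rw [← tendsto_norm_atTop_iff_cobounded]
    simpa using tendsto_natCast_atTop_atTop
  rw [← tendsto_norm_atTop_iff_cobounded] at this ⊢
  have h2 := tendsto_atTop_add_const_right atTop (-‖w‖) this
  refine tendsto_atTop_mono (fun n => ?_) h2
  have := norm_sub_le (w + n) w
  simp only [add_sub_cancel_left] at this
  linarith

lemma GM_lim (M : ℕ) (a w : ℂ) :
    Tendsto (fun n : ℕ => GM M a (w+n) - (w + a + n - 1/2) * (Real.log n : ℂ) + n) atTop (𝓝 0) := by
  have h1 : Tendsto (fun n : ℕ => (n:ℂ) * Complex.log (1 + w/n)) atTop (𝓝 w) := by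
    apply Complex.tendsto_nat_mul_log_one_add_of_tendsto
    refine tendsto_const_nhds.congr' ?_
    filter_upwards [eventually_gt_atTop 0] with n hn
    have : (n:ℂ) ≠ 0 := by exact_mod_cast hn.ne'
    field_simp
  have h0 : Tendsto (fun n : ℕ => ((0:ℂ) + n)⁻¹) atTop (𝓝 0) := inv_nat_tendsto 0
  have h2 : Tendsto (fun n : ℕ => Complex.log (1 + w/n)) atTop (𝓝 0) := by
    have := h0.mul h1
    rw [zero_mul] at this
    refine this.congr' ?_
    filter_upwards [eventually_gt_atTop 0] with n hn
    have : (n:ℂ) ≠ 0 := by exact_mod_cast hn.ne'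
    simp; field_simp
  have h3 : Tendsto (fun n : ℕ => ∑ j ∈ Icc 1 M, bc a j * ((w + n)⁻¹)^j) atTop (𝓝 0) := by
    have : Tendsto (fun n : ℕ => ∑ j ∈ Icc 1 M, bc a j * ((w + n)⁻¹)^j) atTop
        (𝓝 (∑ j ∈ Icc 1 M, bc a j * 0^j)) :=
      tendsto_finsetSum _ fun j _ => ((inv_nat_tendsto w).pow j).const_mul _
    rwa [sum_eq_zero] at this
    intro j hj
    simp at hj
    rw [zero_pow (by omega), mul_zero]
  have h4 := (((h2.const_mul (w + a - 1/2)).add h1).sub_const w).add h3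
  have e : (w + a - 1/2) * 0 + w - w + 0 = 0 := by ring
  rw [e] at h4
  refine h4.congr' ?_
  filter_upwards [eventually_gt_atTop 0, tendsto_natCast_atTop_atTop.eventually_gt_atTop (‖w‖)] with n hn hnw
  have hk' : (0:ℝ) < n := by exact_mod_cast hn
  have hnc : (n:ℂ) ≠ 0 := by exact_mod_cast hn.ne'
  have hne : 1 + w / (n:ℂ) ≠ 0 := by
    intro h
    have := re_one_add_pos (y := w / (n:ℂ)) (by rw [norm_div, Complex.norm_natCast, div_lt_one hk']; exact hnw)
    rw [h] at this; simp at this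
  have e2 : Complex.log (w + n) = Real.log n + Complex.log (1 + w/n) := by
    rw [← log_ofReal_mul hk' hne]; congr 1; push_cast; field_simp; ring
  rw [GM, e2]; ring

lemma shift_ge {w : ℂ} (hw : 0 ≤ w.re) (k : ℕ) : ‖w‖ ≤ ‖w + k‖ ∧ (k:ℝ) ≤ ‖w + k‖ := by
  have hk : (0:ℝ) ≤ k := Nat.cast_nonneg k
  constructor
  · rw [← sqrt_sq (norm_nonneg w), ← sqrt_sq (norm_nonneg (w+k)), Complex.sq_norm, Complex.sq_norm,
      normSq_apply, normSq_apply]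
    apply sqrt_le_sqrt
    simp; nlinarith
  · have := re_le_norm (w + k)
    simp at this; linarith

lemma phi_sum (M : ℕ) (a0 : ℝ) (ha0 : 0 ≤ a0) : ∃ C, 0 ≤ C ∧ ∀ a w : ℂ, ‖a‖ ≤ a0 → 0 ≤ w.re →
    2*(2+a0) ≤ ‖w‖ → ∀ n : ℕ, ‖∑ k ∈ range n, phi M a (w + k)⁻¹‖ ≤ C * (‖w‖⁻¹)^M := by
  obtain ⟨C, hC0, hC⟩ := phi_bdd M a0 ha0
  have hsm : Summable (fun k : ℕ => 4 * (1 / ((k:ℝ)+1)^2)) := by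
    apply Summable.mul_left
    have := (summable_nat_add_iff 1).2 (summable_one_div_nat_pow.2 (by norm_num : 1 < 2))
    simpa using this
  refine ⟨C * ∑' k : ℕ, 4 * (1 / ((k:ℝ)+1)^2), by positivity, fun a w ha hw hwn n => ?_⟩
  have hw0 : 0 < ‖w‖ := by linarith
  refine (norm_sum_le _ _).trans ?_
  have hb : ∀ k : ℕ, ‖phi M a (w + k)⁻¹‖ ≤ (C * (‖w‖⁻¹)^M) * (4 * (1 / ((k:ℝ)+1)^2)) := by
    intro k
    obtain ⟨s1, s2⟩ := shift_ge hw k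
    have hp : 0 < ‖w + k‖ := by linarith
    have hxn : ‖(w+k)⁻¹‖ ≤ 1/(2*(2+a0)) := by
      rw [norm_inv, ← one_div]; apply one_div_le_one_div_of_le (by positivity); linarith
    refine (hC a _ ha hxn (inv_ne_zero (norm_pos_iff.1 hp))).trans ?_
    rw [pow_add, mul_assoc C, norm_inv]
    have i1 : (‖w+k‖⁻¹)^M ≤ (‖w‖⁻¹)^M := by gcongr
    have i2 : (‖w+k‖⁻¹)^2 ≤ 4 * (1 / ((k:ℝ)+1)^2) := by
      have : ‖w+k‖⁻¹ ≤ (((k:ℝ)+1)/2)⁻¹ := by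
        gcongr; linarith
      calc (‖w+k‖⁻¹)^2 ≤ ((((k:ℝ)+1)/2)⁻¹)^2 := by gcongr
        _ = _ := by field_simp; norm_num
    gcongr
  refine (sum_le_sum fun k _ => hb k).trans ?_
  rw [← mul_sum, mul_right_comm]
  gcongr
  exact hsm.sum_le_tsum _ (fun k _ => by positivity)

lemma DD_asym (M : ℕ) (a0 : ℝ) (ha0 : 0 ≤ a0) : ∃ C, 0 ≤ C ∧ ∀ a1 a2 w1 w2 : ℂ, ‖a1‖ ≤ a0 → ‖a2‖ ≤ a0 →
    0 ≤ w1.re → 0 ≤ w2.re → 2*(2+a0) ≤ ‖w1‖ → 2*(2+a0) ≤ ‖w2‖ →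
    ‖DD (w1+a1) (w2+a2) - (GM M a1 w1 - GM M a2 w2)‖ ≤ C * ((‖w1‖⁻¹)^M + (‖w2‖⁻¹)^M) := by
  obtain ⟨C, hC0, hC⟩ := phi_sum M a0 ha0
  refine ⟨C, hC0, fun a1 a2 w1 w2 ha1 ha2 hr1 hr2 hn1 hn2 => ?_⟩
  have hs := (dterm_summable (w1+a1) (w2+a2)).hasSum.tendsto_sum_nat
  have hl := (GM_lim M a2 w2).sub (GM_lim M a1 w1)
  have ht := ((hs.sub hl).sub_const (GM M a1 w1 - GM M a2 w2)).norm
  rw [sub_zero, sub_zero] at ht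
  refine le_of_tendsto ht (Eventually.of_forall fun n => ?_)
  have tel : ∀ (a w : ℂ), ‖a‖ ≤ a0 → 0 ≤ w.re → 2*(2+a0) ≤ ‖w‖ →
      ∑ k ∈ range n, Complex.log (w + a + k) = GM M a (w+n) - GM M a w
        - ∑ k ∈ range n, phi M a (w+k)⁻¹ := by
    intro a w ha hr hn
    have h1 : ∀ k : ℕ, Complex.log (w + a + k) =
        (GM M a (w + (k+1 : ℕ)) - GM M a (w + k)) - phi M a (w+k)⁻¹ := by
      intro k
      have := (shift_ge hr k).1
      have h := GM_step M (a := a) (w := w + k) (by simp; positivity) (by linarith) (by linarith)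
      rw [add_right_comm, h]; push_cast; ring_nf
    rw [sum_congr rfl fun k _ => h1 k, sum_sub_distrib,
      sum_range_sub (fun k : ℕ => GM M a (w + k))]
    simp
  have e : ∑ k ∈ range n, dterm (w1+a1) (w2+a2) k -
      ((GM M a2 (w2 + n) - (w2 + a2 + n - 1/2) * (Real.log n : ℂ) + n) -
       (GM M a1 (w1 + n) - (w1 + a1 + n - 1/2) * (Real.log n : ℂ) + n)) - (GM M a1 w1 - GM M a2 w2) =
      ∑ k ∈ range n, phi M a1 (w1+k)⁻¹ - ∑ k ∈ range n, phi M a2 (w2+k)⁻¹ := by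
    rw [dterm_sum, sum_sub_distrib, tel a1 w1 ha1 hr1 hn1, tel a2 w2 ha2 hr2 hn2]
    ring
  rw [e]
  refine (norm_sub_le _ _).trans ?_
  rw [mul_add]
  exact add_le_add (hC a1 w1 ha1 hr1 hn1 n) (hC a2 w2 ha2 hr2 hn2 n)

def th0 (s : ℂ) (M : ℕ) : ℂ := ((1/2 - s)/2) * (Real.log (s.im / (2*π)) : ℂ) + I * (s.im/2 + π/8)
  + ∑ j ∈ Icc 1 M, fseq s.re j * (2 * I / s.im)^j

lemma GM_diff (M : ℕ) {s : ℂ} (ht : 0 < s.im) :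
    GM M ((1 - s.re)/2) (-(I * s.im/2)) - GM M (s.re/2) (I * s.im/2) =
      2 * th0 s M - (s - 1/2) * (Real.log π : ℂ) := by
  have htc : (s.im:ℂ) ≠ 0 := by exact_mod_cast ht.ne'
  have hl1 : Complex.log (I * s.im/2) = (Real.log (s.im/2) : ℂ) + I * π/2 := by
    have : I * (s.im:ℂ)/2 = ((s.im/2 : ℝ):ℂ) * I := by push_cast; ring
    rw [this, log_ofReal_mul (by positivity) I_ne_zero, log_I]; ring
  have hl2 : Complex.log (-(I * s.im/2)) = (Real.log (s.im/2) : ℂ) - I * π/2 := by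
    have : -(I * (s.im:ℂ)/2) = ((s.im/2 : ℝ):ℂ) * (-I) := by push_cast; ring
    rw [this, log_ofReal_mul (by positivity) (neg_ne_zero.2 I_ne_zero), log_neg_I]; ring
  have hl3 : Real.log (s.im / (2*π)) = Real.log (s.im/2) - Real.log π := by
    rw [← div_div, log_div (by positivity) pi_ne_zero]
  have hsum : ∑ n ∈ Icc 1 M, bc ((1 - s.re)/2) n * ((-(I * (s.im:ℂ)/2))⁻¹)^n -
      ∑ n ∈ Icc 1 M, bc (s.re/2) n * ((I * (s.im:ℂ)/2)⁻¹)^n =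
      2 * ∑ j ∈ Icc 1 M, fseq s.re j * (2 * I / s.im)^j := by
    rw [← sum_sub_distrib, mul_sum]
    refine sum_congr rfl fun n hn => ?_
    have hn0 : (n:ℂ) ≠ 0 := by
      simp at hn; exact_mod_cast (by omega : n ≠ 0)
    have hn1 : (n:ℂ) + 1 ≠ 0 := Nat.cast_add_one_ne_zero n
    have e1 : (-(I * (s.im:ℂ)/2))⁻¹ = 2 * I / s.im := by
      rw [inv_eq_iff_eq_inv, inv_div, eq_div_iff (by simp)]
      linear_combination (-(s.im:ℂ)) * I_mul_I
    have e2 : (I * (s.im:ℂ)/2)⁻¹ = - (2 * I / s.im) := by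
      rw [← e1, inv_neg, neg_neg]
    rw [e1, e2, neg_pow (2 * I / (s.im:ℂ))]
    simp only [bc, fseq]
    have e3 : (-1:ℂ)^n * (-1:ℂ)^n = 1 := by rw [← mul_pow]; simp
    have e4 : (-1:ℂ)^(n+1) * (-1:ℂ)^n = -1 := by rw [pow_succ]; linear_combination (-1:ℂ) * e3
    field_simp
    linear_combination (-bernoulliPoly (n+1) (s.re/2)) * (2 * I / s.im)^n * e4
  have hs : s = s.re + s.im * I := (re_add_im s).symm
  have hs2 : s - 1/2 = s.re + s.im * I - 1/2 := by rw [← hs]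
  simp only [GM, th0, hl1, hl2, hl3]
  push_cast
  have hs3 : (1/2 - s)/2 = (1/2 - s.re - s.im * I)/2 := by
    rw [sub_sub, ← hs]
  rw [hs2, hs3]
  linear_combination hsum

lemma DS_asym (A B : ℝ) (M : ℕ) : ∃ C, 0 ≤ C ∧ ∀ s : ℂ, s.re ∈ Set.Icc A B → 2*π ≤ s.im →
    ‖DS s - (2 * th0 s M - (s - 1/2) * (Real.log π : ℂ))‖ ≤ C * (1/s.im)^M := by
  set a0 : ℝ := |A| + |B| + 1 with ha0
  have ha0p : 0 ≤ a0 := by positivity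
  obtain ⟨C, hC0, hC⟩ := DD_asym M a0 ha0p
  set t0 : ℝ := 4*(2+a0) with ht0
  -- compact part
  set K : Set ℂ := Set.Icc A B ×ℂ Set.Icc (2*π) t0 with hK
  have hpi := pi_pos
  have hKc : IsCompact K := isCompact_Icc.reProdIm isCompact_Icc
  have hKO : K ⊆ RSOmega := by
    intro s hs
    left
    have := hs.2.1
    have : 2*π ≤ s.im := this
    linarith
  obtain ⟨R, hR⟩ := hKc.isBounded.exists_norm_le
  have hcont : ContinuousOn (fun s => DS s - (2 * th0 s M - (s - 1/2) * (Real.log π : ℂ))) K := by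
    apply ContinuousOn.sub (DS_cont hKO hR)
    have him : ∀ s ∈ K, s.im ≠ 0 := by
      intro s hs
      have : 2*π ≤ s.im := hs.2.1
      linarith
    have himc : ∀ s ∈ K, (s.im : ℂ) ≠ 0 := fun s hs => by exact_mod_cast him s hs
    have hb : ∀ n, Continuous fun a : ℂ => bernoulliPoly n a := by
      intro n; unfold bernoulliPoly; exact Polynomial.continuous_aeval _
    unfold th0 fseq
    apply ContinuousOn.sub
    · apply ContinuousOn.mul continuousOn_const
      apply ContinuousOn.add
      · apply ContinuousOn.add
        · apply ContinuousOn.mul (by fun_prop)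
          apply continuous_ofReal.comp_continuousOn
          apply ContinuousOn.log (by fun_prop)
          intro s hs
          have := him s hs
          positivity
        · fun_prop
      · apply continuousOn_finsetSum
        intro j _
        apply ContinuousOn.mul
        · apply ContinuousOn.div_const
          apply Continuous.continuousOn
          apply Continuous.add
          · exact (hb _).comp (by fun_prop)
          · exact continuous_const.mul ((hb _).comp (by fun_prop))
        · apply ContinuousOn.pow
          apply ContinuousOn.div (by fun_prop) (by fun_prop) himc
    · fun_prop
  obtain ⟨C2, hC2⟩ := hKc.exists_bound_of_continuousOn hcont
  refine ⟨C * (2^M + 2^M) + |C2| * t0^M, by positivity, fun s hs ht => ?_⟩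
  have ht0' : 0 < s.im := by linarith
  by_cases hbig : t0 ≤ s.im
  · have hw : ‖I * (s.im:ℂ)/2‖ = s.im/2 := by
      simp [abs_of_pos ht0']
    have hσ : |s.re| ≤ |A| + |B| := by
      rw [abs_le]
      constructor
      · linarith [hs.1, neg_abs_le A, abs_nonneg B]
      · linarith [hs.2, le_abs_self B, abs_nonneg A]
    have h := hC ((1 - s.re)/2) (s.re/2) (-(I * s.im/2)) (I * s.im/2) ?_ ?_ (by simp) (by simp)
      (by rw [norm_neg, hw]; linarith) (by rw [hw]; linarith)
    · rw [GM_diff M ht0', norm_neg, hw] at h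
      have e : DS s = DD (-(I * s.im/2) + (1 - s.re)/2) (I * s.im/2 + s.re/2) := by
        have hs' : s = s.re + s.im * I := (re_add_im s).symm
        unfold DS
        congr 1
        · linear_combination (-1/2:ℂ) * hs'
        · linear_combination (1/2:ℂ) * hs'
      rw [e]
      refine h.trans ?_
      have : (s.im/2)⁻¹ = 2 * (1/s.im) := by field_simp
      rw [this, mul_pow, ← add_mul, ← mul_assoc]
      gcongr
      have : 0 ≤ |C2| * t0^M := by positivity
      linarith
    · have : ((1:ℂ) - s.re)/2 = (((1 - s.re)/2 : ℝ) : ℂ) := by push_cast; ring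
      rw [this, norm_real, norm_eq_abs, abs_div, abs_two]
      have := abs_sub (1:ℝ) s.re
      rw [abs_one] at this
      linarith [abs_nonneg s.re]
    · have : (s.re:ℂ)/2 = ((s.re/2 : ℝ) : ℂ) := by push_cast; ring
      rw [this, norm_real, norm_eq_abs, abs_div, abs_two]
      linarith [abs_nonneg s.re]
  · push Not at hbig
    refine (hC2 s ⟨hs, ht, hbig.le⟩).trans ?_
    have h1 : 1 ≤ t0^M * (1/s.im)^M := by
      rw [← mul_pow]
      apply one_le_pow₀
      rw [mul_one_div, le_div_iff₀ ht0']; linarith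
    have h2 : 0 ≤ C * (2^M + 2^M) * (1/s.im)^M := by positivity
    have h3 : C2 ≤ |C2| := le_abs_self _
    nlinarith [abs_nonneg C2]

lemma theta_asym {ϑ : ℂ → ℂ} (hϑ : IsRSTheta ϑ) (A B : ℝ) (M : ℕ) : ∃ C, 0 ≤ C ∧ ∀ s : ℂ,
    s.re ∈ Set.Icc A B → 2*π ≤ s.im → ‖-I * ϑ s - th0 s M‖ ≤ C * (1/s.im)^M := by
  obtain ⟨C, hC0, hC⟩ := DS_asym A B M
  refine ⟨C, hC0, fun s hs ht => ?_⟩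
  have hpi := pi_pos
  have h := hC s hs ht
  have h2 := theta_eq hϑ (s := s) (by linarith)
  have e : -I * ϑ s - th0 s M = (1/2) * (DS s - (2 * th0 s M - (s - 1/2) * (Real.log π : ℂ))) := by
    linear_combination (1/2) * h2
  rw [e, norm_mul]
  norm_num at h ⊢
  linarith [norm_nonneg (DS s - (2 * th0 s M - (s - 2⁻¹) * (Real.log π : ℂ)))]

end P4

section P5
open Filter Topology

def Uf (ϑ : ℂ → ℂ) (s : ℂ) : ℂ := cexp (-I * ϑ s - th0 s 0)

lemma fseq_bdd (A B : ℝ) (j : ℕ) : ∃ C : ℝ, 0 ≤ C ∧ ∀ σ ∈ Set.Icc A B, ‖fseq σ j‖ ≤ C := by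
  have hc : Continuous fun σ : ℝ => ‖fseq σ j‖ := by
    unfold fseq bernoulliPoly
    have h1 : ∀ p : Polynomial ℚ, Continuous fun x : ℂ => Polynomial.aeval x p := fun p =>
      Polynomial.continuous_aeval p
    have h2 := (h1 (Polynomial.bernoulli (j+1)))
    have h3 : Continuous fun σ : ℝ => (σ:ℂ)/2 := by fun_prop
    have h4 : Continuous fun σ : ℝ => (1-(σ:ℂ))/2 := by fun_prop
    have h5 := h2.comp h3
    have h6 := h2.comp h4
    exact ((h5.add (continuous_const.mul h6)).div_const _).norm
  obtain ⟨C, hC⟩ := isCompact_Icc.bddAbove_image (f := fun σ : ℝ => ‖fseq σ j‖) (K := Set.Icc A B) hc.continuousOn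
  refine ⟨max C 0, le_max_right _ _, fun σ hσ => (hC ⟨σ, hσ, rfl⟩).trans (le_max_left _ _)⟩

lemma fseq_sum_bdd (A B : ℝ) (M : ℕ) : ∃ C : ℝ, 0 ≤ C ∧ ∀ σ ∈ Set.Icc A B,
    ∑ j ∈ Icc 1 M, ‖fseq σ j‖ ≤ C := by
  choose c h0 hc using fseq_bdd A B
  exact ⟨∑ j ∈ Icc 1 M, c j, sum_nonneg fun j _ => h0 j,
    fun σ hσ => sum_le_sum fun j _ => hc j σ hσ⟩

lemma theta_bdd {ϑ : ℂ → ℂ} (hϑ : IsRSTheta ϑ) (A B : ℝ) : ∃ C, 0 ≤ C ∧ ∀ s : ℂ, s.re ∈ Set.Icc A B →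
    2*π ≤ s.im → ‖-I*ϑ s - th0 s 0‖ ≤ C := by
  obtain ⟨C, h0, h⟩ := theta_asym hϑ A B 0
  exact ⟨C, h0, fun s h1 h2 => by simpa using h s h1 h2⟩

lemma U_asym {ϑ : ℂ → ℂ} (hϑ : IsRSTheta ϑ) (A B : ℝ) (M : ℕ) : ∃ C, 0 ≤ C ∧ ∀ s : ℂ, s.re ∈ Set.Icc A B →
    2*π ≤ s.im → ‖Uf ϑ s - ∑ m ∈ range M, um m s.re * (-I/s.im)^m‖ ≤ C * (1/s.im)^M := by
  obtain ⟨C1, h10, h1⟩ := theta_asym hϑ A B M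
  obtain ⟨C2, h20, h2⟩ := fseq_sum_bdd A B M
  refine ⟨rexp C2 * (C1 * rexp C1) + 2^M * rexp C2, by positivity, fun s hs ht => ?_⟩
  have hpi := pi_gt_three
  have ht0 : 0 < s.im := by linarith
  have ht2 : 2 ≤ s.im := by linarith
  have htl : (1/s.im)^M ≤ 1 := pow_le_one₀ (by positivity) (by rw [div_le_one ht0]; linarith)
  set p : ℕ → ℂ := fun j => if j ≤ M then fseq s.re j else 0 with hp
  set x : ℂ := 2*I/s.im with hx
  have hxn : ‖x‖ = 2/s.im := by
    rw [hx, norm_div, norm_mul, norm_I, norm_real, norm_of_nonneg ht0.le]; simp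
  have hx1 : ‖x‖ ≤ 1 := by rw [hxn, div_le_one ht0]; exact ht2
  have hpz0 : ∀ j, j ∉ Icc 1 M → pz p j = 0 := by
    intro j hj
    simp only [mem_Icc, not_and, not_le] at hj
    unfold pz; split_ifs with h
    · rfl
    · simp only [hp]; rw [if_neg]; have := hj (by omega); omega
  have hpz1 : ∀ j ∈ Icc 1 M, pz p j = fseq s.re j := by
    intro j hj
    simp only [mem_Icc] at hj
    unfold pz; rw [if_neg (by omega)]; simp only [hp]; rw [if_pos hj.2]
  have hmaj : Maj (pz p) 1 C2 := by
    have hs1 : HasSum (fun i => ‖pz p i‖ * (1:ℝ)^i) (∑ j ∈ Icc 1 M, ‖pz p j‖ * 1^j) :=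
      hasSum_sum_of_ne_finset_zero (fun j hj => by rw [hpz0 j hj]; simp)
    refine ⟨hs1.summable, hs1.tsum_eq.le.trans ?_⟩
    refine le_trans (le_of_eq ?_) (h2 s.re hs)
    exact sum_congr rfl fun j hj => by rw [hpz1 j hj]; simp
  have hts : ∑' i, pz p i * x^i = th0 s M - th0 s 0 := by
    rw [tsum_eq_sum (s := Icc 1 M) (fun j hj => by rw [hpz0 j hj]; simp)]
    unfold th0
    simp only [Icc_eq_empty_of_lt Nat.zero_lt_one, sum_empty]
    rw [sum_congr rfl fun j hj => by rw [hpz1 j hj]]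
    ring
  obtain ⟨he1, he2⟩ := hmaj.exp zero_le_one
  have he3 := he1.tail one_pos hx1 M
  rw [he2 x hx1, hts] at he3
  have hum : ∑ m ∈ range M, um m s.re * (-I/s.im)^m = ∑ i ∈ range M, ecoef p i * x^i := by
    refine sum_congr rfl fun m hm => ?_
    have hm' := mem_range.1 hm
    have : ∀ k, obell (fseq s.re) m k = obell p m k := fun k => obell_congr fun j _ hj => by
      simp only [hp]; rw [if_pos (by omega)]
    unfold um ecoef
    simp_rw [this]
    rw [mul_right_comm, ← mul_pow, mul_comm]
    congr 2
    rw [hx]; ring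
  have hexpn : ‖cexp (th0 s M - th0 s 0)‖ ≤ rexp C2 := by
    have := he1.tail one_pos hx1 0
    rw [he2 x hx1, hts] at this
    simpa using this
  have hd : ‖cexp (-I*ϑ s - th0 s M) - 1‖ ≤ C1 * (1/s.im)^M * rexp C1 := by
    have hn := h1 s hs ht
    have h3 := norm_exp_sub_sum_le_norm_mul_exp (-I*ϑ s - th0 s M) 1
    simp only [sum_range_one, pow_zero, Nat.factorial_zero, Nat.cast_one, div_one, pow_one] at h3
    refine h3.trans ?_
    have : ‖-I*ϑ s - th0 s M‖ ≤ C1 := hn.trans (by nlinarith)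
    gcongr
  rw [hum]
  have : Uf ϑ s - ∑ i ∈ range M, ecoef p i * x^i =
      cexp (th0 s M - th0 s 0) * (cexp (-I*ϑ s - th0 s M) - 1) +
      (cexp (th0 s M - th0 s 0) - ∑ i ∈ range M, ecoef p i * x^i) := by
    rw [mul_sub, ← Complex.exp_add, show th0 s M - th0 s 0 + (-I*ϑ s - th0 s M) = -I*ϑ s - th0 s 0 by ring]; unfold Uf; ring
  rw [this]
  refine (norm_add_le _ _).trans ?_
  rw [norm_mul, add_mul]
  refine add_le_add ?_ (he3.trans ?_)
  · calc _ ≤ rexp C2 * (C1 * (1/s.im)^M * rexp C1) := by gcongr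
      _ = _ := by ring
  · rw [hxn, div_one, div_pow, div_pow]; apply le_of_eq; ring
end P5

section P6
open Filter Topology

def Qd (d : ℂ) (k : ℕ) : ℂ := if Even k then d^(k/2)/(Nat.factorial (k/2) : ℂ) else 0

def hp (c d : ℂ) (n : ℕ) : ℂ := ∑ i ∈ range (n+1), c^i/(Nat.factorial i : ℂ) * Qd d (n-i)

def pE (c : ℂ) : PowerSeries ℂ := PowerSeries.mk fun i => c^i/(Nat.factorial i : ℂ)
def pQ (d : ℂ) : PowerSeries ℂ := PowerSeries.mk (Qd d)

lemma hp_coeff (c d : ℂ) (n : ℕ) : hp c d n = PowerSeries.coeff n (pE c * pQ d) := by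
  rw [PowerSeries.coeff_mul, Nat.sum_antidiagonal_eq_sum_range_succ_mk]
  simp [hp, pE, pQ]

lemma pE_deriv (c : ℂ) : PowerSeries.derivative ℂ (pE c) = PowerSeries.C c * pE c := by
  ext n
  rw [PowerSeries.coeff_derivative, PowerSeries.coeff_C_mul]
  simp only [pE, PowerSeries.coeff_mk]
  rw [Nat.factorial_succ]; push_cast
  have : (n:ℂ) + 1 ≠ 0 := by exact_mod_cast Nat.succ_ne_zero n
  field_simp
  ring

lemma pQ_deriv (d : ℂ) : PowerSeries.derivative ℂ (pQ d) = PowerSeries.C (2*d) * (PowerSeries.X * pQ d) := by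
  ext n
  rw [PowerSeries.coeff_derivative, PowerSeries.coeff_C_mul]
  cases n with
  | zero => simp [pQ, Qd]
  | succ n =>
    rw [PowerSeries.coeff_succ_X_mul]
    simp only [pQ, PowerSeries.coeff_mk, Qd]
    by_cases h : Even n
    · have h2 : Even (n+1+1) := by rw [Nat.even_add_one, Nat.even_add_one]; simpa using h
      rw [if_pos h, if_pos h2]
      obtain ⟨k, rfl⟩ := h
      rw [show (k+k+1+1)/2 = k+1 by omega, show (k+k)/2 = k by omega, Nat.factorial_succ]
      push_cast
      have : (k:ℂ) + 1 ≠ 0 := by exact_mod_cast Nat.succ_ne_zero k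
      field_simp; ring
    · have h2 : ¬ Even (n+1+1) := by rw [Nat.even_add_one, Nat.even_add_one]; simpa using h
      rw [if_neg h, if_neg h2]; simp

lemma hp_rec (c d : ℂ) (n : ℕ) : ((n:ℂ)+2) * hp c d (n+2) = c * hp c d (n+1) + 2*d*hp c d n := by
  have h : PowerSeries.derivative ℂ (pE c * pQ d) = PowerSeries.C c * (pE c * pQ d) +
      PowerSeries.C (2*d) * (PowerSeries.X * (pE c * pQ d)) := by
    rw [Derivation.leibniz, pE_deriv, pQ_deriv]; simp only [smul_eq_mul]; ring
  have h2 := congrArg (PowerSeries.coeff (n+1)) h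
  rw [PowerSeries.coeff_derivative, map_add, PowerSeries.coeff_C_mul, PowerSeries.coeff_C_mul,
    PowerSeries.coeff_succ_X_mul, ← hp_coeff, ← hp_coeff, ← hp_coeff] at h2
  rw [← h2]; push_cast; ring

lemma hp_zero (c d : ℂ) : hp c d 0 = 1 := by simp [hp, Qd]
lemma hp_one (c d : ℂ) : hp c d 1 = c := by simp [hp, Qd, sum_range_succ]

lemma pE_add (c c' : ℂ) : pE c * pE c' = pE (c+c') := by
  ext n
  rw [PowerSeries.coeff_mul]
  simp only [pE, PowerSeries.coeff_mk]
  rw [add_pow, Nat.sum_antidiagonal_eq_sum_range_succ_mk, sum_div]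
  refine sum_congr rfl fun i hi => ?_
  have hi' : i ≤ n := by simpa [Nat.lt_succ_iff] using hi
  rw [Nat.choose_eq_factorial_div_factorial hi', Nat.cast_div (Nat.factorial_mul_factorial_dvd_factorial hi')
    (by exact_mod_cast (mul_ne_zero (Nat.factorial_ne_zero _) (Nat.factorial_ne_zero _)))]
  push_cast
  have := Nat.factorial_ne_zero n
  field_simp

lemma pQ_neg (d : ℂ) : pQ d * pQ (-d) = 1 := by
  apply PowerSeries.derivative.ext
  · rw [Derivation.leibniz, pQ_deriv, pQ_deriv]
    simp only [smul_eq_mul, mul_neg, map_neg]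
    simp; ring
  · simp [pQ, Qd]

lemma hp_add (c c' d : ℂ) (n : ℕ) :
    ∑ i ∈ range (n+1), hp c d i * hp c' (-d) (n-i) = (c+c')^n/(Nat.factorial n : ℂ) := by
  have h : (pE c * pQ d) * (pE c' * pQ (-d)) = pE (c+c') := by
    rw [mul_mul_mul_comm, pQ_neg, pE_add, mul_one]
  have h2 := congrArg (PowerSeries.coeff n) h
  rw [PowerSeries.coeff_mul, Nat.sum_antidiagonal_eq_sum_range_succ_mk] at h2
  simp_rw [← hp_coeff] at h2
  rw [h2]; simp [pE]

lemma hp_deriv (c d : ℂ) (n : ℕ) : HasDerivAt (fun c => hp c d (n+1)) (hp c d n) c := by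
  unfold hp
  have h : ∀ i ∈ range (n+1+1), HasDerivAt (fun c : ℂ => c^i/(Nat.factorial i : ℂ) * Qd d (n+1-i))
      ((i:ℂ)*c^(i-1)/(Nat.factorial i : ℂ) * Qd d (n+1-i)) c := fun i _ =>
    ((hasDerivAt_pow i c).div_const _).mul_const _
  have h2 := HasDerivAt.fun_sum h
  refine h2.congr_deriv ?_
  rw [sum_range_succ']
  simp only [Nat.cast_zero, zero_mul, zero_div, add_zero]
  refine sum_congr rfl fun i hi => ?_
  rw [show n+1-(i+1) = n-i by omega, Nat.factorial_succ, show i+1-1=i by omega]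
  push_cast
  have : (i:ℂ) + 1 ≠ 0 := by exact_mod_cast Nat.succ_ne_zero i
  field_simp

lemma hp_explicit (c d : ℂ) (n : ℕ) : hp c d n = ∑ j ∈ range (n/2+1),
    d^j/((Nat.factorial j : ℂ) * (Nat.factorial (n-2*j) : ℂ)) * c^(n-2*j) := by
  unfold hp
  symm
  refine sum_of_injOn (fun j => n-2*j) ?_ ?_ ?_ ?_
  · intro i hi j hj h
    simp only [coe_range, Set.mem_Iio] at hi hj
    simp only at h
    omega
  · intro i hi
    simp only [coe_range, Set.mem_Iio] at hi ⊢
    omega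
  · intro i hi hi2
    simp only [coe_range, Set.mem_image, Set.mem_Iio, mem_range] at hi hi2
    have : ¬ Even (n-i) := by
      rintro ⟨k, hk⟩
      exact hi2 ⟨k, by omega, by omega⟩
    rw [Qd, if_neg this, mul_zero]
  · intro j hj
    simp only [mem_range] at hj
    have h1 : n-(n-2*j) = 2*j := by omega
    rw [h1, Qd, if_pos (even_two_mul j), show 2*j/2=j by omega]
    ring

lemma hp_bdd (c d : ℂ) (n : ℕ) : ‖hp c d n‖ ≤ (n+1) * (rexp ‖c‖ * rexp ‖d‖) := by
  unfold hp
  have hb : ∀ (x : ℝ) (_ : 0 ≤ x) (i : ℕ), x^i/(Nat.factorial i : ℝ) ≤ rexp x := fun x hx i =>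
    pow_div_factorial_le_exp x hx i
  have h : ∀ i ∈ range (n+1), ‖c^i/(Nat.factorial i : ℂ) * Qd d (n-i)‖ ≤ rexp ‖c‖ * rexp ‖d‖ := by
    intro i _
    rw [norm_mul, norm_div, norm_pow, Complex.norm_natCast]
    refine mul_le_mul (hb _ (norm_nonneg _) i) ?_ (norm_nonneg _) (by positivity)
    unfold Qd; split_ifs
    · rw [norm_div, norm_pow, Complex.norm_natCast]; exact hb _ (norm_nonneg _) _
    · simp; positivity
  refine (norm_sum_le_of_le _ h).trans ?_
  simp

def Er (r : ℕ) (X : ℂ) : ℂ := (Nat.factorial r : ℂ) * hp (I*X) (-I/4) r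

lemma Er_zero (X : ℂ) : Er 0 X = 1 := by simp [Er, hp_zero]

lemma Er_bdd (r : ℕ) : ∃ C : ℝ, 0 ≤ C ∧ ∀ X : ℂ, ‖Er r X‖ ≤ C * rexp ‖X‖ := by
  refine ⟨(Nat.factorial r) * ((r+1) * rexp ‖-I/4‖), by positivity, fun X => ?_⟩
  unfold Er
  rw [norm_mul, Complex.norm_natCast]
  have := hp_bdd (I*X) (-I/4) r
  rw [norm_mul, norm_I, one_mul] at this
  calc _ ≤ (Nat.factorial r : ℝ) * ((r + 1) * (rexp ‖X‖ * rexp ‖-I / 4‖)) := by gcongr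
    _ = _ := by ring

lemma Er_deriv (r : ℕ) (X : ℂ) : HasDerivAt (Er r) (I * r * Er (r-1) X) X := by
  cases r with
  | zero => 
    have : Er 0 = fun _ => 1 := by ext X; exact Er_zero X
    rw [this]; simpa using hasDerivAt_const X (1:ℂ)
  | succ n =>
    have h := (hp_deriv (I*X) (-I/4) n).comp X ((hasDerivAt_id X).const_mul I)
    have h2 := h.const_mul (Nat.factorial (n+1) : ℂ)
    unfold Er
    refine h2.congr_deriv ?_
    rw [Nat.factorial_succ, show n+1-1=n by omega]; push_cast; ring

lemma Er_rec (r : ℕ) (X : ℂ) : Er (r+1) X = I*X*Er r X - I/2*r*Er (r-1) X := by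
  cases r with
  | zero => simp [Er, hp_zero, hp_one]
  | succ n =>
    have h := hp_rec (I*X) (-I/4) n
    unfold Er
    rw [Nat.factorial_succ, Nat.factorial_succ, show n+1-1=n by omega]
    push_cast
    linear_combination ((n:ℂ)+1) * (Nat.factorial n : ℂ) * h

lemma herm_hp (k : ℕ) (x : ℂ) : (cexp (3*(π:ℂ)*I/4)/2)^k * hermiteH k (cexp (-(π:ℂ)*I/4)*x)
    = (Nat.factorial k : ℂ) * hp (I*x) (I/4) k := by
  rw [hp_explicit, hermiteH, mul_left_comm, mul_sum]
  congr 1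
  refine sum_congr rfl fun j hj => ?_
  have hj' : 2*j ≤ k := by simp only [mem_range] at hj; omega
  set w := cexp (3*(π:ℂ)*I/4) with hw
  have h1 : w * cexp (-(π:ℂ)*I/4) = I := by
    rw [hw, ← Complex.exp_add, show 3*(π:ℂ)*I/4 + -(π:ℂ)*I/4 = π/2*I by ring, exp_pi_div_two_mul_I]
  have h2 : w^2 = -I := by
    rw [hw, ← Complex.exp_nat_mul, show ((2:ℕ):ℂ)*(3*(π:ℂ)*I/4) = π*I + π/2*I by push_cast; ring,
      Complex.exp_add, exp_pi_mul_I, exp_pi_div_two_mul_I]; ring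
  have h3 : (w/2)^k = (w/2)^(k-2*j) * (w^2/4)^j := by
    rw [show w^2/4 = (w/2)^2 by ring, ← pow_mul, ← pow_add]; congr 1; omega
  rw [h3, h2, show I*x = (w/2)*(2*(cexp (-(π:ℂ)*I/4)*x)) by linear_combination (-x)*h1, mul_pow (w/2),
    show I/4 = (-1)*(-I/4) by ring, mul_pow (-1:ℂ)]
  ring

def pn (n : ℕ) (σ : ℝ) (z : ℂ) : ℂ := ∑ ℓ ∈ range (3*n/2+1), I ^ n*(-I)^ℓ*qq n ℓ σ*z^(3*n-2*ℓ)

lemma PP_eq (n k : ℕ) (hk : k ≤ 3*n) (x : ℂ) (σ : ℝ) : PP n k x σ = ∑ ℓ ∈ range (k/2+1),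
    (Nat.choose (3*n-2*ℓ) (3*n-k) : ℂ) * ((-1)^(n+ℓ) * (-I)^ℓ * qq n ℓ σ) *
      ((Nat.factorial (k-2*ℓ) : ℂ) * hp (I*x) (I/4) (k-2*ℓ)) := by
  unfold PP
  rw [mul_sum]
  refine sum_congr rfl fun ℓ hl => ?_
  have hl' : 2*ℓ ≤ k := by simp only [mem_range] at hl; omega
  rw [← herm_hp]
  set w := cexp (3*(π:ℂ)*I/4) with hw
  have h2 : w^2 = -I := by
    rw [hw, ← Complex.exp_nat_mul, show ((2:ℕ):ℂ)*(3*(π:ℂ)*I/4) = π*I + π/2*I by push_cast; ring,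
      Complex.exp_add, exp_pi_mul_I, exp_pi_div_two_mul_I]; ring
  have h1 : cexp (3*(π:ℂ)*I*(k:ℂ)/4) = w^(k-2*ℓ) * (-I)^ℓ := by
    rw [← h2, ← pow_mul, ← pow_add, show k-2*ℓ+2*ℓ = k by omega, hw, ← Complex.exp_nat_mul]
    congr 1; ring
  have h4 : (2:ℂ)^(2*ℓ)/2^k = 1/2^(k-2*ℓ) := by
    rw [div_eq_div_iff (pow_ne_zero _ two_ne_zero) (pow_ne_zero _ two_ne_zero), ← pow_add]
    rw [one_mul]; congr 1; omega
  rw [h1, mul_div_assoc, h4, div_pow]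
  ring

lemma PP_sum (n : ℕ) (σ : ℝ) (x z : ℂ) :
    ∑ r ∈ range (3*n+1), Er r (z-x) * PP n (3*n-r) x σ = pn n σ z := by
  have h1 : ∀ r ∈ range (3*n+1), Er r (z-x) * PP n (3*n-r) x σ =
      ∑ ℓ ∈ range ((3*n-r)/2+1), (-1)^(n+ℓ) * (-I)^ℓ * qq n ℓ σ *
        ((Nat.factorial (3*n-2*ℓ) : ℂ) * (hp (I*(z-x)) (-I/4) r * hp (I*x) (I/4) (3*n-2*ℓ-r))) := by
    intro r hr
    have hr' : r ≤ 3*n := by simp only [mem_range] at hr; omega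
    rw [PP_eq n _ (by omega), mul_sum]
    refine sum_congr rfl fun ℓ hl => ?_
    have hl' : 2*ℓ ≤ 3*n-r := by simp only [mem_range] at hl; omega
    rw [show 3*n-(3*n-r) = r by omega, show 3*n-r-2*ℓ = 3*n-2*ℓ-r by omega,
      ← Nat.choose_mul_factorial_mul_factorial (show r ≤ 3*n-2*ℓ by omega)]
    unfold Er
    push_cast
    ring
  rw [sum_congr rfl h1]
  rw [sum_comm' (t' := range (3*n/2+1)) (s' := fun ℓ => range (3*n-2*ℓ+1))]
  · unfold pn
    refine sum_congr rfl fun ℓ hl => ?_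
    have hl' : 2*ℓ ≤ 3*n := by simp only [mem_range] at hl; omega
    rw [← mul_sum, ← mul_sum]
    have := hp_add (I*(z-x)) (I*x) (-I/4) (3*n-2*ℓ)
    rw [show -(-I/4) = I/4 by ring] at this
    rw [this, mul_div_cancel₀ _ (by exact_mod_cast Nat.factorial_ne_zero _), show I*(z-x)+I*x = I*z by ring, mul_pow]
    have hI : I ^ (3*n-2*ℓ) * (-1)^ℓ = (-I)^n := by
      rw [← I_sq, ← pow_mul, ← pow_add, show 3*n-2*ℓ+2*ℓ=3*n by omega, pow_mul, I_pow_three]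
    have : (-1:ℂ)^n * (-I)^n = I ^ n := by rw [← mul_pow]; congr 1; ring
    rw [← this, ← hI, pow_add]; ring
  · intro r ℓ; simp only [mem_range]; omega

def aco (σ : ℝ) (z : ℂ) (i : ℕ) : ℂ := cmul (ecoef (fun j => (I*z^2)*seqA j)) (ecoef (fun j => ((σ:ℂ)-1)*seqB j)) i

lemma aco_eq (σ : ℝ) (z : ℂ) (i : ℕ) : aco σ z i = ∑ r ∈ range (i+1), (I*z^2)^r * dd i r σ := by
  unfold aco cmul dd
  rw [Nat.sum_antidiagonal_eq_sum_range_succ_mk]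
  simp_rw [mul_sum]
  simp only [ecoef, obell_smul, sum_mul]
  rw [sum_comm' (t' := range (i+1)) (s' := fun r => Icc r i)]
  · refine sum_congr rfl fun r _ => sum_congr rfl fun n _ => ?_
    rw [mul_sum]
    refine sum_congr rfl fun k _ => by ring
  · intro n r; simp only [mem_range, mem_Icc]; omega

def bco (σ : ℝ) (N k : ℕ) : ℂ := if Even k ∧ k < N then um (k/2) σ * (-I)^(k/2) else 0

lemma pn_eq (n N : ℕ) (hn : n < N) (σ : ℝ) (z : ℂ) :
    pn n σ z = cmul (bco σ N) (fun i => aco σ z i * z^i) n := by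
  unfold cmul
  rw [Nat.sum_antidiagonal_eq_sum_range_succ_mk]
  have h1 : ∑ k ∈ range (n+1), bco σ N k * (aco σ z (n-k) * z^(n-k)) =
      ∑ m ∈ range (n/2+1), um m σ * (-I)^m * (aco σ z (n-2*m) * z^(n-2*m)) := by
    symm
    refine sum_of_injOn (fun j => 2*j) ?_ ?_ ?_ ?_
    · intro i hi j hj h; simp only at h; omega
    · intro i hi; simp only [coe_range, Set.mem_Iio] at hi ⊢; omega
    · intro i hi hi2
      simp only [coe_range, Set.mem_image, Set.mem_Iio, mem_range] at hi hi2
      have : ¬ (Even i ∧ i < N) := by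
        rintro ⟨⟨k, hk⟩, _⟩; exact hi2 ⟨k, by omega, by omega⟩
      rw [bco, if_neg this, zero_mul]
    · intro j hj
      simp only [mem_range] at hj
      rw [bco, if_pos ⟨even_two_mul j, by omega⟩, show 2*j/2=j by omega]
  rw [h1]
  unfold pn qq
  simp only [aco_eq, mul_sum, sum_mul]
  rw [sum_sigma', sum_sigma']
  refine sum_bij' (fun p _ => ⟨p.2, n+p.2-p.1⟩) (fun p _ => ⟨n+p.1-p.2, p.1⟩) ?_ ?_ ?_ ?_ ?_
  · rintro ⟨l, m⟩ h
    simp only [mem_sigma, mem_range, mem_Icc] at h ⊢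
    omega
  · rintro ⟨l, m⟩ h
    simp only [mem_sigma, mem_range, mem_Icc] at h ⊢
    omega
  · rintro ⟨l, m⟩ h
    simp only [mem_sigma, mem_range, mem_Icc] at h
    simp only [Sigma.mk.injEq, heq_eq_eq, and_true]; omega
  · rintro ⟨l, m⟩ h
    simp only [mem_sigma, mem_range, mem_Icc] at h
    simp only [Sigma.mk.injEq, heq_eq_eq, true_and]; omega
  · rintro ⟨l, m⟩ h
    simp only [mem_sigma, mem_range, mem_Icc] at h
    simp only
    have e1 : (I*z^2)^(n+m-l) * z^(n-2*m) = I ^ (n+m-l) * z^(3*n-2*l) := by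
      rw [mul_pow, mul_assoc, ← pow_mul, ← pow_add]; congr 2; omega
    have e2 : I ^ n*(-I)^l = (-I)^m * I ^ (n+m-l) := by
      have h3 : (-I)^l * I ^ l = 1 := by rw [← mul_pow]; simp
      have h4 : (-I)^m * I ^ m = 1 := by rw [← mul_pow]; simp
      have h5 : I ^ (n+m-l) * I ^ l = I ^ n * I ^ m := by rw [← pow_add, ← pow_add]; congr 1; omega
      have h6 : I ^ l ≠ 0 := pow_ne_zero _ I_ne_zero
      apply mul_right_cancel₀ h6
      linear_combination I ^ n * h3 - (-I)^m*h5 - I ^ n * h4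
    calc _ = (I ^ n*(-I)^l) * um m σ * dd (n-2*m) (n+m-l) σ * z^(3*n-2*l) := by ring
      _ = um m σ * (-I)^m * dd (n-2*m) (n+m-l) σ * (I ^ (n+m-l) * z^(3*n-2*l)) := by rw [e2]; ring
      _ = _ := by rw [← e1]; ring
end P6

section P7
open Filter Topology

lemma poly_exp (M : ℕ) {c : ℝ} (hc : 0 < c) : ∃ C, 0 ≤ C ∧ ∀ x : ℝ, 0 ≤ x → (1+x)^M ≤ C * rexp (c*x) := by
  refine ⟨Nat.factorial M / c^M * rexp c, by positivity, fun x hx => ?_⟩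
  have := pow_div_factorial_le_exp (c*(1+x)) (by positivity) M
  rw [div_le_iff₀ (by positivity), mul_pow] at this
  rw [mul_assoc, ← Real.exp_add, div_mul_eq_mul_div, le_div_iff₀ (by positivity)]
  calc _ = c^M * (1+x)^M := by ring
    _ ≤ _ := this
    _ = _ := by rw [mul_add, mul_one, mul_comm]

lemma fseq_cont (j : ℕ) : Continuous fun σ : ℝ => fseq σ j := by
  unfold fseq bernoulliPoly
  have h2 : Continuous fun x : ℂ => Polynomial.aeval x (Polynomial.bernoulli (j+1)) :=
    Polynomial.continuous_aeval _
  have h3 : Continuous fun σ : ℝ => (σ:ℂ)/2 := by fun_prop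
  have h4 : Continuous fun σ : ℝ => (1-(σ:ℂ))/2 := by fun_prop
  exact (((h2.comp h3).add (continuous_const.mul (h2.comp h4))).div_const _)

lemma um_cont (m : ℕ) : Continuous fun σ : ℝ => um m σ := by
  unfold um obell
  have := fseq_cont
  fun_prop

lemma qq_cont (n l : ℕ) : Continuous fun σ : ℝ => qq n l σ := by
  unfold qq dd
  have := um_cont
  fun_prop

lemma bdd_of_cont (A B : ℝ) {f : ℝ → ℂ} (hf : Continuous f) : ∃ C : ℝ, 0 ≤ C ∧ ∀ σ ∈ Set.Icc A B, ‖f σ‖ ≤ C := by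
  obtain ⟨C, hC⟩ := isCompact_Icc.bddAbove_image (f := fun σ : ℝ => ‖f σ‖) (K := Set.Icc A B) hf.norm.continuousOn
  exact ⟨max C 0, le_max_right _ _, fun σ hσ => (hC ⟨σ, hσ, rfl⟩).trans (le_max_left _ _)⟩

lemma pn_bdd (A B : ℝ) (n : ℕ) : ∃ C : ℝ, 0 ≤ C ∧ ∀ σ ∈ Set.Icc A B, ∀ z, ‖pn n σ z‖ ≤ C * (1+‖z‖)^(3*n) := by
  choose c h0 hc using fun l => bdd_of_cont A B (qq_cont n l)
  refine ⟨∑ l ∈ range (3*n/2+1), c l, sum_nonneg fun j _ => h0 j, fun σ hσ z => ?_⟩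
  unfold pn
  rw [sum_mul]
  refine norm_sum_le_of_le _ fun l _ => ?_
  simp only [norm_mul, norm_pow, norm_neg, norm_I, one_pow, one_mul]
  have hz : 1 ≤ 1 + ‖z‖ := by linarith [norm_nonneg z]
  have : ‖z‖^(3*n-2*l) ≤ (1+‖z‖)^(3*n) :=
    (pow_le_pow_left₀ (norm_nonneg _) (by linarith) _).trans (pow_le_pow_right₀ hz (by omega))
  exact mul_le_mul (hc l σ hσ) this (by positivity) (h0 l)

lemma arg_hasDeriv (p : ℝ) (hp : p < 1) : HasDerivAt (fun p : ℝ => (Complex.log (1 - p + p*I)).im)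
    (1/(1-2*p+2*p^2)) p := by
  have h1 : HasDerivAt (fun p : ℝ => (1 - p + p*I : ℂ)) (-1 + I) p := by
    have h := (hasDerivAt_id p).ofReal_comp
    have := (h.const_sub 1).add (h.mul_const I)
    exact (show HasDerivAt (fun p : ℝ => (1 - p + p*I : ℂ)) _ p from this).congr_deriv (by simp)
  have hre : (1 - p + p*I : ℂ).re = 1-p := by simp
  have him : (1 - p + p*I : ℂ).im = p := by simp
  have hs : (1 - p + p*I : ℂ) ∈ slitPlane := Or.inl (by rw [hre]; linarith)
  have h2 := h1.clog_real hs
  have h3 := (imCLM.hasFDerivAt.comp_hasDerivAt p h2)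
  refine h3.congr_deriv ?_
  simp only [imCLM_apply, div_im, hre, him, normSq_apply]
  simp
  have : (1-p)*(1-p)+p*p ≠ 0 := by nlinarith
  have : 1-2*p+2*p^2 ≠ 0 := by nlinarith
  field_simp
  ring

lemma arg_pos {p : ℝ} (h0 : 0 ≤ p) (h1 : p ≤ 1/2) : p + p^2/2 ≤ (Complex.log (1 - p + p*I)).im := by
  have hd : ∀ x : ℝ, x < 1 → HasDerivAt (fun p : ℝ => (Complex.log (1 - p + p*I)).im - (p+p^2/2))
      (1/(1-2*x+2*x^2) - (1+x)) x := by
    intro x hx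
    refine (arg_hasDeriv x hx).sub ?_
    have := (hasDerivAt_id x).add ((hasDerivAt_pow 2 x).div_const 2)
    refine this.congr_deriv ?_
    simp
  have hm : MonotoneOn (fun p : ℝ => (Complex.log (1 - p + p*I)).im - (p+p^2/2)) (Set.Icc 0 (1/2)) := by
    apply monotoneOn_of_deriv_nonneg (convex_Icc _ _)
    · exact fun x hx => (hd x (by linarith [hx.2])).continuousAt.continuousWithinAt
    · exact fun x hx => (hd x (by rw [interior_Icc] at hx; linarith [hx.2])).differentiableAt.differentiableWithinAt
    · intro x hx
      rw [interior_Icc] at hx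
      rw [(hd x (by linarith [hx.2])).deriv, sub_nonneg, le_div_iff₀ (by nlinarith)]
      nlinarith [hx.1, hx.2, mul_pos hx.1 hx.1, mul_nonneg (mul_pos hx.1 hx.1).le (by linarith [hx.2] : 0 ≤ 1/2 - x)]
  have := hm (Set.left_mem_Icc.2 (by norm_num)) ⟨h0, h1⟩ h0
  simp at this
  linarith

lemma arg_neg1 {r : ℝ} (h0 : 0 ≤ r) (h1 : r ≤ 1) : -r + 2/5*r^2 ≤ (Complex.log (1 + r - r*I)).im := by
  have hd : ∀ x : ℝ, x < 1 → HasDerivAt (fun p : ℝ => (Complex.log (1 - p + p*I)).im - (p+2/5*p^2))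
      (1/(1-2*x+2*x^2) - (1+4/5*x)) x := by
    intro x hx
    refine (arg_hasDeriv x hx).sub ?_
    have := (hasDerivAt_id x).add ((hasDerivAt_pow 2 x).const_mul (2/5))
    refine this.congr_deriv ?_
    simp; ring
  have hm : AntitoneOn (fun p : ℝ => (Complex.log (1 - p + p*I)).im - (p+2/5*p^2)) (Set.Icc (-1) 0) := by
    apply antitoneOn_of_deriv_nonpos (convex_Icc _ _)
    · exact fun x hx => (hd x (by linarith [hx.2])).continuousAt.continuousWithinAt
    · exact fun x hx => (hd x (by rw [interior_Icc] at hx; linarith [hx.2])).differentiableAt.differentiableWithinAt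
    · intro x hx
      rw [interior_Icc] at hx
      obtain ⟨y, rfl⟩ : ∃ y, x = -y := ⟨-x, by ring⟩
      have hy0 : 0 < y := by linarith [hx.2]
      have hy1 : y < 1 := by linarith [hx.1]
      rw [(hd _ (by linarith)).deriv, sub_nonpos, div_le_iff₀ (by nlinarith)]
      have : (1 + 4/5*(-y))*(1-2*(-y)+2*(-y)^2) - 1 = y*(1-y)*(6/5+8/5*y) := by ring
      have h3 : 0 ≤ y*(1-y)*(6/5+8/5*y) := by
        have : 0 ≤ 1-y := by linarith
        positivity
      linarith
  have := hm (show -r ∈ Set.Icc (-1:ℝ) 0 from ⟨by linarith, by linarith⟩) (Set.right_mem_Icc.2 (by norm_num)) (by linarith)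
  simp [sub_eq_add_neg] at this
  rw [sub_eq_add_neg]
  linarith

lemma arg_neg2 {r : ℝ} (h1 : 1 ≤ r) : -r + 2/5*r ≤ (Complex.log (1 + r - r*I)).im := by
  have hd : ∀ x : ℝ, x < 1 → HasDerivAt (fun p : ℝ => (Complex.log (1 - p + p*I)).im - (3/5*p))
      (1/(1-2*x+2*x^2) - 3/5) x := by
    intro x hx
    refine (arg_hasDeriv x hx).sub ?_
    have := ((hasDerivAt_id x).const_mul (3/5))
    refine this.congr_deriv ?_
    simp
  have hm : AntitoneOn (fun p : ℝ => (Complex.log (1 - p + p*I)).im - (3/5*p)) (Set.Iic (-1)) := by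
    apply antitoneOn_of_deriv_nonpos (convex_Iic _)
    · exact fun x hx => (hd x (by linarith [Set.mem_Iic.1 hx])).continuousAt.continuousWithinAt
    · exact fun x hx => (hd x (by rw [interior_Iic] at hx; linarith [Set.mem_Iio.1 hx])).differentiableAt.differentiableWithinAt
    · intro x hx
      rw [interior_Iic] at hx
      have hx := Set.mem_Iio.1 hx
      rw [(hd _ (by linarith)).deriv, sub_nonpos, div_le_iff₀ (by nlinarith)]
      nlinarith
  have := hm (show -r ∈ Set.Iic (-1:ℝ) from by simp; linarith) (show (-1:ℝ) ∈ Set.Iic (-1:ℝ) by simp) (by linarith)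
  have h2 := arg_neg1 (r := 1) (by norm_num) le_rfl
  simp [sub_eq_add_neg] at this h2
  rw [sub_eq_add_neg]
  linarith

lemma Wexp {T k ν : ℝ} (hT : 5/2 ≤ T) (hk : |k| ≤ 7/10) (hν : ν < (T+k)/2) :
    -T^2 * (Complex.log (1 + (k + (-1+I)*ν)/T)).im + T*ν ≤ 4 - |ν|/5 := by
  obtain ⟨hk1, hk2⟩ := abs_le.1 hk
  have hT0 : 0 < T := by linarith
  have hT' : 0 < T + k := by linarith
  obtain ⟨p, rfl⟩ : ∃ p, ν = (T+k)*p := ⟨ν/(T+k), by field_simp⟩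
  have hp : p < 1/2 := by
    by_contra h; push Not at h; nlinarith
  have hw : (1 + (k + (-1+I)*(((T+k)*p : ℝ):ℂ))/T : ℂ) = (((T+k)/T : ℝ) : ℂ) * (1 - p + p*I) := by
    have : (T:ℂ) ≠ 0 := by exact_mod_cast hT0.ne'
    push_cast; field_simp; ring
  rw [hw, log_im, arg_real_mul _ (by positivity), ← log_im]
  rcases le_or_gt 0 p with h0 | h0
  · have h := arg_pos h0 hp.le
    rw [abs_of_nonneg (by positivity)]
    set y := T*p with hy
    have hy0 : 0 ≤ y := by positivity
    have h3 : k*p ≤ 7/25 * y := by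
      rw [hy]; nlinarith
    have h4 : T^2*(p+p^2/2) ≤ T^2 * (Complex.log (1 - p + p*I)).im := by gcongr
    have h5 : T^2*(p+p^2/2) = T*y + y^2/2 := by rw [hy]; ring
    have h6 : T*((T+k)*p) = T*y + k*y := by rw [hy]; ring
    have h7 : (T+k)*p = y + k*p := by rw [hy]; ring
    rw [h6, h7]
    nlinarith [sq_nonneg (y-1)]
  · obtain ⟨r, rfl⟩ : ∃ r, p = -r := ⟨-p, by ring⟩
    have hr : 0 < r := by linarith
    rw [abs_of_nonpos (by nlinarith)]
    rw [show (1 - ((-r:ℝ):ℂ) + ((-r:ℝ):ℂ)*I) = 1 + r - r*I by push_cast; ring]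
    set y := T*r with hy
    have hy0 : 0 ≤ y := by positivity
    have h3 : k*r ≤ 7/25 * y := by
      rw [hy]; nlinarith
    have h7 : -((T+k)*(-r)) = y + k*r := by rw [hy]; ring
    have h6 : T*((T+k)*(-r)) = -T*y - k*y := by rw [hy]; ring
    have hky : -(k*y) ≤ 7/10*y := by nlinarith
    rw [h6, h7]
    rcases le_or_gt r 1 with h1 | h1
    · have h := arg_neg1 hr.le h1
      have h4 : T^2*(-r+2/5*r^2) ≤ T^2 * (Complex.log (1 + r - r*I)).im := by gcongr
      have h5 : T^2*(-r+2/5*r^2) = -T*y + 2/5*y^2 := by rw [hy]; ring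
      nlinarith [sq_nonneg (y-2)]
    · have h := arg_neg2 h1.le
      have h4 : T^2*(-r+2/5*r) ≤ T^2 * (Complex.log (1 + r - r*I)).im := by gcongr
      have h5 : T^2*(-r+2/5*r) = -T*y + 2/5*(T*y) := by rw [hy]; ring
      have h8 : 5/2*y ≤ T*y := by gcongr
      nlinarith

def zz (k ν : ℝ) : ℂ := k + (-1+I)*ν

lemma zz_im (k ν : ℝ) : (zz k ν).im = ν := by simp [zz]
lemma zz_re (k ν : ℝ) : (zz k ν).re = k - ν := by simp [zz]; ring

lemma zz_sq (k ν : ℝ) : ‖zz k ν‖^2 = 2*ν^2 - 2*k*ν + k^2 := by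
  rw [← normSq_eq_norm_sq, normSq_apply, zz_re, zz_im]; ring

lemma zz_le {k ν : ℝ} (hk : |k| ≤ 7/10) : ‖zz k ν‖ ≤ 1 + 3/2*|ν| := by
  obtain ⟨hk1, hk2⟩ := abs_le.1 hk
  apply abs_le_of_sq_le_sq' _ (by positivity) |>.2
  rw [zz_sq]
  have h1 : -(k*ν) ≤ 7/10*|ν| := by
    calc _ ≤ |k*ν| := neg_le_abs _
      _ ≤ _ := by rw [abs_mul]; gcongr
  have : ν^2 = |ν|^2 := (sq_abs ν).symm
  rw [this]
  nlinarith [abs_nonneg ν, sq_nonneg (|ν|)]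

lemma zz_exp (k ν : ℝ) : ‖cexp (-I*(zz k ν)^2/2)‖ = rexp (k*ν-ν^2) := by
  rw [norm_exp]
  congr 1
  have : (zz k ν)^2 = ((k-ν:ℝ) + ν*I)^2 := by simp only [zz]; push_cast; ring
  rw [this]
  simp [pow_two]
  ring

def Wz (s z : ℂ) : ℂ := cexp ((s-1)*Complex.log (1+z/(Real.sqrt s.im:ℂ)) - I*(Real.sqrt s.im:ℂ)*z)

lemma sqrt_ge {t : ℝ} (ht : 2*π ≤ t) : 5/2 ≤ Real.sqrt t := by
  apply le_sqrt_of_sq_le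
  have := pi_gt_d2
  linarith

lemma Wz_bdd (A B : ℝ) : ∃ M : ℕ, ∃ C : ℝ, 0 ≤ C ∧ ∀ s : ℂ, s.re ∈ Set.Icc A B → 2*π ≤ s.im → ∀ k ν : ℝ, |k| ≤ 7/10 →
    ν < (Real.sqrt s.im+k)/2 → ‖Wz s (zz k ν)‖ ≤ C * (1+‖zz k ν‖)^M * rexp (-|ν|/5) := by
  obtain ⟨M, hM⟩ := exists_nat_ge (|A|+|B|+1)
  refine ⟨M, 4^M*rexp 4, by positivity, fun s hs ht k ν hk hν => ?_⟩
  have hT := sqrt_ge ht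
  have hWe := Wexp hT hk hν
  have hTs : Real.sqrt s.im^2 = s.im := sq_sqrt (by have := pi_pos; linarith)
  set T := Real.sqrt s.im with hTdef
  obtain ⟨hk1, hk2⟩ := abs_le.1 hk
  have hT0 : 0 < T := by linarith
  set w : ℂ := 1 + zz k ν/T with hw
  have hwre : w.re = 1 + (k-ν)/T := by
    rw [hw, add_re, div_ofReal_re, zz_re]; simp
  have hwl : 1/4 ≤ ‖w‖ := by
    refine le_trans ?_ (re_le_norm w)
    rw [hwre]
    have : -(3/4) ≤ (k-ν)/T := by rw [le_div_iff₀ hT0]; nlinarith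
    linarith
  have hwu : ‖w‖ ≤ 1+‖zz k ν‖ := by
    refine (norm_add_le _ _).trans ?_
    rw [norm_one, norm_div, norm_real, norm_of_nonneg hT0.le]
    gcongr
    apply div_le_self (norm_nonneg _); linarith
  have hlog : |Real.log ‖w‖| ≤ Real.log (4*(1+‖zz k ν‖)) := by
    rw [abs_le]
    have hz := norm_nonneg (zz k ν)
    constructor
    · rw [← Real.log_inv]
      apply log_le_log (by positivity)
      rw [inv_le_comm₀ (by positivity) (by positivity)]
      refine le_trans ?_ (show (4:ℝ) ≤ _ by linarith)
      rw [inv_le_comm₀ (by linarith) (by norm_num)]; linarith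
    · apply log_le_log (by linarith); linarith
  have hsr : |s.re - 1| ≤ M := by
    refine le_trans ?_ hM
    rw [abs_le]
    have := neg_abs_le A; have := le_abs_self B; have := abs_nonneg A; have := abs_nonneg B
    constructor <;> linarith [hs.1, hs.2]
  unfold Wz
  rw [norm_exp]
  have hre : ((s-1)*Complex.log w - I*(T:ℂ)*zz k ν).re = (s.re-1)*Real.log ‖w‖ + (-T^2*(Complex.log w).im + T*ν) := by
    rw [sub_re, mul_re, hTs, log_re]
    have : (I*(T:ℂ)*zz k ν).re = -T*ν := by
      rw [mul_assoc, I_mul_re, im_ofReal_mul, zz_im]; ring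
    rw [this]; simp; ring
  rw [hre]
  have h1 : (s.re-1)*Real.log ‖w‖ ≤ M*Real.log (4*(1+‖zz k ν‖)) := by
    calc _ ≤ |(s.re-1)*Real.log ‖w‖| := le_abs_self _
      _ ≤ _ := by rw [abs_mul]; gcongr
  calc rexp _ ≤ rexp (M*Real.log (4*(1+‖zz k ν‖)) + (4-|ν|/5)) := by
        apply exp_le_exp.2
        exact add_le_add h1 hWe
    _ = _ := by
        rw [Real.exp_add, sub_eq_add_neg, Real.exp_add, Real.exp_nat_mul, Real.exp_log (by positivity), mul_pow, neg_div]
        ring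
end P7

section P8
open Filter Topology

lemma maj_geo {p : ℕ → ℂ} {K : ℝ} (h : ∀ j, 1 ≤ j → ‖p j‖ ≤ K) (z : ℂ) :
    Maj (pz (fun j => p j * z^j)) (1/8/(1+‖z‖)) (K/7) := by
  have hz := norm_nonneg z
  have hg : HasSum (fun j : ℕ => K*(1/8:ℝ)^j - if j = 0 then K else 0) (K*(1-1/8)⁻¹ - K) :=
    ((hasSum_geometric_of_lt_one (by norm_num) (by norm_num)).mul_left K).sub (hasSum_ite_eq 0 K)
  have : K*(1-1/8)⁻¹ - K = K/7 := by norm_num; ring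
  rw [this] at hg
  refine Maj.of_le (by positivity) hg fun j => ?_
  unfold pz
  split_ifs with hj
  · simp [hj]
  · rw [norm_mul, norm_pow, sub_zero, mul_assoc, ← mul_pow]
    have h1 : ‖z‖ * (1/8/(1+‖z‖)) ≤ 1/8 := by
      rw [mul_div_assoc', div_le_iff₀ (by positivity)]; nlinarith
    have h2 := h j (by omega)
    exact mul_le_mul h2 (pow_le_pow_left₀ (by positivity) h1 _) (by positivity) ((norm_nonneg _).trans h2)

lemma ecoef_scale (p : ℕ → ℂ) (z : ℂ) (i : ℕ) : ecoef (fun j => p j * z^j) i = ecoef p i * z^i := by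
  unfold ecoef
  rw [sum_mul]
  refine sum_congr rfl fun k _ => ?_
  rw [obell_scale]; ring

lemma seqA_norm (j : ℕ) (hj : 1 ≤ j) : ‖seqA j‖ ≤ 1/3 := by
  unfold seqA
  rw [norm_div, norm_pow, norm_neg, norm_one, one_pow]
  have : ‖(j:ℂ)+2‖ = (j:ℝ)+2 := by
    rw [show (j:ℂ)+2 = ((j+2:ℕ):ℂ) by push_cast; ring, Complex.norm_natCast]; push_cast; ring
  rw [this]
  have : (1:ℝ) ≤ j := by exact_mod_cast hj
  gcongr; linarith

lemma seqB_norm (j : ℕ) (hj : 1 ≤ j) : ‖seqB j‖ ≤ 1 := by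
  unfold seqB
  rw [norm_div, norm_pow, norm_neg, norm_one, one_pow, Complex.norm_natCast]
  have : (1:ℝ) ≤ j := by exact_mod_cast hj
  rw [div_le_one (by linarith)]; exact this

lemma serA {T : ℝ} (hT : 0 < T) {z : ℂ} (hz : ‖z/T‖ < 1) :
    ∑' j, pz (fun j => (I*z^2)*seqA j * z^j) j * ((1/T:ℝ):ℂ)^j =
      I*T^2*Complex.log (1+z/T) - I*T*z + I*z^2/2 := by
  have hTc : (T:ℂ) ≠ 0 := by exact_mod_cast hT.ne'
  have h := hasSum_taylorSeries_log hz
  rw [← hasSum_nat_add_iff' 2] at h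
  have h2 := (h.mul_left (I*(T:ℂ)^2)).sub (hasSum_ite_eq 0 (-(I*z^2/2)))
  refine (hs_congr h2 (fun j => ?_) ?_).tsum_eq
  · unfold pz seqA
    split_ifs with hj
    · subst hj; simp; field_simp; ring
    · have : (j:ℂ)+2 ≠ 0 := by exact_mod_cast (show j+2 ≠ 0 by omega)
      push_cast
      rw [div_pow, div_pow z, pow_add z, pow_add (T:ℂ), sub_zero, one_pow]
      field_simp
      ring
  · simp [sum_range_succ]; field_simp

lemma serB {T : ℝ} (hT : 0 < T) {z : ℂ} (hz : ‖z/T‖ < 1) (c : ℂ) :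
    ∑' j, pz (fun j => c*seqB j * z^j) j * ((1/T:ℝ):ℂ)^j = c*Complex.log (1+z/T) := by
  have hTc : (T:ℂ) ≠ 0 := by exact_mod_cast hT.ne'
  have h := (hasSum_taylorSeries_log hz).mul_left c
  refine (hs_congr h (fun j => ?_) rfl).tsum_eq
  unfold pz seqB
  split_ifs with hj
  · subst hj; simp
  · push_cast; rw [div_pow, div_pow, one_pow]; ring

lemma bco_maj (A B : ℝ) (N : ℕ) : ∃ S : ℝ, 0 ≤ S ∧ ∀ σ ∈ Set.Icc A B, ∀ ρ : ℝ, 0 ≤ ρ → ρ ≤ 1 → Maj (bco σ N) ρ S := by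
  choose c h0 hc using fun l => bdd_of_cont A B (um_cont l)
  refine ⟨∑ k ∈ range N, c (k/2), sum_nonneg fun j _ => h0 _, fun σ hσ ρ hρ hρ1 => ?_⟩
  have hs1 : HasSum (fun i => ‖bco σ N i‖ * ρ^i) (∑ i ∈ range N, ‖bco σ N i‖ * ρ^i) :=
    hasSum_sum_of_ne_finset_zero (fun j hj => by
      rw [bco, if_neg]; · simp
      · simp at hj; omega)
  refine ⟨hs1.summable, hs1.tsum_eq.le.trans (sum_le_sum fun k _ => ?_)⟩
  have h1 : ‖bco σ N k‖ ≤ c (k/2) := by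
    unfold bco; split_ifs
    · simpa using hc _ σ hσ
    · simpa using h0 _
  calc _ ≤ c (k/2) * 1 := mul_le_mul h1 (pow_le_one₀ hρ hρ1) (by positivity) (h0 _)
    _ = _ := mul_one _

lemma bco_sum (σ : ℝ) (N : ℕ) {T : ℝ} (hT : 0 < T) : ∑' k, bco σ N k * ((1/T:ℝ):ℂ)^k =
    ∑ m ∈ range ((N+1)/2), um m σ * (-I/((T^2:ℝ):ℂ))^m := by
  rw [tsum_eq_sum (s := range N) (fun j hj => by
      rw [bco, if_neg]; · simp
      · simp at hj; omega)]
  symm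
  refine sum_of_injOn (fun j => 2*j) ?_ ?_ ?_ ?_
  · intro i hi j hj h; simp only at h; omega
  · intro i hi; simp only [coe_range, Set.mem_Iio] at hi ⊢; omega
  · intro i hi hi2
    simp only [coe_range, Set.mem_image, Set.mem_Iio, mem_range] at hi hi2
    have : ¬ (Even i ∧ i < N) := by
      rintro ⟨⟨k, hk⟩, _⟩; exact hi2 ⟨k, by omega, by omega⟩
    rw [bco, if_neg this, zero_mul]
  · intro j hj
    simp only [mem_range] at hj
    rw [bco, if_pos ⟨even_two_mul j, by omega⟩, show 2*j/2=j by omega, pow_mul, div_eq_mul_inv, mul_pow, mul_assoc]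
    push_cast; simp

lemma near_est {ϑ : ℂ → ℂ} (hϑ : IsRSTheta ϑ) (A B : ℝ) (N : ℕ) : ∃ C, 0 ≤ C ∧ ∀ s : ℂ, s.re ∈ Set.Icc A B →
    2*π ≤ s.im → ∀ z : ℂ, 1+‖z‖ ≤ Real.sqrt s.im/8 →
    ‖Uf ϑ s * wfun s z - ∑ n ∈ range N, pn n s.re z * ((1/Real.sqrt s.im:ℝ):ℂ)^n‖ ≤
      C * (1/Real.sqrt s.im)^N * (1+‖z‖)^N * rexp (‖z‖^2/21) := by
  obtain ⟨C1, h10, h1⟩ := U_asym hϑ A B ((N+1)/2)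
  obtain ⟨S, hS0, hS⟩ := bco_maj A B N
  set L := (|A|+|B|+1)/7 with hL
  refine ⟨(C1 + 8^N*S)*rexp L, by positivity, fun s hs ht z hz => ?_⟩
  have hT := sqrt_ge ht
  have hTs : Real.sqrt s.im^2 = s.im := sq_sqrt (by have := pi_pos; linarith)
  have hU := h1 s hs ht
  unfold wfun
  set T := Real.sqrt s.im with hTdef
  have hT0 : 0 < T := by linarith
  have hzn := norm_nonneg z
  set ρ := 1/8/(1+‖z‖) with hρ
  have hρ0 : 0 < ρ := by positivity
  have hρ1 : ρ ≤ 1 := by rw [hρ, div_le_one (by positivity)]; linarith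
  set x : ℂ := ((1/T:ℝ):ℂ) with hx
  have hxn : ‖x‖ = 1/T := by rw [hx, norm_real, norm_of_nonneg (by positivity)]
  have hxρ : ‖x‖ ≤ ρ := by
    rw [hxn, hρ, div_div, div_le_div_iff₀ (by positivity) (by positivity)]; linarith
  have hzT : ‖z/T‖ < 1 := by
    rw [norm_div, norm_real, norm_of_nonneg hT0.le, div_lt_one hT0]; linarith
  have hsr : ‖((s.re:ℂ)-1)‖ ≤ |A|+|B|+1 := by
    rw [show ((s.re:ℂ)-1) = ((s.re-1:ℝ):ℂ) by push_cast; ring, norm_real, norm_eq_abs, abs_le]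
    have := neg_abs_le A; have := le_abs_self B; have := abs_nonneg A; have := abs_nonneg B
    constructor <;> linarith [hs.1, hs.2]
  have mA : Maj (pz (fun j => (I*z^2)*seqA j * z^j)) ρ (‖z‖^2/3/7) := by
    refine maj_geo (p := fun j => (I*z^2)*seqA j) (fun j hj => ?_) z
    rw [norm_mul, norm_mul, norm_I, one_mul, norm_pow]
    calc _ ≤ ‖z‖^2*(1/3) := by gcongr; exact seqA_norm j hj
      _ = _ := by ring
  have mB : Maj (pz (fun j => ((s.re:ℂ)-1)*seqB j * z^j)) ρ L := by
    refine maj_geo (p := fun j => ((s.re:ℂ)-1)*seqB j) (fun j hj => ?_) z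
    rw [norm_mul]
    calc _ ≤ (|A|+|B|+1)*1 := by gcongr; exact seqB_norm j hj
      _ = _ := by ring
  obtain ⟨eA, fA⟩ := mA.exp hρ0.le
  obtain ⟨eB, fB⟩ := mB.exp hρ0.le
  have eAB := eA.mul eB hρ0.le
  have fAB := eA.tsum_mul eB hxρ
  have hcm : ∀ i, cmul (ecoef (fun j => (I*z^2)*seqA j * z^j)) (ecoef (fun j => ((s.re:ℂ)-1)*seqB j * z^j)) i
      = aco s.re z i * z^i := by
    intro i
    unfold aco cmul
    rw [sum_mul]
    refine sum_congr rfl fun kl hkl => ?_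
    rw [← HasAntidiagonal.mem_antidiagonal.1 hkl, ecoef_scale, ecoef_scale]; ring
  have hcm' : cmul (ecoef (fun j => (I*z^2)*seqA j * z^j)) (ecoef (fun j => ((s.re:ℂ)-1)*seqB j * z^j))
      = fun i => aco s.re z i * z^i := funext hcm
  rw [hcm'] at eAB fAB
  rw [fA x hxρ, fB x hxρ, serA hT0 hzT, serB hT0 hzT, ← Complex.exp_add] at fAB
  have hexp : I*(T:ℂ)^2*Complex.log (1+z/T) - I*T*z + I*z^2/2 + ((s.re:ℂ)-1)*Complex.log (1+z/T) =
      (s-1)*Complex.log (1+z/T) - I*T*z + I*z^2/2 := by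
    have : s = s.re + T^2*I := by
      rw [show (T:ℂ)^2 = (s.im:ℂ) by exact_mod_cast hTs, re_add_im]
    linear_combination -Complex.log (1+z/T) * this
  rw [hexp] at fAB
  set w := cexp ((s-1)*Complex.log (1+z/T) - I*T*z + I*z^2/2) with hw
  have hb := hS s.re hs ρ hρ0.le hρ1
  have hba := hb.mul eAB hρ0.le
  have fba := hb.tsum_mul eAB hxρ
  have htail := hba.tail hρ0 hxρ N
  rw [fba, fAB, bco_sum _ _ hT0, hTs] at htail
  rw [sum_congr rfl fun n hn => by rw [pn_eq n N (mem_range.1 hn)]]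
  have hwn : ‖w‖ ≤ rexp (‖z‖^2/3/7) * rexp L := by
    have := eAB.tail hρ0 hxρ 0
    rw [fAB] at this
    simpa using this
  have e3 : ‖z‖^2/3/7 = ‖z‖^2/21 := by ring
  rw [e3] at hwn htail
  have hUb : C1*(1/s.im)^((N+1)/2) ≤ C1 * (1/T)^N := by
    have hT1 : 1/T ≤ 1 := by rw [div_le_one hT0]; linarith
    rw [← hTs, show 1/T^2 = (1/T)^2 by rw [div_pow, one_pow], ← pow_mul]
    have : (1/T)^(2*((N+1)/2)) ≤ (1/T)^N := pow_le_pow_of_le_one (by positivity) hT1 (by omega)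
    gcongr
  set u := ∑ m ∈ range ((N+1)/2), um m s.re * (-I/(s.im:ℂ))^m with hu
  set q := ∑ n ∈ range N, cmul (bco s.re N) (fun i => aco s.re z i * z^i) n * x^n with hq
  have : Uf ϑ s * w - q = (Uf ϑ s - u)*w + (u*w - q) := by ring
  rw [this]
  refine (norm_add_le _ _).trans ?_
  rw [norm_mul]
  have e4 : (‖x‖/ρ)^N = (1/T)^N * (8^N*(1+‖z‖)^N) := by
    rw [← mul_pow, ← mul_pow, hxn, hρ]; congr 1; field_simp
  rw [e4] at htail
  have e5 : (1:ℝ) ≤ (1+‖z‖)^N := one_le_pow₀ (by linarith)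
  calc _ ≤ C1*(1/T)^N * (rexp (‖z‖^2/21)*rexp L) + _ := by
        gcongr; exact hU.trans hUb
    _ ≤ C1*(1/T)^N * (1+‖z‖)^N * (rexp (‖z‖^2/21)*rexp L) + _ := by
        refine add_le_add (mul_le_mul_of_nonneg_right ?_ (by positivity)) le_rfl
        exact le_mul_of_one_le_right (by positivity) e5
    _ ≤ _ := add_le_add_right htail _
    _ = _ := by ring
lemma main_est {ϑ : ℂ → ℂ} (hϑ : IsRSTheta ϑ) (A B : ℝ) (N : ℕ) : ∃ C, 0 ≤ C ∧ ∀ s : ℂ, s.re ∈ Set.Icc A B →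
    2*π ≤ s.im → ∀ k ν : ℝ, |k| ≤ 7/10 →
    ‖(if ν < (Real.sqrt s.im + k)/2 then Uf ϑ s * Wz s (zz k ν) else 0) -
      (∑ n ∈ range N, pn n s.re (zz k ν) * ((1/Real.sqrt s.im:ℝ):ℂ)^n) * cexp (-I*(zz k ν)^2/2)‖ ≤
      C * (1/Real.sqrt s.im)^N * rexp (-|ν|/10) := by
  obtain ⟨C1, h10, h1⟩ := near_est hϑ A B N
  obtain ⟨M, C2, h20, h2⟩ := Wz_bdd A B
  obtain ⟨C3, h30, h3⟩ := U_asym hϑ A B 0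
  choose c4 h40 h4 using fun n => pn_bdd A B n
  obtain ⟨D1, d10, d1⟩ := poly_exp N (c := 1) one_pos
  obtain ⟨D2, d20, d2⟩ := poly_exp (N+M) (c := 1/15) (by norm_num)
  choose D3 d30 d3 using fun n => poly_exp (N+3*n) (c := 1) one_pos
  set C4 := ∑ n ∈ range N, c4 n * D3 n with hC4
  have hC40 : 0 ≤ C4 := sum_nonneg fun n _ => mul_nonneg (h40 n) (d30 n)
  refine ⟨C1*D1*rexp 6 + 8^N*C4*rexp 6 + C3*C2*8^N*D2*rexp 6, by positivity, fun s hs ht k ν hk => ?_⟩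
  have hT := sqrt_ge ht
  have hTs : Real.sqrt s.im^2 = s.im := sq_sqrt (by have := pi_pos; linarith)
  have hN1 := h1 s hs ht (zz k ν)
  have hW := h2 s hs ht k ν hk
  have hU := h3 s hs ht
  simp only [range_zero, sum_empty, sub_zero, pow_zero, mul_one] at hU
  have hwz : Wz s (zz k ν) = wfun s (zz k ν) * cexp (-I*(zz k ν)^2/2) := by
    unfold Wz wfun
    rw [← Complex.exp_add]; congr 1; ring
  set T := Real.sqrt s.im with hTdef
  have hT0 : 0 < T := by linarith
  obtain ⟨hk1, hk2⟩ := abs_le.1 hk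
  have hzl := zz_le (ν := ν) hk
  have hzs := zz_sq k ν
  have hze := zz_exp k ν
  set z := zz k ν with hz
  have hzn := norm_nonneg z
  have hν2 : ν^2 = |ν|^2 := (sq_abs ν).symm
  have hνn := abs_nonneg ν
  have hkν : k*ν ≤ 7/10*|ν| := by
    calc _ ≤ |k*ν| := le_abs_self _
      _ ≤ _ := by rw [abs_mul]; gcongr
  have hkν' : -(k*ν) ≤ 7/10*|ν| := by
    calc _ ≤ |k*ν| := neg_le_abs _
      _ ≤ _ := by rw [abs_mul]; gcongr
  have hg1 : ‖z‖ + ‖z‖^2/21 + (k*ν-ν^2) ≤ 6 - |ν|/10 := by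
    rw [hzs, hν2]; nlinarith [sq_nonneg (|ν| - 2)]
  have hg2 : ‖z‖ + (k*ν-ν^2) ≤ 6 - |ν|/10 := by
    rw [hν2]; nlinarith [sq_nonneg (|ν| - 2)]
  have e6 : rexp (6-|ν|/10) = rexp 6 * rexp (-|ν|/10) := by
    rw [← Real.exp_add]; congr 1; ring
  by_cases hc : 1+‖z‖ ≤ T/8
  · have hν : ν < (T+k)/2 := by
      have : ν ≤ ‖z‖ := by
        have := abs_im_le_norm z
        rw [hz, zz_im] at this; exact (le_abs_self ν).trans this
      linarith
    rw [if_pos hν, hwz, ← mul_assoc, ← sub_mul, norm_mul, hze]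
    calc _ ≤ C1*(1/T)^N*(1+‖z‖)^N*rexp (‖z‖^2/21) * rexp (k*ν-ν^2) := by
          gcongr; exact hN1 hc
      _ ≤ C1*(1/T)^N*(D1 * rexp (1*‖z‖))*rexp (‖z‖^2/21) * rexp (k*ν-ν^2) := by
          gcongr; exact d1 _ hzn
      _ = C1*(1/T)^N*D1*rexp (‖z‖ + ‖z‖^2/21 + (k*ν-ν^2)) := by
          rw [Real.exp_add, Real.exp_add, one_mul]; ring
      _ ≤ C1*(1/T)^N*D1*rexp (6-|ν|/10) := by gcongr
      _ = (C1*D1*rexp 6)*((1/T)^N*rexp (-|ν|/10)) := by rw [e6]; ring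
      _ ≤ (C1*D1*rexp 6 + 8^N*C4*rexp 6 + C3*C2*8^N*D2*rexp 6)*((1/T)^N*rexp (-|ν|/10)) := by
          gcongr
          have : 0 ≤ 8^N*C4*rexp 6 := by positivity
          have : 0 ≤ C3*C2*8^N*D2*rexp 6 := by positivity
          linarith
      _ = _ := by ring
  · push Not at hc
    have hfar : 1 ≤ 8^N*(1/T)^N*(1+‖z‖)^N := by
      rw [← mul_pow, ← mul_pow]
      apply one_le_pow₀
      rw [show 8*(1/T)*(1+‖z‖) = (8*(1+‖z‖))/T by ring, le_div_iff₀ hT0]; linarith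
    have hx1 : ‖((1/T:ℝ):ℂ)‖ ≤ 1 := by
      rw [norm_real, norm_of_nonneg (by positivity), div_le_one hT0]; linarith
    have hp2 : ‖(∑ n ∈ range N, pn n s.re z * ((1/T:ℝ):ℂ)^n) * cexp (-I*z^2/2)‖ ≤
        (8^N*C4*rexp 6)*((1/T)^N*rexp (-|ν|/10)) := by
      rw [norm_mul, hze]
      have : ‖∑ n ∈ range N, pn n s.re z * ((1/T:ℝ):ℂ)^n‖ ≤ 8^N*(1/T)^N*C4*rexp ‖z‖ := by
        rw [hC4, mul_sum, sum_mul]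
        refine norm_sum_le_of_le _ fun n _ => ?_
        rw [norm_mul, norm_pow]
        calc _ ≤ ‖pn n s.re z‖ * 1 := by gcongr; exact pow_le_one₀ (norm_nonneg _) hx1
          _ ≤ c4 n*(1+‖z‖)^(3*n) := by rw [mul_one]; exact h4 n s.re hs z
          _ ≤ c4 n*(1+‖z‖)^(3*n) * (8^N*(1/T)^N*(1+‖z‖)^N) :=
              le_mul_of_one_le_right (mul_nonneg (h40 n) (by positivity)) hfar
          _ = 8^N*(1/T)^N*c4 n*(1+‖z‖)^(N+3*n) := by rw [pow_add]; ring
          _ ≤ 8^N*(1/T)^N*c4 n*(D3 n * rexp (1*‖z‖)) := by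
              have := h40 n
              gcongr; exact d3 n _ hzn
          _ = _ := by rw [one_mul]; ring
      calc _ ≤ 8^N*(1/T)^N*C4*rexp ‖z‖*rexp (k*ν-ν^2) := by gcongr
        _ = 8^N*(1/T)^N*C4*rexp (‖z‖ + (k*ν-ν^2)) := by rw [Real.exp_add]; ring
        _ ≤ 8^N*(1/T)^N*C4*rexp (6-|ν|/10) := by gcongr
        _ = _ := by rw [e6]; ring
    have hp1 : ‖(if ν < (T + k)/2 then Uf ϑ s * Wz s z else 0)‖ ≤
        (C3*C2*8^N*D2*rexp 6)*((1/T)^N*rexp (-|ν|/10)) := by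
      split_ifs with hν
      · rw [norm_mul]
        calc _ ≤ C3*(C2*(1+‖z‖)^M*rexp (-|ν|/5)) := by gcongr; exact hW hν
          _ ≤ C3*(C2*(1+‖z‖)^M*rexp (-|ν|/5)) * (8^N*(1/T)^N*(1+‖z‖)^N) :=
              le_mul_of_one_le_right (by positivity) hfar
          _ = C3*C2*8^N*(1/T)^N*(1+‖z‖)^(N+M)*rexp (-|ν|/5) := by rw [pow_add]; ring
          _ ≤ C3*C2*8^N*(1/T)^N*(D2*rexp (1/15*‖z‖))*rexp (-|ν|/5) := by
              gcongr; exact d2 _ hzn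
          _ = C3*C2*8^N*(1/T)^N*D2*rexp (1/15*‖z‖-|ν|/5) := by
              rw [sub_eq_add_neg, Real.exp_add, neg_div]; ring
          _ ≤ C3*C2*8^N*(1/T)^N*D2*rexp (6-|ν|/10) :=
              mul_le_mul_of_nonneg_left (exp_le_exp.2 (by linarith)) (by positivity)
          _ = _ := by rw [e6]; ring
      · rw [norm_zero]; positivity
    refine (norm_sub_le _ _).trans ((add_le_add hp1 hp2).trans ?_)
    rw [mul_assoc _ ((1/T)^N), ← add_mul]
    refine mul_le_mul_of_nonneg_right ?_ (by positivity)
    have : 0 ≤ C1*D1*rexp 6 := by positivity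
    linarith
end P8

section P9
open Filter Topology

def ww : ℂ := cexp (3 * (π:ℂ) * I / 4)
def Kk (y : ℂ) : ℂ := 1 / (cexp (2 * (π:ℂ) * I * y) - 1)

lemma ww_eq : ww = (-1 + I) * ((√2/2 : ℝ):ℂ) := by
  rw [ww, show 3 * (π:ℂ) * I / 4 = (π - π/4 : ℂ) * I by ring, exp_mul_I,
    Complex.cos_pi_sub, Complex.sin_pi_sub]
  have h1 : Complex.cos (π/4) = ((√2/2 : ℝ):ℂ) := by
    rw [← cos_pi_div_four]; push_cast; rfl
  have h2 : Complex.sin (π/4) = ((√2/2 : ℝ):ℂ) := by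
    rw [← sin_pi_div_four]; push_cast; rfl
  rw [h1, h2]; ring
lemma ww_re : ww.re = -(√2/2) := by rw [ww_eq, re_mul_ofReal]; simp
lemma ww_im : ww.im = √2/2 := by rw [ww_eq, im_mul_ofReal]; simp
lemma r2 : √2 * √2 = 2 := mul_self_sqrt (by norm_num)
lemma ww_sq : ww * ww = -I := by
  rw [ww_eq]
  have : (((√2/2:ℝ)):ℂ) * ((√2/2:ℝ):ℂ) = 1/2 := by
    rw [← ofReal_mul, show √2/2*(√2/2) = (√2*√2)/4 by ring, r2]; norm_num
  linear_combination (-1 + I)*(-1+I) * this + (1/2:ℂ) * I_sq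
lemma ww_norm : ‖ww‖ = 1 := by
  rw [ww, show 3 * (π:ℂ) * I / 4 = ((3*π/4 : ℝ):ℂ) * I by push_cast; ring, norm_exp_ofReal_mul_I]
lemma ln_re (p v : ℝ) : ((p:ℂ) + ww * v).re = p - √2/2*v := by
  simp [ww_re]; ring
lemma ln_im (p v : ℝ) : ((p:ℂ) + ww * v).im = √2/2*v := by
  simp [ww_im]

lemma sq_dom_int (C : ℝ) : Integrable (fun v : ℝ => C/(1+v^2)) := by
  simpa [div_eq_mul_inv] using integrable_inv_one_add_sq.const_mul C

lemma gauss_dom {κ : ℝ} (D : ℝ) (hκ : 0 < κ) :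
    ∃ C, 0 ≤ C ∧ ∀ v : ℝ, rexp (D*(1+|v|) - κ*v^2) ≤ C/(1+v^2) := by
  refine ⟨2*rexp (D + (D+1)^2/(4*κ)), by positivity, fun v => ?_⟩
  rw [le_div_iff₀ (by positivity)]
  have h1 : 1 + v^2 ≤ 2*rexp |v| := by
    have := quadratic_le_exp_of_nonneg (abs_nonneg v)
    have h2 := sq_abs v
    nlinarith [abs_nonneg v]
  calc _ ≤ rexp (D*(1+|v|) - κ*v^2) * (2*rexp |v|) := by gcongr
    _ = 2*rexp (D*(1+|v|) - κ*v^2 + |v|) := by rw [Real.exp_add]; ring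
    _ ≤ _ := by
      refine mul_le_mul_of_nonneg_left (exp_le_exp.2 ?_) (by norm_num)
      have : (D+1)^2/(4*κ) - ((D+1)*|v| - κ*v^2) = (2*κ*|v| - (D+1))^2/(4*κ) := by
        rw [← sq_abs v]; field_simp; ring
      have h3 : 0 ≤ (2*κ*|v| - (D+1))^2/(4*κ) := by positivity
      nlinarith

lemma line_shift {f : ℂ → ℂ} {p0 p1 C : ℝ} (h : p0 ≤ p1)
    (hd : ∀ y : ℂ, p0 ≤ y.re + y.im → y.re + y.im ≤ p1 → DifferentiableAt ℂ f y)
    (hb : ∀ p ∈ Set.Icc p0 p1, ∀ v : ℝ, ‖f (p + ww*v)‖ ≤ C/(1+v^2)) :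
    ∫ v : ℝ, f (p0 + ww*v) = ∫ v : ℝ, f (p1 + ww*v) := by
  set F : ℂ → ℂ := fun u => f (-ww*u) with hF
  have key : ∀ x y : ℝ, -ww * (x + y*I) = ((√2*y:ℝ):ℂ) + ww*((y-x:ℝ):ℂ) := by
    intro x y
    apply Complex.ext
    · rw [ln_re]; simp [ww_re, ww_im]; ring
    · rw [ln_im]; simp [ww_re, ww_im]; ring
  have hreim : ∀ u : ℂ, (-ww*u).re + (-ww*u).im = √2*u.im := by
    intro u; simp [ww_re, ww_im]; ring
  have hs : (0:ℝ) < √2 := by positivity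
  set h0 := p0/√2
  set h1 := p1/√2
  have e0 : √2*h0 = p0 := by simp only [h0]; field_simp
  have e1 : √2*h1 = p1 := by simp only [h1]; field_simp
  have h01 : h0 ≤ h1 := by simp only [h0, h1]; gcongr
  have hC : 0 ≤ C := by
    have := (norm_nonneg _).trans (hb p0 ⟨le_rfl, h⟩ 0)
    simpa using this
  have hFd : ∀ u : ℂ, u.im ∈ Set.Icc h0 h1 → DifferentiableAt ℂ F u := by
    intro u hu
    have h2 := hreim u
    refine DifferentiableAt.comp u (hd _ ?_ ?_) (by fun_prop)
    · rw [h2, ← e0]; exact mul_le_mul_of_nonneg_left hu.1 hs.le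
    · rw [h2, ← e1]; exact mul_le_mul_of_nonneg_left hu.2 hs.le
  have hFb : ∀ x y : ℝ, y ∈ Set.Icc h0 h1 → ‖F (x+y*I)‖ ≤ C/(1+(y-x)^2) := by
    intro x y hy
    simp only [hF]; rw [key]
    refine hb _ ⟨?_, ?_⟩ _
    · rw [← e0]; exact mul_le_mul_of_nonneg_left hy.1 hs.le
    · rw [← e1]; exact mul_le_mul_of_nonneg_left hy.2 hs.le
  have hline : ∀ y : ℝ, ∫ x : ℝ, F (x + y*I) = ∫ v : ℝ, f (((√2*y:ℝ):ℂ) + ww*v) := by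
    intro y
    rw [← integral_sub_left_eq_self (fun v : ℝ => f (((√2*y:ℝ):ℂ) + ww*v)) volume y]
    simp only [hF, key]
  have hint : ∀ y ∈ Set.Icc h0 h1, Integrable (fun x : ℝ => F (x+y*I)) := by
    intro y hy
    refine ((sq_dom_int C).comp_sub_left y).mono' ?_ (ae_of_all _ fun x => hFb x y hy)
    refine Continuous.aestronglyMeasurable (continuous_iff_continuousAt.2 fun x => ?_)
    exact ContinuousAt.comp (f := fun x : ℝ => (x:ℂ)+y*I) (hFd _ (by simpa using hy)).continuousAt
      (by fun_prop)
  have m0 : h0 ∈ Set.Icc h0 h1 := ⟨le_rfl, h01⟩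
  have m1 : h1 ∈ Set.Icc h0 h1 := ⟨h01, le_rfl⟩
  have t0 := intervalIntegral_tendsto_integral (hint h0 m0) tendsto_neg_atTop_atBot tendsto_id
  have t1 := intervalIntegral_tendsto_integral (hint h1 m1) tendsto_neg_atTop_atBot tendsto_id
  have vert : ∀ g : ℝ → ℝ, Tendsto (fun X => |g X|) atTop atTop →
      Tendsto (fun X : ℝ => ∫ y in h0..h1, F ((g X : ℂ) + y*I)) atTop (𝓝 0) := by
    intro g hg
    have hM : Tendsto (fun X => C/(1+(|g X| - (|h0|+|h1|))^2) * |h1-h0|) atTop (𝓝 0) := by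
      rw [show (0:ℝ) = 0 * |h1-h0| by simp]
      refine Tendsto.mul_const _ (Tendsto.div_atTop tendsto_const_nhds ?_)
      refine tendsto_atTop_add_const_left _ _ ((tendsto_pow_atTop two_ne_zero).comp ?_)
      simpa [sub_eq_add_neg] using tendsto_atTop_add_const_right _ (-(|h0|+|h1|)) hg
    refine squeeze_zero_norm' ?_ hM
    filter_upwards [hg.eventually_ge_atTop (|h0|+|h1|)] with X hX
    refine intervalIntegral.norm_integral_le_of_norm_le_const fun y hy => ?_
    rw [Set.uIoc_of_le h01] at hy
    refine (hFb _ y ⟨hy.1.le, hy.2⟩).trans ?_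
    have h5 : |y| ≤ |h0|+|h1| := by
      rw [abs_le]; constructor
      · have := neg_abs_le h0; have := abs_nonneg h1; linarith [hy.1]
      · have := le_abs_self h1; have := abs_nonneg h0; linarith [hy.2]
    have h6 : |g X| - (|h0|+|h1|) ≤ |y - g X| := by
      have := abs_sub_abs_le_abs_sub (g X) y
      rw [abs_sub_comm] at this; linarith
    have h7 : (|g X| - (|h0|+|h1|))^2 ≤ (y - g X)^2 := by
      rw [← sq_abs (y - g X)]; exact pow_le_pow_left₀ (by linarith) h6 2
    gcongr
  have v1 := vert (fun X => X) (tendsto_abs_atTop_atTop)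
  have v2 := vert (fun X => -X) (by simpa using tendsto_abs_atTop_atTop)
  have hz : ∀ X : ℝ, (∫ x in (-X)..X, F (x+h0*I)) - (∫ x in (-X)..X, F (x+h1*I))
      + I • (∫ y in h0..h1, F ((X:ℂ) + y*I)) - I • (∫ y in h0..h1, F (((-X:ℝ):ℂ) + y*I)) = 0 := by
    intro X
    have := integral_boundary_rect_eq_zero_of_differentiableOn F ((-X:ℝ)+h0*I) (X+h1*I) ?_
    · simpa using this
    · intro u hu
      refine (hFd u ?_).differentiableWithinAt
      have := hu.2
      simpa [Set.uIcc_of_le h01] using this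
  have tt := ((t0.sub t1).add (v1.const_smul I)).sub (v2.const_smul I)
  have : Tendsto (fun _ : ℝ => (0:ℂ)) atTop
      (𝓝 ((∫ x : ℝ, F (x+h0*I)) - (∫ x : ℝ, F (x+h1*I)) + I • 0 - I • 0)) :=
    tt.congr fun X => by simpa using hz X
  have h8 := tendsto_nhds_unique this tendsto_const_nhds
  rw [hline, hline, e0, e1] at h8
  simpa [sub_eq_zero] using h8

lemma exp_sub_lower {p q η : ℝ} (h0 : 0 < η) (h4 : η ≤ 1/4) (h1 : ∃ n : ℤ, n + η ≤ p + q ∧ p + q ≤ n + 1-η) :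
    η ≤ ‖cexp (2*(π:ℂ)*I*(p+q*I)) - 1‖ := by
  have hpi := pi_gt_three
  have hpi4 := pi_lt_d2
  set r := rexp (-(2*π*q))
  have hr : 0 < r := exp_pos _
  have hw : cexp (2*(π:ℂ)*I*(p+q*I)) =
      ((r * Real.cos (2*π*p) : ℝ):ℂ) + ((r*Real.sin (2*π*p):ℝ):ℂ)*I := by
    rw [show 2*(π:ℂ)*I*(p+q*I) = ((-(2*π*q):ℝ):ℂ) + ((2*π*p:ℝ):ℂ)*I by
      push_cast; linear_combination 2*(π:ℂ)*q*I_sq, Complex.exp_add, exp_mul_I,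
      ← ofReal_exp, ← ofReal_cos, ← ofReal_sin]
    simp only [r]; push_cast; ring
  have hn : ‖cexp (2*(π:ℂ)*I*(p+q*I)) - 1‖^2 = (r-1)^2 + 4*r*(Real.sin (π*p))^2 := by
    rw [hw, Complex.sq_norm, normSq_apply]
    simp only [sub_re, add_re, ofReal_re, mul_re, I_re,
      ofReal_im, I_im, sub_im, add_im, mul_im,
      one_re, one_im]
    have e1 : Real.cos (2*π*p) = 1 - 2*Real.sin (π*p)^2 := by
      rw [mul_assoc, Real.cos_two_mul, Real.cos_sq']; ring
    have e2 := Real.sin_sq_add_cos_sq (2*π*p)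
    rw [e1] at e2 ⊢
    linear_combination r^2*e2
  refine le_of_sq_le_sq ?_ (norm_nonneg _) |> fun h => h
  rw [hn]
  by_cases hq : η/2 ≤ |q|
  · have h5 : η ≤ |r-1| := by
      rcases le_total 0 q with h | h
      · rw [abs_of_nonneg h] at hq
        have h6 : r ≤ rexp (-(π*η)) := exp_le_exp.2 (by nlinarith)
        have h7 : rexp (-(π*η)) ≤ 1/(1+π*η) := by
          rw [Real.exp_neg, ← one_div]
          exact one_div_le_one_div_of_le (by positivity) (by linarith [add_one_le_exp (π*η)])
        have h8 : 1/(1+π*η) ≤ 1-η := by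
          rw [div_le_iff₀ (by positivity)]
          nlinarith [mul_pos h0 (show 0 < π by positivity), mul_nonneg h0.le (show 0 ≤ 1/4-η by linarith)]
        rw [abs_sub_comm]; exact le_trans (by linarith) (le_abs_self _)
      · rw [abs_of_nonpos h] at hq
        have h6 : rexp (π*η) ≤ r := exp_le_exp.2 (by nlinarith)
        have h7 := add_one_le_exp (π*η)
        exact le_trans (by nlinarith) (le_abs_self _)
    have : η^2 ≤ (r-1)^2 := by rw [← sq_abs (r-1)]; exact pow_le_pow_left₀ h0.le h5 2
    have : 0 ≤ 4*r*(Real.sin (π*p))^2 := by positivity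
    linarith
  · push Not at hq
    obtain ⟨n, hn1, hn2⟩ := h1
    have hq1 := (abs_lt.1 hq)
    set p' := p - n
    have hs : Real.sin (π*p)^2 = Real.sin (π*p')^2 := by
      rw [sin_sq_eq_half_sub, sin_sq_eq_half_sub,
        show 2*(π*p) = 2*(π*p') + n*(2*π) by simp only [p']; ring, Real.cos_add_int_mul_two_pi]
    have g1 : η/2 ≤ p' := by simp only [p']; linarith
    have g2 : p' ≤ 1-η/2 := by simp only [p']; linarith
    have hsin : η ≤ Real.sin (π*p') := by
      rcases le_total p' (1/2) with h | h
      · have := mul_le_sin (x := π*p') (by nlinarith) (by nlinarith)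
        have e : 2/π*(π*p') = 2*p' := by field_simp
        rw [e] at this; linarith
      · have := mul_le_sin (x := π*(1-p')) (by nlinarith) (by nlinarith)
        have e : 2/π*(π*(1-p')) = 2*(1-p') := by field_simp
        rw [e, show π*(1-p') = π - π*p' by ring, Real.sin_pi_sub] at this; linarith
    have hr4 : 1/4 ≤ r := by
      have h7 : -(π*η/2) ≤ -(π*q) := by nlinarith
      have h8 := add_one_le_exp (-(π*q))
      have h10 : rexp (-(π*q)) ^ 2 = r := by
        rw [← Real.exp_nat_mul]; simp only [r]; congr 1; push_cast; ring
      have h11 : 1/2 ≤ rexp (-(π*q)) := by nlinarith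
      rw [← h10]; nlinarith
    have : η^2 ≤ Real.sin (π*p')^2 := pow_le_pow_left₀ h0.le hsin 2
    rw [hs]; nlinarith [sq_nonneg (r-1), sq_nonneg (Real.sin (π*p'))]
end P9

section P10
open Filter Topology

def inStrip (η : ℝ) (x : ℝ) : Prop := ∃ n : ℤ, n + η ≤ x ∧ x ≤ n + 1 - η

lemma Kk_ne {y : ℂ} {η : ℝ} (h0 : 0 < η) (h4 : η ≤ 1/4) (h1 : inStrip η (y.re+y.im)) :
    η ≤ ‖cexp (2*(π:ℂ)*I*y) - 1‖ := by
  have := exp_sub_lower h0 h4 h1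
  rwa [re_add_im] at this

lemma Kk_bdd {y : ℂ} {η : ℝ} (h0 : 0 < η) (h4 : η ≤ 1/4) (h1 : inStrip η (y.re+y.im)) :
    ‖Kk y‖ ≤ 1/η := by
  rw [Kk, norm_div, norm_one]
  exact one_div_le_one_div_of_le h0 (Kk_ne h0 h4 h1)

lemma Kk_ne0 {y : ℂ} {η : ℝ} (h0 : 0 < η) (h4 : η ≤ 1/4) (h1 : inStrip η (y.re+y.im)) :
    cexp (2*(π:ℂ)*I*y) - 1 ≠ 0 := by
  intro h; have := Kk_ne h0 h4 h1; rw [h, norm_zero] at this; linarith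

lemma Kk_exp {y : ℂ} {η : ℝ} (h0 : 0 < η) (h4 : η ≤ 1/4) (h1 : inStrip η (y.re+y.im)) :
    cexp (2*(π:ℂ)*I*y) * Kk y = Kk y + 1 := by
  have := Kk_ne0 h0 h4 h1
  rw [Kk]; field_simp; ring

lemma Kk_diff {y : ℂ} {η : ℝ} (h0 : 0 < η) (h4 : η ≤ 1/4) (h1 : inStrip η (y.re+y.im)) :
    DifferentiableAt ℂ Kk y := by
  unfold Kk
  exact (differentiableAt_const _).div (by fun_prop) (Kk_ne0 h0 h4 h1)

lemma ln_reim (p v : ℝ) : ((p:ℂ) + ww * v).re + ((p:ℂ) + ww * v).im = p := by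
  rw [ln_re, ln_im]; ring

lemma ln_cont {f : ℂ → ℂ} {p : ℝ} (h : ∀ v : ℝ, DifferentiableAt ℂ f (p + ww*v)) :
    Continuous (fun v : ℝ => f (p + ww*v)) := by
  refine continuous_iff_continuousAt.2 fun v => ?_
  exact ContinuousAt.comp (f := fun v : ℝ => (p:ℂ)+ww*v) (h v).continuousAt (by fun_prop)

def mX (lam : ℝ) (u ζ : ℂ) : ℂ := (√(2*π):ℝ)*lam*ζ - (√(π/2):ℝ)*u
def mF (r : ℕ) (lam : ℝ) (u ζ : ℂ) : ℂ := Er r (mX lam u ζ) *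
  cexp (-(π:ℂ)*I*u^2/2 + 2*(π:ℂ)*I*lam*u*ζ - π*I*lam^2*ζ^2) * Kk ζ

lemma mF_bound (r : ℕ) {lam R η : ℝ} (hl : 0 < lam) (hR : 0 ≤ R) (h0 : 0 < η) (h4 : η ≤ 1/4) :
    ∃ C, 0 ≤ C ∧ ∀ u : ℂ, ‖u‖ ≤ R → ∀ p : ℝ, p ∈ Set.Icc η (1-η) → ∀ v : ℝ,
      ‖mF r lam u (p + ww*v)‖ ≤ C/(1+v^2) := by
  obtain ⟨C1, hC1, H1⟩ := Er_bdd r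
  set D := √(2*π)*lam + √(π/2)*R + π*R^2 + 2*π*lam*R + 2*π*lam^2 with hD
  obtain ⟨C2, hC2, H2⟩ := gauss_dom D (show 0 < π*lam^2 by positivity)
  refine ⟨C1*C2/η, by positivity, fun u hu p hp v => ?_⟩
  have hp1 : |p| ≤ 1 := abs_le.2 ⟨by linarith [hp.1], by linarith [hp.2]⟩
  have hζ : ‖(p:ℂ) + ww*v‖ ≤ 1 + |v| := by
    refine (norm_add_le _ _).trans ?_
    rw [norm_mul, ww_norm, one_mul, norm_real, norm_real]
    exact add_le_add hp1 le_rfl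
  have hv := abs_nonneg v
  have hX : ‖mX lam u (p+ww*v)‖ ≤ √(2*π)*lam*(1+|v|) + √(π/2)*R := by
    unfold mX
    refine (norm_sub_le _ _).trans ?_
    simp only [norm_mul, norm_real, norm_eq_abs, abs_of_pos hl,
      abs_of_nonneg (sqrt_nonneg _)]
    gcongr
  have hre : (-(π:ℂ)*I*u^2/2 + 2*(π:ℂ)*I*lam*u*(p+ww*v) - π*I*lam^2*(p+ww*v)^2).re ≤
      π*R^2 + 2*π*lam*R*(1+|v|) + 2*π*lam^2*|v| - π*lam^2*v^2 := by
    rw [sub_re, add_re]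
    have a1 : (-(π:ℂ)*I*u^2/2).re ≤ π*R^2 := by
      refine (re_le_norm _).trans ?_
      simp only [norm_div, norm_mul, norm_neg, norm_pow, norm_real, norm_I,
        norm_eq_abs, abs_of_pos pi_pos, Complex.norm_ofNat]
      have : ‖u‖^2 ≤ R^2 := by gcongr
      nlinarith [pi_pos, sq_nonneg ‖u‖, mul_le_mul_of_nonneg_left this pi_pos.le, mul_nonneg pi_pos.le (sq_nonneg ‖u‖)]
    have a2 : (2*(π:ℂ)*I*lam*u*(p+ww*v)).re ≤ 2*π*lam*R*(1+|v|) := by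
      refine (re_le_norm _).trans ?_
      simp only [norm_mul, norm_real, norm_I,
        norm_eq_abs, abs_of_pos pi_pos, Complex.norm_ofNat, abs_of_pos hl, mul_one]
      gcongr
    have a3 : (π*I*lam^2*((p:ℂ)+ww*v)^2).re = π*lam^2*v^2 - π*lam^2*√2*p*v := by
      have : π*I*lam^2*((p:ℂ)+ww*v)^2 = ((π*lam^2*v^2:ℝ):ℂ) + ((π*lam^2:ℝ):ℂ)*I*((p^2:ℝ):ℂ)
          + ((2*π*lam^2*p*v:ℝ):ℂ)*(I*ww) := by
        push_cast; linear_combination π*I*lam^2*v^2*ww_sq - π*lam^2*v^2*I_sq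
      rw [this]
      simp only [add_re, re_ofReal_mul, ofReal_re, mul_re,
        I_re, I_im, ww_im, ofReal_im, mul_im]
      ring
    rw [a3]
    have h2 : √2 ≤ 2 := by rw [sqrt_le_left] <;> norm_num
    have : √2*p*v ≤ 2*|v| := by
      calc √2*p*v ≤ |√2*p*v| := le_abs_self _
        _ = √2 * |p| * |v| := by rw [abs_mul, abs_mul, abs_of_nonneg (sqrt_nonneg _)]
        _ ≤ 2*1*|v| := by gcongr
        _ = _ := by ring
    have := mul_le_mul_of_nonneg_left this (show 0 ≤ π*lam^2 by positivity)
    nlinarith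
  have hK := Kk_bdd (y := p+ww*v) h0 h4 ⟨0, by rw [ln_reim]; simpa using hp⟩
  unfold mF
  rw [norm_mul, norm_mul, norm_exp]
  calc _ ≤ C1*rexp (√(2*π)*lam*(1+|v|) + √(π/2)*R) *
        rexp (π*R^2 + 2*π*lam*R*(1+|v|) + 2*π*lam^2*|v| - π*lam^2*v^2) * (1/η) := by
        have := (H1 (mX lam u (p+ww*v))).trans
          (mul_le_mul_of_nonneg_left (exp_le_exp.2 hX) hC1)
        have := exp_le_exp.2 hre
        gcongr
    _ ≤ C1*rexp (D*(1+|v|) - π*lam^2*v^2) * (1/η) := by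
        rw [mul_assoc C1, ← Real.exp_add]
        refine mul_le_mul_of_nonneg_right (mul_le_mul_of_nonneg_left (exp_le_exp.2 ?_) hC1)
          (by positivity)
        have : 0 ≤ √(π/2)*R*|v| := by positivity
        have : 0 ≤ π*R^2*|v| := by positivity
        have : 0 ≤ 2*π*lam^2 := by positivity
        rw [hD]; nlinarith
    _ ≤ C1*(C2/(1+v^2))*(1/η) := by gcongr; exact H2 v
    _ = _ := by field_simp

lemma mF_diff (r : ℕ) (lam : ℝ) (u : ℂ) {ζ : ℂ} {η : ℝ} (h0 : 0 < η) (h4 : η ≤ 1/4)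
    (h1 : inStrip η (ζ.re+ζ.im)) : DifferentiableAt ℂ (mF r lam u) ζ := by
  unfold mF mX
  refine (DifferentiableAt.mul ?_ (by fun_prop)).mul (Kk_diff h0 h4 h1)
  exact (Er_deriv r _).differentiableAt.comp ζ (by fun_prop)

lemma mF_deriv (r : ℕ) (lam : ℝ) (u ζ : ℂ) :
    HasDerivAt (fun u => mF r lam u ζ) ((√(2*π):ℝ) * mF (r+1) lam u ζ) u := by
  have hX : HasDerivAt (fun u => mX lam u ζ) (-(√(π/2):ℝ)) u := by
    unfold mX
    simpa using ((hasDerivAt_id u).const_mul ((√(π/2):ℝ):ℂ)).const_sub ((√(2*π):ℝ)*lam*ζ)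
  have hE : HasDerivAt (fun u => Er r (mX lam u ζ)) _ u := (Er_deriv r _).comp u hX
  have hq : HasDerivAt (fun u : ℂ => -(π:ℂ)*I*u^2/2 + 2*(π:ℂ)*I*lam*u*ζ - π*I*lam^2*ζ^2)
      (-(π:ℂ)*I*u + 2*π*I*lam*ζ) u := by
    have h1 := (((hasDerivAt_id u).pow 2).const_mul (-(π:ℂ)*I)).div_const 2
    have h2 := ((hasDerivAt_id u).const_mul (2*(π:ℂ)*I*lam)).mul_const ζ
    refine ((h1.add h2).sub_const (π*I*lam^2*ζ^2)).congr_deriv ?_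
    simp; ring
  refine ((hE.mul hq.cexp).mul_const (Kk ζ)).congr_deriv ?_
  have e1 : ((√(2*π):ℝ):ℂ) = 2*((√(π/2):ℝ):ℂ) := by
    rw [show 2*π = 2^2*(π/2) by ring, sqrt_mul (by norm_num), sqrt_sq (by norm_num)]
    push_cast; ring
  have e2 : ((√(π/2):ℝ):ℂ)*((√(π/2):ℝ):ℂ) = π/2 := by
    rw [← ofReal_mul, mul_self_sqrt (by positivity)]; push_cast; ring
  simp only [mF]
  rw [Er_rec, e1]
  have e3 : mX lam u ζ = (2*((√(π/2):ℝ):ℂ))*lam*ζ - (√(π/2):ℝ)*u := by rw [← e1]; rfl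
  generalize hX' : mX lam u ζ = X at *
  generalize Er r X = E0
  generalize Er (r-1) X = E1
  rw [show -(π:ℂ)*I*u + 2*π*I*lam*ζ = 2*((√(π/2):ℝ):ℂ)*I*X by
    rw [e3]; linear_combination (-2*I*(2*lam*ζ-u))*e2]
  ring

def Gm (r : ℕ) (lam p : ℝ) (u : ℂ) : ℂ := ∫ v : ℝ, ww * mF r lam u (p + ww*v)

lemma mF_cont (r : ℕ) (lam : ℝ) (u : ℂ) {p : ℝ} {η : ℝ} (h0 : 0 < η) (h4 : η ≤ 1/4)
    (hp : p ∈ Set.Icc η (1-η)) : Continuous (fun v : ℝ => mF r lam u (p + ww*v)) :=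
  ln_cont fun v => mF_diff r lam u h0 h4 ⟨0, by rw [ln_reim]; simpa using hp⟩

lemma mF_int (r : ℕ) {lam : ℝ} (hl : 0 < lam) (u : ℂ) {p : ℝ} {η : ℝ} (h0 : 0 < η) (h4 : η ≤ 1/4)
    (hp : p ∈ Set.Icc η (1-η)) : Integrable (fun v : ℝ => ww * mF r lam u (p + ww*v)) := by
  obtain ⟨C, hC, H⟩ := mF_bound r hl (norm_nonneg u) h0 h4
  exact ((sq_dom_int C).mono' (mF_cont r lam u h0 h4 hp).aestronglyMeasurable
    (ae_of_all _ (H u le_rfl p hp))).const_mul _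

lemma Gm_deriv (r : ℕ) {lam : ℝ} (hl : 0 < lam) (u : ℂ) {p : ℝ} {η : ℝ} (h0 : 0 < η)
    (h4 : η ≤ 1/4) (hp : p ∈ Set.Icc η (1-η)) :
    HasDerivAt (Gm r lam p) ((√(2*π):ℝ) * Gm (r+1) lam p u) u := by
  obtain ⟨C, hC, H⟩ := mF_bound (r+1) hl (show 0 ≤ ‖u‖+1 by positivity) h0 h4
  have := (hasDerivAt_integral_of_dominated_loc_of_deriv_le
    (F := fun u (v:ℝ) => ww * mF r lam u (p + ww*v))
    (F' := fun u (v:ℝ) => ww * ((√(2*π):ℝ) * mF (r+1) lam u (p + ww*v))) (μ := volume)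
    (x₀ := u) (s := Metric.ball u 1) (bound := fun v => √(2*π)*(C/(1+v^2)))
    (Metric.ball_mem_nhds u one_pos) ?_ (mF_int r hl u h0 h4 hp) ?_ ?_ ?_ ?_).2
  · refine this.congr_deriv ?_
    unfold Gm; rw [← integral_const_mul]; congr 1; ext v; ring
  · exact Eventually.of_forall fun u' =>
      (continuous_const.mul (mF_cont r lam u' h0 h4 hp)).aestronglyMeasurable
  · exact (continuous_const.mul (continuous_const.mul
      (mF_cont (r+1) lam u h0 h4 hp))).aestronglyMeasurable
  · refine ae_of_all _ fun v u' hu' => ?_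
    rw [norm_mul, norm_mul, ww_norm, one_mul, norm_real, norm_eq_abs,
      abs_of_nonneg (sqrt_nonneg _)]
    refine mul_le_mul_of_nonneg_left (H u' ?_ p hp v) (sqrt_nonneg _)
    have : ‖u'‖ ≤ ‖u‖ + ‖u'-u‖ := by simpa using norm_add_le u (u'-u)
    rw [mem_ball_iff_norm] at hu'; linarith
  · exact (sq_dom_int C).const_mul _
  · exact ae_of_all _ fun v u' _ => (mF_deriv r lam u' _).const_mul ww

lemma Gderiv_eq (r : ℕ) {lam : ℝ} (hl : 0 < lam) (u : ℂ) {p : ℝ} {η : ℝ} (h0 : 0 < η)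
    (h4 : η ≤ 1/4) (hp : p ∈ Set.Icc η (1-η)) :
    Gderiv r u ((lam^2:ℝ):ℂ) = ((lam^((1:ℝ)/2):ℝ):ℂ) * cexp (π*I/8) *
      ((√(2*π):ℝ):ℂ)^r * Gm r lam p u := by
  have hG : ∀ u, G u ((lam^2:ℝ):ℂ) =
      ((lam^((1:ℝ)/2):ℝ):ℂ) * cexp (π*I/8) * Gm 0 lam p u := by
    intro u
    have e1 : ((lam^2:ℝ):ℂ)^((1:ℂ)/4) = ((lam^((1:ℝ)/2):ℝ):ℂ) := by
      rw [show ((1:ℂ)/4) = ((1/4:ℝ):ℂ) by push_cast; rfl, ← ofReal_cpow (by positivity),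
        ← rpow_natCast lam 2, ← rpow_mul hl.le]; norm_num
    have e2 : ((lam^2:ℝ):ℂ)^((1:ℂ)/2) = lam := by
      rw [show ((1:ℂ)/2) = ((1/2:ℝ):ℂ) by push_cast; rfl, ← ofReal_cpow (by positivity),
        ← rpow_natCast lam 2, ← rpow_mul hl.le]; norm_num
    have e3 : cexp (-(π:ℂ)*I*u^2/2) * Upsilon (lam*u) ((lam^2:ℝ):ℂ) = Gm 0 lam (1/2:ℝ) u := by
      unfold Upsilon Gm
      rw [← integral_const_mul]
      congr 1; ext v
      simp only [mF, Er_zero, one_mul, Kk]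
      rw [← ww, show -(π:ℂ)*I*u^2/2 + 2*(π:ℂ)*I*lam*u*(((1/2:ℝ):ℂ)+ww*v)
        - π*I*lam^2*(((1/2:ℝ):ℂ)+ww*v)^2 = -(π:ℂ)*I*u^2/2 + (-(π:ℂ)*I*((lam^2:ℝ):ℂ)*(1/2+ww*v)^2 +
        2*π*I*(lam*u)*(1/2+ww*v)) by push_cast; ring, Complex.exp_add (-(π:ℂ)*I*u^2/2)]
      push_cast
      ring
    have hsh : Gm 0 lam (1/2:ℝ) u = Gm 0 lam p u := by
      obtain ⟨C, hC, H⟩ := mF_bound 0 hl (norm_nonneg u) h0 h4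
      have hh : (1/2:ℝ) ∈ Set.Icc η (1-η) := ⟨by linarith, by linarith⟩
      unfold Gm
      rw [integral_const_mul, integral_const_mul]; congr 1
      have gen : ∀ p0 ∈ Set.Icc η (1-η), ∀ p1 ∈ Set.Icc η (1-η), p0 ≤ p1 →
          ∫ v : ℝ, mF 0 lam u (p0 + ww*v) = ∫ v : ℝ, mF 0 lam u (p1 + ww*v) := by
        intro p0 h5 p1 h6 h7
        refine line_shift (C := C) h7 (fun y hy1 hy2 => mF_diff 0 lam u h0 h4 ⟨0, ?_, ?_⟩)
          (fun p hp v => H u le_rfl p ⟨h5.1.trans hp.1, hp.2.trans h6.2⟩ v)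
        · push_cast; linarith [h5.1]
        · push_cast; linarith [h6.2]
      rcases le_total (1/2) p with h | h
      · exact gen _ hh _ hp h
      · exact (gen _ hp _ hh h).symm
    rw [G, e1, e2, Complex.exp_add, ← hsh, ← e3]; ring
  have hd : ∀ r, iteratedDeriv r (fun u => G u ((lam^2:ℝ):ℂ)) = fun u =>
      ((lam^((1:ℝ)/2):ℝ):ℂ) * cexp (π*I/8) * ((√(2*π):ℝ):ℂ)^r * Gm r lam p u := by
    intro r
    induction r with
    | zero => rw [iteratedDeriv_zero]; ext u; rw [hG u]; ring
    | succ r ih =>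
      rw [iteratedDeriv_succ, ih]; ext u
      rw [((Gm_deriv r hl u h0 h4 hp).const_mul _).deriv]; ring
  unfold Gderiv
  rw [hd]
end P10

section P11
open Filter Topology

def yl (c v : ℝ) : ℂ := (c:ℂ) + ww * v

lemma yl_lb (c v : ℝ) : (c^2+v^2)/4 ≤ ‖yl c v‖^2 := by
  rw [Complex.sq_norm, normSq_apply, yl, ln_re, ln_im]
  have h := r2
  have e : (c - √2/2*v)*(c-√2/2*v) + √2/2*v*(√2/2*v) = (c - √2/2*v)^2 + v^2/2 := by
    linear_combination v^2/4*h
  have e2 : (c - √2/2*v)*(c-√2/2*v) + √2/2*v*(√2/2*v) = (v - √2/2*c)^2 + c^2/2 := by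
    linear_combination v^2/2*h - c^2/4*h
  nlinarith [sq_nonneg (c - √2/2*v), sq_nonneg (v - √2/2*c)]

lemma yl_half {c : ℝ} (hc : 1 ≤ c) (v : ℝ) : 1/2 ≤ ‖yl c v‖ := by
  have := yl_lb c v
  nlinarith [norm_nonneg (yl c v), sq_nonneg v]

lemma yl_ub {c : ℝ} (hc : 1 ≤ c) (v : ℝ) : ‖yl c v‖ ≤ c*(1+|v|) := by
  refine (norm_add_le _ _).trans ?_
  rw [norm_mul, ww_norm, one_mul, norm_real, norm_real, norm_eq_abs,
    norm_eq_abs, abs_of_nonneg (by linarith)]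
  nlinarith [abs_nonneg v]

lemma slit_ri {y : ℂ} (h : 0 < y.re + y.im) : y ∈ slitPlane := by
  rw [mem_slitPlane_iff]
  by_cases h1 : y.im = 0
  · left; rw [h1] at h; linarith
  · exact Or.inr h1

lemma yl_slit {c : ℝ} (hc : 0 < c) (v : ℝ) : yl c v ∈ slitPlane :=
  slit_ri (by rw [yl, ln_reim]; exact hc)

lemma rpow_bd {x τ Q : ℝ} {M : ℕ} (hx : 1/2 ≤ x) (hQ : 1 ≤ Q) (hxQ : x ≤ Q) (hτ : |τ| ≤ M) :
    x^τ ≤ (2*Q)^M := by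
  have h := abs_le.1 hτ
  rw [← rpow_natCast]
  rcases le_total 1 x with h1 | h1
  · exact (rpow_le_rpow_of_exponent_le h1 h.2).trans
      (rpow_le_rpow (by linarith) (by linarith) (by positivity))
  · calc x^τ ≤ x^(-(M:ℝ)) := rpow_le_rpow_of_exponent_ge (by linarith) h1 h.1
      _ = (x⁻¹)^(M:ℝ) := by rw [rpow_neg (by linarith), inv_rpow (by linarith)]
      _ ≤ _ := rpow_le_rpow (by positivity) (by
        rw [inv_le_comm₀ (by linarith) (by linarith)]
        exact (inv_anti₀ (by norm_num) (by linarith : (2:ℝ) ≤ 2*Q)).trans (by linarith)) (by positivity)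

lemma cpow_bd (y s : ℂ) : ‖y^s‖ ≤ ‖y‖^s.re * rexp (π*|s.im|) := by
  refine (norm_cpow_le y s).trans ?_
  rw [div_eq_mul_inv, ← Real.exp_neg]
  have h1 : -(arg y * s.im) ≤ π*|s.im| := by
    calc _ ≤ |arg y * s.im| := neg_le_abs _
      _ ≤ _ := by rw [abs_mul]; gcongr; exact abs_arg_le_pi y
  exact mul_le_mul_of_nonneg_left (exp_le_exp.2 h1) (by positivity)

lemma ycpow_bd {c : ℝ} (hc : 1 ≤ c) (v : ℝ) {s : ℂ} {M : ℕ} (hM : |s.re| ≤ M) :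
    ‖(yl c v)^s‖ ≤ (2*(c*(1+|v|)))^M * rexp (π*|s.im|) := by
  refine (cpow_bd _ _).trans ?_
  refine mul_le_mul_of_nonneg_right (rpow_bd (yl_half hc v) ?_ (yl_ub hc v) hM) (by positivity)
  nlinarith [abs_nonneg v]

lemma ycpow_dec {c : ℝ} (hc : 1 ≤ c) (v : ℝ) {s : ℂ} (hs : s.re ≤ -4) :
    ‖(yl c v)^s‖ ≤ 2^(-s.re) * rexp (π*|s.im|) / (c^2 * (1+v^2)) := by
  refine (cpow_bd _ _).trans ?_
  have h1 := yl_lb c v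
  have h2 := yl_half hc v
  set x := ‖yl c v‖
  have h3 : x^s.re = 2^(-s.re) * (2*x)^s.re := by
    rw [mul_rpow (by norm_num) (by linarith), ← mul_assoc, ← rpow_add (by norm_num)]
    simp
  have h4 : (2*x)^s.re ≤ 1/(c^2*(1+v^2)) := by
    calc (2*x)^s.re ≤ (2*x)^(-((4:ℕ):ℝ)) :=
          rpow_le_rpow_of_exponent_le (by linarith) (by push_cast; linarith)
      _ = 1/(2*x)^4 := by
          rw [rpow_neg (by linarith), rpow_natCast, one_div]
      _ ≤ _ := by
          refine one_div_le_one_div_of_le (by positivity) ?_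
          have h5 : c^2+v^2 ≤ (2*x)^2 := by nlinarith
          calc c^2*(1+v^2) ≤ (c^2+v^2)^2 := by nlinarith [sq_nonneg v, mul_nonneg (sq_nonneg c) (sq_nonneg v), mul_nonneg (sq_nonneg c) (show 0 ≤ c^2-1 by nlinarith)]
            _ ≤ ((2*x)^2)^2 := pow_le_pow_left₀ (by positivity) h5 2
            _ = _ := by ring
  rw [h3]
  calc _ ≤ 2^(-s.re)*(1/(c^2*(1+v^2))) * rexp (π*|s.im|) := by gcongr
    _ = _ := by ring

def gg (y : ℂ) : ℂ := cexp (-(π:ℂ)*I*(y*(y-1)))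

lemma gg_nat (n : ℕ) : gg n = 1 := by
  unfold gg
  rw [Complex.exp_eq_one_iff]
  have h2 : Even ((n:ℤ)*(n-1)) := by
    rw [mul_comm]; exact Int.even_mul_pred_self n |> fun h => by rwa [mul_comm]
  obtain ⟨k, hk⟩ := h2
  refine ⟨-k, ?_⟩
  have : ((n:ℂ)*(n-1)) = k + k := by exact_mod_cast hk
  rw [this]; push_cast; ring

lemma gg_bd {c : ℝ} (hc : 1 ≤ c) : ∃ C, 0 ≤ C ∧ ∀ p ∈ Set.Icc c (c+1), ∀ v : ℝ,
    ‖gg (p + ww*v)‖ ≤ C/(1+v^2) := by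
  obtain ⟨C, hC, H⟩ := gauss_dom (π*(2*(2*(c+1)+1))) pi_pos
  refine ⟨C, hC, fun p hp v => le_trans ?_ (H v)⟩
  unfold gg
  rw [norm_exp]
  refine exp_le_exp.2 ?_
  have e : -(π:ℂ)*I*((p+ww*v)*(p+ww*v-1)) = ((-(π*v^2):ℝ):ℂ) + ((-(π*(p*(p-1))):ℝ):ℂ)*I +
      ((-(π*(2*p-1)*v):ℝ):ℂ)*(I*ww) := by
    push_cast; linear_combination -(π:ℂ)*I*v^2*ww_sq + π*v^2*I_sq
  rw [e]
  simp only [add_re, ofReal_re, mul_re,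
        I_re, I_im, ww_im, ofReal_im, mul_im]
  have h2 : √2/2 ≤ 1 := by
    have : √2 ≤ 2 := by rw [sqrt_le_left] <;> norm_num
    linarith
  have h3 : |(2*p-1)*v*(√2/2)| ≤ (2*(c+1)+1) * |v| * 1 := by
    rw [abs_mul, abs_mul, abs_of_nonneg (show 0 ≤ √2/2 by positivity)]
    have : |2*p-1| ≤ 2*(c+1)+1 := abs_le.2 ⟨by linarith [hp.1], by linarith [hp.2]⟩
    gcongr
  have h4 := (abs_le.1 h3).2
  have := mul_le_mul_of_nonneg_left h4 pi_pos.le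
  have h5 : 0 ≤ π*((2*(c+1)+1)*|v|) := by
    have : 0 ≤ 2*(c+1)+1 := by linarith
    positivity
  have h6 : 0 ≤ π*(2*(c+1)+1) := by
    have : 0 ≤ 2*(c+1)+1 := by linarith
    positivity
  nlinarith

lemma gg_int {c : ℝ} : ∫ v : ℝ, ww * gg (c + ww*v + 1) = -1 := by
  rw [integral_const_mul]
  have h := integral_cexp_quadratic (b := -(π:ℂ)) (by simp [pi_pos])
    (-(π:ℂ)*I*ww*(2*c+1)) (-(π:ℂ)*I*(c*(c+1)))
  have e : ∀ v : ℝ, gg (c+ww*v+1) =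
      cexp (-(π:ℂ)*v^2 + -(π:ℂ)*I*ww*(2*c+1)*v + -(π:ℂ)*I*(c*(c+1))) := by
    intro v; unfold gg; congr 1
    linear_combination -(π:ℂ)*I*v^2*ww_sq + π*v^2*I_sq
  simp_rw [e]
  rw [h, neg_neg, div_self (by exact_mod_cast pi_ne_zero), one_cpow, one_mul]
  have hpi : (π:ℂ) ≠ 0 := by exact_mod_cast pi_ne_zero
  rw [show -(π:ℂ)*I*(c*(c+1)) - (-(π:ℂ)*I*ww*(2*c+1))^2/(4*-(π:ℂ)) = π/4*I by
    field_simp; linear_combination I*(2*c+1)^2*ww_sq - (2*c+1)^2*I_sq, ww, ← Complex.exp_add]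
  rw [show 3*(π:ℂ)*I/4 + π/4*I = π*I by ring, exp_pi_mul_I]

end P11

section P12
open Filter Topology

lemma Kk_far (p v : ℝ) (hv : 1 ≤ |v|) : ‖Kk (p+ww*v)‖ ≤ 2 := by
  have hn : ‖cexp (2*(π:ℂ)*I*(p+ww*v))‖ = rexp (-(π*√2*v)) := by
    rw [norm_exp]; congr 1
    have : (2*(π:ℂ)*I*(p+ww*v)) = ((2*π:ℝ):ℂ)*(I*(p+ww*v)) := by push_cast; ring
    rw [this, re_ofReal_mul, I_mul_re, ln_im]; ring
  have h2 : 1 ≤ √2 := by rw [one_le_sqrt]; norm_num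
  have hpi := pi_gt_three
  have hps : 3 ≤ π*√2 := by nlinarith
  have h : 1/2 ≤ ‖cexp (2*(π:ℂ)*I*(p+ww*v)) - 1‖ := by
    rcases le_abs.1 hv with h | h
    · have h3 : rexp (-(π*√2*v)) ≤ 1/2 := by
        rw [Real.exp_neg, ← one_div]
        refine one_div_le_one_div_of_le (by norm_num) ?_
        have := add_one_le_exp (π*√2*v); nlinarith
      have := norm_sub_norm_le (1:ℂ) (cexp (2*(π:ℂ)*I*(p+ww*v)))
      rw [norm_one, hn, norm_sub_rev] at this; linarith
    · have h3 := add_one_le_exp (-(π*√2*v))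
      have := norm_sub_norm_le (cexp (2*(π:ℂ)*I*(p+ww*v))) (1:ℂ)
      rw [norm_one, hn] at this; nlinarith
  rw [Kk, norm_div, norm_one, div_le_iff₀ (by linarith)]; linarith

lemma yl_strip {c η : ℝ} (h : inStrip η c) (v : ℝ) : inStrip η ((yl c v).re + (yl c v).im) := by
  rw [yl, ln_reim]; exact h

lemma yK_cont {c η : ℝ} (h0 : 0 < η) (h4 : η ≤ 1/4) (hc : 0 < c) (h : inStrip η c) {f : ℂ → ℂ}
    (hf : ∀ v, DifferentiableAt ℂ f (yl c v)) :
    Continuous (fun v : ℝ => f (yl c v) * Kk (yl c v)) :=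
  ln_cont (f := fun y => f y * Kk y) fun v => (hf v).mul (Kk_diff h0 h4 (yl_strip h v))

lemma ycpow_diff {c : ℝ} (hc : 0 < c) (s : ℂ) (v : ℝ) :
    DifferentiableAt ℂ (fun y : ℂ => y^s) (yl c v) :=
  differentiableAt_id.cpow_const (yl_slit hc v)

lemma yK_bd {c η : ℝ} (h0 : 0 < η) (h4 : η ≤ 1/4) (hc : 1 ≤ c) (h : inStrip η c) {s : ℂ}
    (hs : s.re ≤ -4) (v : ℝ) : ‖(yl c v)^s * Kk (yl c v)‖ ≤
      (2^(-s.re) * rexp (π*|s.im|)/η/c^2) / (1+v^2) := by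
  rw [norm_mul]
  calc _ ≤ 2^(-s.re) * rexp (π*|s.im|) / (c^2 * (1+v^2)) * (1/η) := by
        have := ycpow_dec hc v hs
        have := Kk_bdd h0 h4 (yl_strip h v)
        gcongr
    _ = _ := by field_simp

lemma yK_int {c η : ℝ} (h0 : 0 < η) (h4 : η ≤ 1/4) (hc : 1 ≤ c) (h : inStrip η c) {s : ℂ}
    (hs : s.re ≤ -4) : Integrable (fun v => (yl c v)^s * Kk (yl c v)) :=
  (sq_dom_int _).mono' (yK_cont h0 h4 (by linarith) h (ycpow_diff (by linarith) s)).aestronglyMeasurable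
    (ae_of_all _ (yK_bd h0 h4 hc h hs))

lemma gK_int {c η : ℝ} (h0 : 0 < η) (h4 : η ≤ 1/4) (hc : 1 ≤ c) (h : inStrip η c) :
    Integrable (fun v => gg (yl c v) * Kk (yl c v)) := by
  obtain ⟨C, hC, H⟩ := gg_bd hc
  refine (sq_dom_int (C*(1/η))).mono' (yK_cont h0 h4 (by linarith) h
    (fun v => by unfold gg; fun_prop)).aestronglyMeasurable (ae_of_all _ fun v => ?_)
  rw [norm_mul]
  calc _ ≤ C/(1+v^2)*(1/η) := by
        have := H c ⟨le_rfl, by linarith⟩ v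
        have := Kk_bdd h0 h4 (yl_strip h v)
        unfold yl at *
        gcongr
    _ = _ := by ring

lemma inStrip_add {η c : ℝ} (h : inStrip η c) : inStrip η (c+1) := by
  obtain ⟨n, h1, h2⟩ := h
  exact ⟨n+1, by push_cast; linarith, by push_cast; linarith⟩

lemma J_step {c η : ℝ} {q : ℕ} (h0 : 0 < η) (h4 : η ≤ 1/4) (hq : 1 ≤ q) (h1 : q + η ≤ c)
    (h2 : c ≤ q+1-η) {s : ℂ} (hs : s.re ≤ -4) :
    ∫ v, ww * ((yl (c+1) v)^s * Kk (yl (c+1) v)) =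
      (∫ v, ww * ((yl c v)^s * Kk (yl c v))) + ((q+1:ℕ):ℂ)^s := by
  have hq' : (1:ℝ) ≤ q := by exact_mod_cast hq
  have hc : 1 ≤ c := by linarith
  have hst : inStrip η c := ⟨q, by push_cast; linarith, by push_cast; linarith⟩
  have hst1 := inStrip_add hst
  set n : ℂ := ((q+1:ℕ):ℂ) with hn
  have hnre : n.re = q+1 := by simp [hn]
  have hnim : n.im = 0 := by simp [hn]
  set φ : ℂ → ℂ := fun y => y^s - n^s*gg y with hφ
  set ψ : ℂ → ℂ := fun y => cexp (2*(π:ℂ)*I*y) - 1 with hψ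
  have φn : φ n = 0 := by simp only [hφ, hn]; rw [gg_nat]; ring
  have ψn : ψ n = 0 := by
    simp only [hψ, hn]
    rw [show 2*(π:ℂ)*I*((q+1:ℕ):ℂ) = ((q+1:ℕ):ℂ)*(2*π*I) by ring, exp_nat_mul_two_pi_mul_I,
      sub_self]
  have hnS : slitPlane ∈ 𝓝 n := isOpen_slitPlane.mem_nhds (slit_ri (by rw [hnre, hnim]; positivity))
  have dφ : DifferentiableOn ℂ (dslope φ n) slitPlane := by
    rw [differentiableOn_dslope hnS]
    intro y hy
    refine DifferentiableAt.differentiableWithinAt ?_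
    refine (differentiableAt_id.cpow_const hy).sub ?_
    unfold gg; fun_prop
  have dψ : DifferentiableOn ℂ (dslope ψ n) Set.univ := by
    rw [differentiableOn_dslope univ_mem]
    simp only [hψ]; fun_prop
  have hne : ∀ y : ℂ, c ≤ y.re+y.im → y.re+y.im ≤ c+1 → dslope ψ n y ≠ 0 := by
    intro y hy1 hy2
    by_cases hy : y = n
    · rw [hy, dslope_same]
      have : HasDerivAt ψ (cexp (2*(π:ℂ)*I*n) * (2*π*I*1)) n :=
        (((hasDerivAt_id n).const_mul (2*(π:ℂ)*I)).cexp).sub_const 1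
      rw [this.deriv]
      simp [pi_ne_zero]
    · rw [dslope_of_ne _ hy, slope_def_field, ψn, sub_zero]
      refine div_ne_zero ?_ (sub_ne_zero.2 hy)
      intro h
      simp only [hψ, sub_eq_zero] at h
      obtain ⟨k, hk⟩ := exp_eq_one_iff.1 h
      have hyk : y = k := by
        have h5 : (2*(π:ℂ)*I) ≠ 0 := by simp [pi_ne_zero]
        have : 2*(π:ℂ)*I*y = 2*(π:ℂ)*I*k := by rw [hk]; ring
        exact mul_left_cancel₀ h5 this
      apply hy
      rw [hyk] at hy1 hy2 ⊢
      simp only [intCast_re, intCast_im, add_zero] at hy1 hy2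
      have a1 : (q:ℝ) < k := by linarith
      have a2 : (k:ℝ) < q+2 := by linarith
      have a3 : (q:ℤ) < k := by exact_mod_cast a1
      have a4 : k < (q:ℤ)+2 := by exact_mod_cast a2
      have : k = (q:ℤ)+1 := by omega
      rw [this, hn]; push_cast; rfl
  set f : ℂ → ℂ := fun y => dslope φ n y / dslope ψ n y with hf
  have fd : ∀ y : ℂ, c ≤ y.re+y.im → y.re+y.im ≤ c+1 → DifferentiableAt ℂ f y := by
    intro y hy1 hy2
    have hy : y ∈ slitPlane := slit_ri (by linarith)
    exact (dφ.differentiableAt (isOpen_slitPlane.mem_nhds hy)).div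
      (dψ.differentiableAt univ_mem) (hne y hy1 hy2)
  have feq : ∀ y : ℂ, y ≠ n → f y = φ y * Kk y := by
    intro y hy
    simp only [hf]
    rw [dslope_of_ne _ hy, dslope_of_ne _ hy, slope_def_field, slope_def_field, φn, ψn, sub_zero,
      sub_zero, div_div_div_cancel_right₀ (sub_ne_zero.2 hy), Kk]
    simp only [hψ]; ring
  obtain ⟨Cg, hCg, Hg⟩ := gg_bd hc
  set C1 := 2^(-s.re) * rexp (π*|s.im|) with hC1
  have hC1p : 0 ≤ C1 := by positivity
  obtain ⟨M, hM⟩ : ∃ M, ∀ p ∈ Set.Icc c (c+1), ∀ v ∈ Set.Icc (-1:ℝ) 1, ‖f (p+ww*v)‖ ≤ M := by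
    have hK : IsCompact (Set.Icc c (c+1) ×ˢ Set.Icc (-1:ℝ) 1) := isCompact_Icc.prod isCompact_Icc
    have hco : ContinuousOn (fun z : ℝ × ℝ => f (z.1+ww*z.2)) (Set.Icc c (c+1) ×ˢ Set.Icc (-1:ℝ) 1) := by
      rintro ⟨p, v⟩ ⟨hp, hv⟩
      refine ContinuousAt.continuousWithinAt ?_
      refine ContinuousAt.comp (f := fun z : ℝ × ℝ => (z.1:ℂ)+ww*z.2) (g := f) (fd _ ?_ ?_).continuousAt (by fun_prop)
      · rw [ln_reim]; exact hp.1
      · rw [ln_reim]; exact hp.2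
    obtain ⟨M, hM⟩ := hK.exists_bound_of_continuousOn hco
    exact ⟨M, fun p hp v hv => hM (p,v) ⟨hp, hv⟩⟩
  have hM0 : 0 ≤ M := (norm_nonneg _).trans (hM c ⟨le_rfl, by linarith⟩ 0 (by simp))
  have hsh := line_shift (f := f) (p0 := c) (p1 := c+1) (C := (C1 + ‖n^s‖*Cg)*2 + M*2)
    (by linarith) fd (by
      intro p hp v
      by_cases hv : |v| ≤ 1
      · refine (hM p hp v (abs_le.1 hv)).trans ?_
        rw [le_div_iff₀ (by positivity)]
        have : v^2 ≤ 1 := by rw [← sq_abs]; nlinarith [abs_nonneg v]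
        have : 0 ≤ (C1 + ‖n^s‖*Cg)*2 := by positivity
        nlinarith
      · push Not at hv
        rw [feq _ (by
          intro h
          have := congrArg im h
          rw [ln_im, hnim] at this
          have h3 : v = 0 := by
            have : √2/2 ≠ 0 := by positivity
            simp_all
          rw [h3] at hv; norm_num at hv), norm_mul]
        have b1 := Kk_far p v hv.le
        have b2 : ‖φ (p+ww*v)‖ ≤ (C1 + ‖n^s‖*Cg)/(1+v^2) := by
          refine (norm_sub_le _ _).trans ?_
          rw [add_div, norm_mul, mul_div_assoc ‖n^s‖]
          refine add_le_add ?_ (mul_le_mul_of_nonneg_left (Hg p hp v) (norm_nonneg _))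
          have hp1 : 1 ≤ p := hc.trans hp.1
          refine (ycpow_dec hp1 v hs).trans ?_
          rw [← hC1]
          refine div_le_div_of_nonneg_left hC1p (by positivity) ?_
          nlinarith [sq_nonneg v, mul_nonneg (show 0 ≤ p^2-1 by nlinarith) (show 0 ≤ 1+v^2 by positivity)]
        calc _ ≤ (C1 + ‖n^s‖*Cg)/(1+v^2)*2 := by gcongr
          _ = (C1 + ‖n^s‖*Cg)*2/(1+v^2) := by ring
          _ ≤ _ := by gcongr; linarith)
  have split : ∀ p, inStrip η p → 1 ≤ p → ∫ v : ℝ, f (p+ww*v) =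
      (∫ v, (yl p v)^s * Kk (yl p v)) - n^s * ∫ v, gg (yl p v) * Kk (yl p v) := by
    intro p hp hp1
    rw [← integral_const_mul, ← integral_sub (yK_int h0 h4 hp1 hp hs)
      ((gK_int h0 h4 hp1 hp).const_mul _)]
    congr 1; ext v
    rw [feq, yl]
    · simp only [hφ]; ring
    · intro h
      have e1 := ln_reim p v
      rw [h, hnre, hnim] at e1
      obtain ⟨k, k1, k2⟩ := hp
      rw [← e1] at k1 k2
      have a1 : (k:ℝ) < q+1 := by linarith
      have a2 : (q:ℝ)+1 < k+1 := by linarith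
      have a3 : k < (q:ℤ)+1 := by exact_mod_cast a1
      have a4 : (q:ℤ)+1 < k+1 := by exact_mod_cast a2
      omega
  rw [split c hst hc, show ((c+1:ℝ):ℂ) = ((c+1:ℝ):ℂ) from rfl, split (c+1) hst1 (by linarith)] at hsh
  have hg : (∫ v, gg (yl (c+1) v) * Kk (yl (c+1) v)) - ∫ v, gg (yl c v) * Kk (yl c v)
      = -∫ v : ℝ, gg (c+ww*v+1) := by
    rw [← integral_sub (gK_int h0 h4 (by linarith) hst1) (gK_int h0 h4 hc hst), ← integral_neg]
    congr 1; ext v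
    have hK : Kk (yl (c+1) v) = Kk (yl c v) := by
      unfold Kk yl
      rw [show 2*(π:ℂ)*I*(((c+1:ℝ):ℂ)+ww*v) = 2*(π:ℂ)*I*(c+ww*v) + 2*π*I by push_cast; ring,
        exp_periodic]
    have hy : yl (c+1) v = yl c v + 1 := by unfold yl; push_cast; ring
    have hgy : gg (yl c v) = gg (yl c v + 1) * cexp (2*(π:ℂ)*I*yl c v) := by
      unfold gg; rw [← Complex.exp_add]; congr 1; ring
    have h7 := Kk_exp h0 h4 (yl_strip hst v)
    rw [hK, hy, hgy]
    show _ = -gg (yl c v + 1)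
    linear_combination (-gg (yl c v + 1)) * h7
  have hgi := gg_int (c := c)
  rw [integral_const_mul] at hgi
  rw [integral_const_mul, integral_const_mul]
  linear_combination (-ww)*hsh + ww*n^s*hg - n^s*hgi

lemma zeta_rep {c η : ℝ} {q : ℕ} (h0 : 0 < η) (h4 : η ≤ 1/4) (hq : 1 ≤ q) (h1 : q + η ≤ c)
    (h2 : c ≤ q+1-η) {s : ℂ} (hs : s.re ≤ -4) :
    riemannZeta (-s) - ∑ n ∈ Icc 1 q, (n:ℂ)^s =
      -∫ v, ww * ((yl c v)^s * Kk (yl c v)) := by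
  have hq' : (1:ℝ) ≤ q := by exact_mod_cast hq
  have hc : 1 ≤ c := by linarith
  have hst : inStrip η c := ⟨q, by push_cast; linarith, by push_cast; linarith⟩
  have hstk : ∀ k : ℕ, inStrip η (c+k) := by
    intro k; obtain ⟨n, h1, h2⟩ := hst
    exact ⟨n+k, by push_cast; linarith, by push_cast; linarith⟩
  set J : ℝ → ℂ := fun c => ∫ v, ww * ((yl c v)^s * Kk (yl c v)) with hJ
  have hJk : ∀ k : ℕ, J (c+k) = J c + ∑ n ∈ Icc 1 (q+k), (n:ℂ)^s
      - ∑ n ∈ Icc 1 q, (n:ℂ)^s := by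
    intro k
    induction k with
    | zero => simp
    | succ k ih =>
      have := J_step (c := c+k) (q := q+k) h0 h4 (by omega) (by push_cast; linarith)
        (by push_cast; linarith) hs
      have e : c + ((k+1:ℕ):ℝ) = c + k + 1 := by push_cast; ring
      rw [e, ← add_assoc q k 1, sum_Icc_succ_top (by omega)]
      simp only [hJ] at ih ⊢
      rw [this, ih]; ring
  have hJ0 : Tendsto (fun k : ℕ => J (c+k)) atTop (𝓝 0) := by
    set C := 2^(-s.re) * rexp (π*|s.im|)/η with hC
    have hb : ∀ k : ℕ, ‖J (c+k)‖ ≤ C/(c+k)^2 * π := by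
      intro k
      have hk : 1 ≤ c+k := by have : (0:ℝ) ≤ k := by positivity
                              linarith
      simp only [hJ]
      refine (norm_integral_le_of_norm_le (sq_dom_int (C/(c+k)^2)) (ae_of_all _ fun v => ?_)).trans ?_
      · rw [norm_mul, ww_norm, one_mul]; exact yK_bd h0 h4 hk (hstk k) hs v
      · simp_rw [div_eq_mul_inv]
        rw [integral_const_mul, integral_univ_inv_one_add_sq]
    refine squeeze_zero_norm hb ?_
    rw [show (0:ℝ) = 0*π by simp]
    refine Tendsto.mul_const _ (Tendsto.div_atTop tendsto_const_nhds ?_)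
    exact (tendsto_pow_atTop two_ne_zero).comp
      (tendsto_atTop_add_const_left _ c tendsto_natCast_atTop_atTop)
  have hz : Tendsto (fun k : ℕ => ∑ n ∈ Icc 1 (q+k), (n:ℂ)^s) atTop (𝓝 (riemannZeta (-s))) := by
    have hre : 1 < (-s).re := by simp; linarith
    have hsum := (summable_one_div_nat_cpow.2 hre).hasSum
    rw [← zeta_eq_tsum_one_div_nat_cpow hre] at hsum
    have ht := hsum.tendsto_sum_nat
    have ht2 := ht.comp (tendsto_add_atTop_nat (q+1))
    refine ht2.congr fun k => ?_
    simp only [Function.comp]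
    rw [show k + (q+1) = (q+k)+1 by ring, sum_range_succ']
    have hs0 : -s ≠ 0 := by intro h; rw [h] at hre; simp at hre; linarith
    simp only [Nat.cast_zero, zero_cpow hs0, div_zero, add_zero]
    rw [← Ico_succ_right_eq_Icc, sum_Ico_eq_sum_range]
    simp only [Nat.succ_eq_succ, Order.succ_eq_add_one, Nat.add_sub_cancel]
    refine sum_congr rfl fun i _ => ?_
    rw [cpow_neg, one_div, inv_inv, add_comm 1 i]
  have h5 : Tendsto (fun k : ℕ => J (c+k)) atTop (𝓝 (J c + riemannZeta (-s)
      - ∑ n ∈ Icc 1 q, (n:ℂ)^s)) := by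
    simp_rw [hJk]
    exact (hz.const_add _).sub_const _
  have := tendsto_nhds_unique h5 hJ0
  linear_combination this
end P12

section P13
open Filter Topology

lemma yl_cont (c : ℝ) : Continuous (yl c) := by unfold yl; fun_prop

lemma ycpow_cont {c : ℝ} (hc : 0 < c) (s : ℂ) : Continuous (fun v => (yl c v)^s) :=
  ln_cont (f := fun y => y^s) fun v => ycpow_diff hc s v

lemma ye_norm (x c v : ℝ) : ‖cexp (-2*π*I*x*yl c v)‖ = rexp (√2*π*x*v) := by
  rw [norm_exp]; congr 1
  rw [show (-2*π*I*x*yl c v : ℂ) = ((-2*π*x:ℝ):ℂ)*(I*yl c v) by push_cast; ring,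
    re_ofReal_mul, I_mul_re, yl, ln_im]; ring

lemma exp_abs_int {κ : ℝ} (hκ : 0 < κ) : Integrable (fun v : ℝ => rexp (-κ*|v|)) := by
  obtain ⟨C, _, hC⟩ := poly_exp 2 hκ
  refine (sq_dom_int C).mono' (by fun_prop) (ae_of_all _ fun v => ?_)
  rw [norm_eq_abs, abs_of_pos (exp_pos _), le_div_iff₀ (by positivity)]
  have h1 := hC |v| (abs_nonneg v)
  have h2 : 1 + v^2 ≤ (1+|v|)^2 := by nlinarith [sq_abs v, abs_nonneg v]
  calc _ ≤ rexp (-κ*|v|) * (C*rexp (κ*|v|)) := by gcongr; linarith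
    _ = C * rexp (-κ*|v| + κ*|v|) := by rw [Real.exp_add]; ring
    _ = C := by simp

lemma param_diff {c κ C : ℝ} (hc : 1 ≤ c) (hκ : 0 < κ) {k : ℝ → ℂ} {S : Set ℝ}
    (hS : MeasurableSet S) (hk : Continuous k)
    (hb : ∀ v ∈ S, ‖k v‖ ≤ C*rexp (-κ*|v|)) (s : ℂ) :
    IntegrableOn (fun v => (yl c v)^(s-1) * k v) S ∧
    DifferentiableAt ℂ (fun s => ∫ v in S, (yl c v)^(s-1) * k v) s := by
  obtain ⟨M, hM⟩ := exists_nat_ge (‖s‖+2)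
  obtain ⟨D, hD, HD⟩ := poly_exp (M+1) (half_pos hκ)
  have hc0 : 0 < c := by linarith
  set E := (2*c)^M * rexp (π*(‖s‖+1)) with hE
  have hcp : ∀ s' ∈ Metric.ball s 1, ∀ v, ‖(yl c v)^(s'-1)‖ ≤ E*(1+|v|)^M := by
    intro s' hs' v
    have hn : ‖s'‖ ≤ ‖s‖+1 := by
      have : ‖s'‖ ≤ ‖s‖ + ‖s'-s‖ := by simpa using norm_add_le s (s'-s)
      rw [mem_ball_iff_norm] at hs'; linarith
    have h1 : |(s'-1).re| ≤ M := by
      have := abs_re_le_norm (s'-1)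
      have h2 := norm_sub_le s' 1
      rw [norm_one] at h2; linarith
    refine (ycpow_bd hc v h1).trans ?_
    have h3 : |(s'-1).im| ≤ ‖s‖+1 := by
      have := abs_im_le_norm s'
      simp; linarith
    rw [← mul_assoc, mul_pow, hE, mul_right_comm]
    have := exp_le_exp.2 (mul_le_mul_of_nonneg_left h3 pi_pos.le)
    gcongr
  have hlog : ∀ v, ‖Complex.log (yl c v)‖ ≤ (2*c+5)*(1+|v|) := by
    intro v
    refine (norm_le_abs_re_add_abs_im _).trans ?_
    rw [log_re, log_im]
    have h1 := abs_arg_le_pi (yl c v)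
    have h2 := yl_half hc v
    have h3 := yl_ub hc v
    have hpi := pi_le_four
    have hv := abs_nonneg v
    have h4 : |Real.log ‖yl c v‖| ≤ c*(1+|v|) + 1 := by
      rw [abs_le]; constructor
      · have := one_sub_inv_le_log_of_pos (show 0 < ‖yl c v‖ by linarith)
        have h6 : (‖yl c v‖)⁻¹ ≤ 2 := by
          rw [inv_le_comm₀ (by linarith) (by norm_num)]; linarith
        nlinarith
      · have := log_le_sub_one_of_pos (show 0 < ‖yl c v‖ by linarith); linarith
    nlinarith
  have hC : ∀ v ∈ S, 0 ≤ C := fun v hv => by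
    have := (norm_nonneg _).trans (hb v hv)
    exact nonneg_of_mul_nonneg_left this (exp_pos _)
  have hdom : ∀ v ∈ S, E*(1+|v|)^M * ((2*c+5)*(1+|v|)) * ‖k v‖ ≤ E*(2*c+5)*D*C*rexp (-(κ/2)*|v|) := by
    intro v hv
    have hCv := hC v hv
    calc _ = E*(2*c+5)*(1+|v|)^(M+1) * ‖k v‖ := by ring
      _ ≤ E*(2*c+5)*(D*rexp (κ/2*|v|)) * (C*rexp (-κ*|v|)) := by
          have := HD |v| (abs_nonneg v)
          have := hb v hv
          gcongr
      _ = E*(2*c+5)*D*C*(rexp (κ/2*|v|)*rexp (-κ*|v|)) := by ring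
      _ = _ := by rw [← Real.exp_add]; congr 2; ring
  have hint : ∀ B : ℝ, Integrable (fun v => B*rexp (-(κ/2)*|v|)) (volume.restrict S) := fun B =>
    ((exp_abs_int (half_pos hκ)).const_mul B).restrict
  have hi : IntegrableOn (fun v => (yl c v)^(s-1) * k v) S := by
    refine (hint (E*(2*c+5)*D*C)).mono' ((ycpow_cont hc0 _).mul hk).aestronglyMeasurable ?_
    refine (ae_restrict_iff' hS).2 (ae_of_all _ fun v hv => ?_)
    refine le_trans ?_ (hdom v hv)
    rw [norm_mul]
    have := hcp s (Metric.mem_ball_self one_pos) v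
    have h6 : 1 ≤ (2*c+5)*(1+|v|) := by nlinarith [abs_nonneg v]
    calc _ ≤ E*(1+|v|)^M*‖k v‖ := by gcongr
      _ = E*(1+|v|)^M*1*‖k v‖ := by ring
      _ ≤ _ := by gcongr
  refine ⟨hi, ?_⟩
  refine (hasDerivAt_integral_of_dominated_loc_of_deriv_le
    (F := fun s v => (yl c v)^(s-1) * k v)
    (F' := fun s v => ((yl c v)^(s-1) * Complex.log (yl c v) * 1) * k v) (μ := volume.restrict S)
    (x₀ := s) (s := Metric.ball s 1) (bound := fun v => E*(2*c+5)*D*C*rexp (-(κ/2)*|v|))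
    (Metric.ball_mem_nhds s one_pos) ?_ hi ?_ ?_ (hint _) ?_).2.differentiableAt
  · exact Eventually.of_forall fun s' => ((ycpow_cont hc0 _).mul hk).aestronglyMeasurable
  · refine ((((ycpow_cont hc0 _).mul ?_).mul continuous_const).mul hk).aestronglyMeasurable
    exact ln_cont (f := Complex.log) fun v => (differentiableAt_id.clog (yl_slit hc0 v))
  · refine (ae_restrict_iff' hS).2 (ae_of_all _ fun v hv s' hs' => ?_)
    refine le_trans ?_ (hdom v hv)
    rw [mul_one, norm_mul, norm_mul]
    have := hcp s' hs' v
    have := hlog v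
    gcongr
  · refine ae_of_all _ fun v s' _ => ?_
    refine HasDerivAt.mul_const ?_ _
    exact ((hasDerivAt_id s').sub_const 1).const_cpow (Or.inl (slitPlane_ne_zero (yl_slit hc0 v)))

def VV (c : ℝ) : ℝ := √2/2*c
def TA (m : ℕ) (c : ℝ) (s : ℂ) : ℂ :=
  ∫ v in Set.Iic (VV c), (yl c v)^(s-1) * (ww * (cexp (-2*π*I*(m:ℝ)*yl c v) * Kk (yl c v)))
def TI (j : ℕ) (c : ℝ) (s : ℂ) : ℂ :=
  ∫ v in Set.Iic (VV c), (yl c v)^(s-1) * (ww * cexp (-2*π*I*(j:ℝ)*yl c v))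
def TT (c : ℝ) (s : ℂ) : ℂ :=
  ∫ v in Set.Ioi (VV c), (yl c v)^(s-1) * (ww * (Kk (yl c v) + 1))

lemma exp_half {a V v : ℝ} (ha : 1 ≤ a) (hV : 0 ≤ V) (h : v ≤ V) :
    rexp (a*v) ≤ rexp ((a+1)*V) * rexp (-1*|v|) := by
  rw [← Real.exp_add]
  refine exp_le_exp.2 ?_
  rcases abs_cases v with ⟨h1, h2⟩ | ⟨h1, h2⟩ <;> rw [h1] <;> nlinarith

lemma s2pi : 1 ≤ √2*π := by
  have : 1 ≤ √2 := by rw [one_le_sqrt]; norm_num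
  nlinarith [pi_gt_three]

lemma VV_nonneg {c : ℝ} (hc : 1 ≤ c) : 0 ≤ VV c := by unfold VV; positivity

lemma Kk_ycont {c η : ℝ} (h0 : 0 < η) (h4 : η ≤ 1/4) (h : inStrip η c) :
    Continuous (fun v => Kk (yl c v)) :=
  ln_cont (f := Kk) fun v => Kk_diff h0 h4 (yl_strip h v)

lemma Kk_decomp {y : ℂ} {η : ℝ} (h0 : 0 < η) (h4 : η ≤ 1/4) (h1 : inStrip η (y.re+y.im)) (m : ℕ) :
    Kk y = cexp (-2*π*I*(m:ℝ)*y) * Kk y +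
      ∑ j ∈ Icc 1 m, cexp (-2*π*I*(j:ℝ)*y) := by
  induction m with
  | zero => simp
  | succ m ih =>
    rw [sum_Icc_succ_top (by omega)]
    have h := Kk_exp h0 h4 h1
    have e : cexp (-2*π*I*((m+1:ℕ):ℝ)*y) * cexp (2*π*I*y) =
        cexp (-2*π*I*(m:ℝ)*y) := by
      rw [← Complex.exp_add]; congr 1; push_cast; ring
    rw [← e] at ih
    linear_combination ih + cexp (-2*π*I*((m+1:ℕ):ℝ)*y) * h

lemma TA_pd {c η : ℝ} (h0 : 0 < η) (h4 : η ≤ 1/4) (hc : 1 ≤ c) (h : inStrip η c) (m : ℕ) (s : ℂ) :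
    IntegrableOn (fun v => (yl c v)^(s-1) * (ww * (cexp (-2*π*I*(m:ℝ)*yl c v) * Kk (yl c v))))
      (Set.Iic (VV c)) ∧ DifferentiableAt ℂ (TA m c) s := by
  refine param_diff (κ := 1) (C := rexp ((√2*π*(m+1)+1)*VV c)*(1/η+1)) hc one_pos measurableSet_Iic
    ?_ ?_ s
  · have := yl_cont c; have := Kk_ycont h0 h4 h; fun_prop
  · intro v hv
    have e : cexp (-2*π*I*(m:ℝ)*yl c v) * Kk (yl c v) =
        cexp (-2*π*I*((m+1:ℝ):ℝ)*yl c v) * (Kk (yl c v) + 1) := by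
      rw [← Kk_exp h0 h4 (yl_strip h v), ← mul_assoc, ← Complex.exp_add]; congr 2; push_cast; ring
    rw [e, norm_mul, ww_norm, one_mul, norm_mul, ye_norm]
    have h5 : ‖Kk (yl c v) + 1‖ ≤ 1/η+1 := (norm_add_le _ _).trans (by
      rw [norm_one]; exact add_le_add (Kk_bdd h0 h4 (yl_strip h v)) le_rfl)
    have h6 := exp_half (a := √2*π*(m+1)) (by
      have := s2pi; have : (0:ℝ) ≤ m := by positivity
      nlinarith) (VV_nonneg hc) hv
    calc _ ≤ rexp ((√2*π*(m+1)+1)*VV c) * rexp (-1*|v|) * (1/η+1) := by gcongr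
      _ = _ := by ring

lemma TI_pd {c : ℝ} (hc : 1 ≤ c) {j : ℕ} (hj : 1 ≤ j) (s : ℂ) :
    IntegrableOn (fun v => (yl c v)^(s-1) * (ww * cexp (-2*π*I*(j:ℝ)*yl c v)))
      (Set.Iic (VV c)) ∧ DifferentiableAt ℂ (TI j c) s := by
  refine param_diff (κ := 1) (C := rexp ((√2*π*j+1)*VV c)) hc one_pos measurableSet_Iic
    ?_ ?_ s
  · have := yl_cont c; fun_prop
  · intro v hv
    rw [norm_mul, ww_norm, one_mul, ye_norm]
    exact exp_half (a := √2*π*j) (by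
      have := s2pi; have : (1:ℝ) ≤ j := by exact_mod_cast hj
      nlinarith) (VV_nonneg hc) hv

lemma TT_k {c η : ℝ} (h0 : 0 < η) (h4 : η ≤ 1/4) (hc : 1 ≤ c) (h : inStrip η c) {v : ℝ}
    (hv : v ∈ Set.Ioi (VV c)) : ‖ww * (Kk (yl c v) + 1)‖ ≤ 1/η*rexp (-1*|v|) := by
  have hv0 : 0 ≤ v := (VV_nonneg hc).trans (le_of_lt hv)
  rw [← Kk_exp h0 h4 (yl_strip h v), norm_mul, ww_norm, one_mul, norm_mul]
  have e := ye_norm (-1) c v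
  rw [show (-2*π*I*((-1:ℝ):ℂ)*yl c v : ℂ) = 2*π*I*yl c v by push_cast; ring] at e
  rw [e, mul_comm, abs_of_nonneg hv0]
  have := Kk_bdd h0 h4 (yl_strip h v)
  have : rexp (√2*π*(-1)*v) ≤ rexp (-1*v) := exp_le_exp.2 (by nlinarith [s2pi])
  gcongr

lemma TT_pd {c η : ℝ} (h0 : 0 < η) (h4 : η ≤ 1/4) (hc : 1 ≤ c) (h : inStrip η c) (s : ℂ) :
    IntegrableOn (fun v => (yl c v)^(s-1) * (ww * (Kk (yl c v) + 1)))
      (Set.Ioi (VV c)) ∧ DifferentiableAt ℂ (TT c) s := by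
  refine param_diff (κ := 1) (C := 1/η) hc one_pos measurableSet_Ioi ?_ ?_ s
  · have := yl_cont c; have := Kk_ycont h0 h4 h; fun_prop
  · exact fun v hv => TT_k h0 h4 hc h hv

lemma yl_hasDeriv (c v : ℝ) : HasDerivAt (fun v : ℝ => yl c v) ww v := by
  unfold yl
  simpa using ((ofRealCLM.hasDerivAt (x := v)).const_mul ww).const_add (c:ℂ)

lemma ycpow_hasDeriv {c : ℝ} (hc : 0 < c) (s : ℂ) (v : ℝ) :
    HasDerivAt (fun v : ℝ => (yl c v)^s) (s*(yl c v)^(s-1)*ww) v := by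
  have h : HasDerivAt (fun y : ℂ => y^s) (s*(yl c v)^(s-1)*1) (yl c v) :=
    (hasDerivAt_id (yl c v)).cpow_const (yl_slit hc v)
  rw [mul_one] at h
  exact h.comp v (yl_hasDeriv c v)

lemma rep_neg {c η : ℝ} {q : ℕ} (h0 : 0 < η) (h4 : η ≤ 1/4) (hq : 1 ≤ q) (h1 : q + η ≤ c)
    (h2 : c ≤ q+1-η) (m : ℕ) {s : ℂ} (hs : s.re ≤ -5) :
    riemannZeta (1-s) - ∑ n ∈ Icc 1 q, (n:ℂ)^(s-1) =
      -TA m c s - ∑ j ∈ Icc 1 m, TI j c s - TT c s - (yl c (VV c))^s/s := by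
  have hq' : (1:ℝ) ≤ q := by exact_mod_cast hq
  have hc : 1 ≤ c := by linarith
  have hc0 : 0 < c := by linarith
  have hst : inStrip η c := ⟨q, by push_cast; linarith, by push_cast; linarith⟩
  have hs1 : (s-1).re ≤ -4 := by simp; linarith
  have hs0 : s ≠ 0 := by intro h; rw [h] at hs; simp at hs; linarith
  have hz := zeta_rep h0 h4 hq h1 h2 hs1
  rw [neg_sub] at hz
  rw [hz]
  have hint := (yK_int h0 h4 hc hst hs1).const_mul ww
  rw [← intervalIntegral.integral_Iic_add_Ioi (b := VV c) hint.integrableOn hint.integrableOn]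
  have e1 : ∫ v in Set.Iic (VV c), ww * ((yl c v)^(s-1) * Kk (yl c v)) =
      TA m c s + ∑ j ∈ Icc 1 m, TI j c s := by
    unfold TA TI
    rw [← integral_finsetSum _ (fun j hj => (TI_pd hc (mem_Icc.1 hj).1 s).1),
      ← integral_add (TA_pd h0 h4 hc hst m s).1
        (integrable_finsetSum _ (fun j hj => (TI_pd hc (mem_Icc.1 hj).1 s).1))]
    congr 1; ext v
    rw [← mul_sum, ← mul_sum, ← mul_add, ← mul_add,
      ← Kk_decomp h0 h4 (yl_strip hst v) m]; ring
  have hyi : Integrable (fun v => (yl c v)^(s-1) * ww) := by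
    refine Integrable.mul_const ?_ _
    refine (sq_dom_int (2^(-(s-1).re) * rexp (π*|(s-1).im|))).mono' (ycpow_cont hc0 _).aestronglyMeasurable
      (ae_of_all _ fun v => (ycpow_dec hc v hs1).trans ?_)
    refine div_le_div_of_nonneg_left (by positivity) (by positivity) ?_
    nlinarith [mul_nonneg (show 0 ≤ c^2-1 by nlinarith) (show 0 ≤ 1+v^2 by positivity)]
  have e2 : ∫ v in Set.Ioi (VV c), ww * ((yl c v)^(s-1) * Kk (yl c v)) =
      TT c s - ∫ v in Set.Ioi (VV c), (yl c v)^(s-1) * ww := by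
    unfold TT
    rw [← integral_sub (TT_pd h0 h4 hc hst s).1 hyi.integrableOn]
    congr 1; ext v; ring
  have e3 : ∫ v in Set.Ioi (VV c), (yl c v)^(s-1) * ww = -(yl c (VV c))^s/s := by
    have hd : ∀ v ∈ Set.Ici (VV c), HasDerivAt (fun v : ℝ => (yl c v)^s/s) ((yl c v)^(s-1) * ww) v := by
      intro v _
      refine ((ycpow_hasDeriv hc0 s v).div_const s).congr_deriv ?_
      field_simp
    have ht : Tendsto (fun v : ℝ => (yl c v)^s/s) atTop (𝓝 0) := by
      rw [show (0:ℂ) = 0/s by simp]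
      refine Tendsto.div_const ?_ s
      refine squeeze_zero_norm (fun v => ycpow_dec hc v (by linarith)) ?_
      refine Tendsto.div_atTop tendsto_const_nhds ?_
      refine Tendsto.const_mul_atTop (by positivity) ?_
      exact tendsto_atTop_add_const_left _ _ (tendsto_pow_atTop two_ne_zero)
    rw [integral_Ioi_of_hasDerivAt_of_tendsto' hd hyi.integrableOn ht]; ring
  rw [e1, e2, e3]; ring

lemma rep {c η : ℝ} {q : ℕ} (h0 : 0 < η) (h4 : η ≤ 1/4) (hq : 1 ≤ q) (h1 : q + η ≤ c)
    (h2 : c ≤ q+1-η) (m : ℕ) {s : ℂ} (hs : 0 < s.im) :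
    riemannZeta (1-s) - ∑ n ∈ Icc 1 q, (n:ℂ)^(s-1) =
      -TA m c s - ∑ j ∈ Icc 1 m, TI j c s - TT c s - (yl c (VV c))^s/s := by
  have hq' : (1:ℝ) ≤ q := by exact_mod_cast hq
  have hc : 1 ≤ c := by linarith
  have hc0 : 0 < c := by linarith
  have hst : inStrip η c := ⟨q, by push_cast; linarith, by push_cast; linarith⟩
  set U : Set ℂ := {s | 0 < s.im} with hU
  have hUo : IsOpen U := isOpen_lt continuous_const continuous_im
  have hUc : IsPreconnected U := (convex_halfSpace_im_gt 0).isPreconnected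
  have hne : ∀ s ∈ U, s ≠ 0 := by
    intro s hs h; simp [hU, h] at hs
  have d1 : DifferentiableOn ℂ (fun s => riemannZeta (1-s) - ∑ n ∈ Icc 1 q, (n:ℂ)^(s-1)) U := by
    intro s hs
    refine DifferentiableAt.differentiableWithinAt (DifferentiableAt.sub ?_ ?_)
    · refine DifferentiableAt.comp s (differentiableAt_riemannZeta ?_) (by fun_prop)
      intro h; exact hne s hs (by linear_combination -h)
    · refine DifferentiableAt.fun_sum fun n hn => ?_
      have : (n:ℂ) ≠ 0 := by
        have := (mem_Icc.1 hn).1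
        exact_mod_cast (by omega : n ≠ 0)
      exact DifferentiableAt.const_cpow (by fun_prop) (Or.inl this)
  have d2 : DifferentiableOn ℂ (fun s => -TA m c s - ∑ j ∈ Icc 1 m, TI j c s - TT c s
      - (yl c (VV c))^s/s) U := by
    intro s hs
    refine DifferentiableAt.differentiableWithinAt ?_
    refine (((TA_pd h0 h4 hc hst m s).2.neg.sub (DifferentiableAt.fun_sum fun j hj =>
      (TI_pd hc (mem_Icc.1 hj).1 s).2)).sub (TT_pd h0 h4 hc hst s).2).sub ?_
    exact (DifferentiableAt.const_cpow (by fun_prop) (Or.inl (slitPlane_ne_zero (yl_slit hc0 _)))).div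
      (by fun_prop) (hne s hs)
  have hz0 : (-6+I : ℂ) ∈ U := by simp [hU]
  refine (d1.analyticOnNhd hUo).eqOn_of_preconnected_of_eventuallyEq (d2.analyticOnNhd hUo) hUc hz0 ?_ hs
  have : {s : ℂ | s.re < -5} ∈ 𝓝 (-6+I : ℂ) :=
    (isOpen_lt continuous_re continuous_const).mem_nhds (by simp; norm_num)
  filter_upwards [this] with s hs
  exact rep_neg h0 h4 hq h1 h2 m (le_of_lt hs)
end P13

section P14
open Filter Topology

def Gj (j : ℕ) (s : ℂ) : ℂ := Complex.Gamma s * cexp (-I*π*s/2) * ((2*π*j:ℝ):ℂ)^(-s)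
def Ee (j : ℕ) (c : ℝ) (s : ℂ) : ℂ := TI j c s + Gj j s

lemma nww_mul (x y : ℝ) : -ww * (x + y*I) = yl (√2*y) (y-x) := by
  rw [yl, ww_eq]
  have h : ((√2:ℝ):ℂ) * ((√2:ℝ):ℂ) = 2 := by exact_mod_cast r2
  apply Complex.ext <;> simp [mul_re, mul_im, add_re] <;> ring

lemma nww_exp : -ww = cexp (((-(π/4):ℝ):ℂ)*I) := by
  rw [ww, ← neg_one_mul, ← exp_pi_mul_I, ← Complex.exp_add]
  rw [exp_eq_exp_iff_exists_int]
  exact ⟨1, by push_cast; ring⟩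

lemma nww_log : Complex.log (-ww) = ((-(π/4):ℝ):ℂ)*I := by
  rw [nww_exp, Complex.log_exp] <;> simp <;> linarith [pi_pos]

lemma nwI_log : Complex.log (-ww*I) = (((π/4):ℝ):ℂ)*I := by
  rw [nww_exp, show (I:ℂ) = cexp (π/2*I) by rw [exp_pi_div_two_mul_I], ← Complex.exp_add, exp_pi_div_two_mul_I]
  rw [show ((-(π/4):ℝ):ℂ)*I + π/2*I = (((π/4):ℝ):ℂ)*I by push_cast; ring]
  rw [Complex.log_exp] <;> simp <;> linarith [pi_pos]

lemma diag_norm {y : ℝ} (hy : 0 < y) (s : ℂ) : ‖(-ww*(y*I))^s‖ = y^s.re * rexp (-(π/4*s.im)) := by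
  have h0 : -ww*I ≠ 0 := by
    intro h; have := congrArg norm h; simp [ww_norm] at this
  have h1 : -ww*(y*I) = (y:ℂ)*(-ww*I) := by ring
  have h2 : (y:ℂ)*(-ww*I) ≠ 0 := mul_ne_zero (by exact_mod_cast hy.ne') h0
  rw [h1, cpow_def_of_ne_zero h2, log_ofReal_mul hy h0, nwI_log, norm_exp,
    rpow_def_of_pos hy, ← Real.exp_add]
  congr 1
  simp [mul_re, add_re]; ring

lemma yl_pt (c : ℝ) : yl c (VV c) = -ww*((VV c:ℝ)*I) := by
  have := nww_mul 0 (VV c)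
  rw [sub_zero, show √2*VV c = c by rw [VV]; linear_combination c/2*r2] at this
  rw [← this]; simp

lemma VV_half {c : ℝ} (hc : 1 ≤ c) : 1/2 ≤ VV c ∧ VV c ≤ c := by
  have := r2
  have h1 : 1 ≤ √2 := by rw [one_le_sqrt]; norm_num
  have h2 : √2 ≤ 2 := by nlinarith
  unfold VV; constructor <;> nlinarith

lemma Gj_rec (j : ℕ) (hj : 1 ≤ j) {s : ℂ} (hs : s ≠ 0) : s*Gj j s = 2*π*I*j*Gj j (s+1) := by
  have hj' : ((2*π*j:ℝ):ℂ) ≠ 0 := by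
    have : (1:ℝ) ≤ j := by exact_mod_cast hj
    have := pi_pos
    exact_mod_cast (by positivity : (2*π*j:ℝ) ≠ 0)
  have e : -I*π*(s+1)/2 = -I*π*s/2 + -(π/2*I) := by ring
  rw [Gj, Gj, Complex.Gamma_add_one s hs, neg_add, cpow_add _ _ hj', cpow_neg_one,
    e, Complex.exp_add, Complex.exp_neg (π/2*I),
    exp_pi_div_two_mul_I, inv_I]
  generalize ((2*π*j:ℝ):ℂ)^(-s) = X
  have h2 : (2*π*j:ℂ)*((2*π*j:ℝ):ℂ)⁻¹ = 1 := by
    push_cast at hj' ⊢; exact mul_inv_cancel₀ hj'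
  linear_combination (-s*Complex.Gamma s*cexp (-I*π*s/2)*X)*(h2 - (2*π*j:ℂ)*((2*π*j:ℝ):ℂ)⁻¹*I_sq)

lemma TI_rec {c : ℝ} (hc : 1 ≤ c) {j : ℕ} (hj : 1 ≤ j) (s : ℂ) :
    s*TI j c s - 2*π*I*j*TI j c (s+1) = (yl c (VV c))^s * cexp (-2*π*I*(j:ℝ)*yl c (VV c)) := by
  have hc0 : 0 < c := by linarith
  have i1 := (TI_pd hc hj s).1
  have i2 := (TI_pd hc hj (s+1)).1
  have hd : ∀ v ∈ Set.Iic (VV c), HasDerivAt (fun v : ℝ => (yl c v)^s * cexp (-2*π*I*(j:ℝ)*yl c v))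
      (s*((yl c v)^(s-1) * (ww * cexp (-2*π*I*(j:ℝ)*yl c v))) -
        2*π*I*j*((yl c v)^(s+1-1) * (ww * cexp (-2*π*I*(j:ℝ)*yl c v)))) v := by
    intro v _
    refine ((ycpow_hasDeriv hc0 s v).mul (((yl_hasDeriv c v).const_mul (-2*π*I*(j:ℝ))).cexp)).congr_deriv ?_
    rw [add_sub_cancel_right]; push_cast; ring
  have hi := (i1.const_mul s).sub (i2.const_mul (2*π*I*j))
  have hf : IntegrableOn (fun v : ℝ => (yl c v)^s * cexp (-2*π*I*(j:ℝ)*yl c v)) (Set.Iic (VV c)) := by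
    refine (i2.mul_const ww⁻¹).congr (ae_of_all _ fun v => ?_)
    have : ww ≠ 0 := by intro h; have := ww_norm; simp [h] at this
    simp only [add_sub_cancel_right]; field_simp
  have := integral_Iic_of_hasDerivAt_of_tendsto' hd hi (tendsto_zero_of_hasDerivAt_of_integrableOn_Iic hd hi hf)
  rw [sub_zero] at this
  rw [← this, TI, TI, integral_sub (i1.const_mul s) (i2.const_mul _), integral_const_mul, integral_const_mul]

lemma pt_norm {c : ℝ} (hc : 1 ≤ c) {M : ℕ} {s : ℂ} (hM : |s.re| ≤ M) :
    ‖(yl c (VV c))^s‖ ≤ (2*c)^M * rexp (-(π/4*s.im)) := by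
  rw [yl_pt, diag_norm (by have := VV_half hc; linarith)]
  have := rpow_bd (VV_half hc).1 hc (VV_half hc).2 hM
  gcongr

lemma pt_exp (c : ℝ) (x : ℝ) : ‖cexp (-2*π*I*x*yl c (VV c))‖ = rexp (π*x*c) := by
  rw [ye_norm, VV]; congr 1; linear_combination π*x*c/2*r2

lemma lap_int {s : ℂ} (hs : 1 < s.re) : ∀ r : ℂ, 0 < r.re →
    IntegrableOn (fun x : ℝ => (x:ℂ)^(s-1) * cexp (-(r*x))) (Set.Ioi 0) ∧
    HasDerivAt (fun r : ℂ => ∫ x in Set.Ioi (0:ℝ), (x:ℂ)^(s-1) * cexp (-(r*x)))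
      (∫ x in Set.Ioi (0:ℝ), (x:ℂ)^(s-1) * (cexp (-(r*x)) * -x)) r := by
  intro r hr
  have hcont : ContinuousOn (fun x : ℝ => (x:ℂ)^(s-1)) (Set.Ioi 0) := fun x hx =>
    (continuousAt_ofReal_cpow_const x (s-1) (Or.inr (ne_of_gt hx))).continuousWithinAt
  have hb0 : ∀ (p : ℝ), -1 < p → ∀ d : ℝ, 0 < d →
      IntegrableOn (fun x : ℝ => x^p * rexp (-d*x)) (Set.Ioi 0) := by
    intro p hp d hd
    have := integrableOn_rpow_mul_exp_neg_mul_rpow (p := 1) hp one_pos hd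
    simpa using this
  have hnx : ∀ x ∈ Set.Ioi (0:ℝ), ∀ r' : ℂ, ‖(x:ℂ)^(s-1) * cexp (-(r'*x))‖ =
      x^(s.re-1) * rexp (-r'.re*x) := by
    intro x hx r'
    rw [norm_mul, norm_cpow_eq_rpow_re_of_pos hx, norm_exp]
    simp
  have hi : IntegrableOn (fun x : ℝ => (x:ℂ)^(s-1) * cexp (-(r*x))) (Set.Ioi 0) := by
    refine (hb0 (s.re-1) (by linarith) r.re hr).mono' ?_ ((ae_restrict_iff' measurableSet_Ioi).2
      (ae_of_all _ fun x hx => (hnx x hx r).le))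
    exact (hcont.mul (by fun_prop)).aestronglyMeasurable measurableSet_Ioi
  refine ⟨hi, ?_⟩
  refine (hasDerivAt_integral_of_dominated_loc_of_deriv_le
    (F := fun r x => ((x:ℝ):ℂ)^(s-1) * cexp (-(r*x)))
    (F' := fun r x => ((x:ℝ):ℂ)^(s-1) * (cexp (-(r*x)) * -x)) (μ := volume.restrict (Set.Ioi 0))
    (x₀ := r) (s := {r' : ℂ | r.re/2 < r'.re}) (bound := fun x => x^s.re * rexp (-(r.re/2)*x))
    ((isOpen_lt continuous_const continuous_re).mem_nhds (by simp; linarith)) ?_ hi ?_ ?_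
      (hb0 s.re (by linarith) (r.re/2) (by linarith)) ?_).2
  · exact Eventually.of_forall fun s' =>
      (hcont.mul (by fun_prop)).aestronglyMeasurable measurableSet_Ioi
  · exact (hcont.mul (by fun_prop)).aestronglyMeasurable measurableSet_Ioi
  · refine (ae_restrict_iff' measurableSet_Ioi).2 (ae_of_all _ fun x hx r' hr' => ?_)
    have hx0 : 0 < x := hx
    rw [← mul_assoc, norm_mul, hnx x hx r', norm_neg, norm_real, norm_eq_abs, abs_of_pos hx0,
      rpow_sub_one hx0.ne']
    rw [show x^s.re/x*rexp (-r'.re*x)*x = x^s.re*rexp (-r'.re*x) by field_simp]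
    refine mul_le_mul_of_nonneg_left (exp_le_exp.2 ?_) (by positivity)
    have : r.re/2 < r'.re := hr'
    nlinarith
  · refine ae_of_all _ fun x r' _ => HasDerivAt.const_mul _ ?_
    have := (((hasDerivAt_id r').mul_const (x:ℂ)).neg).cexp
    simpa using this

lemma lap {s : ℂ} (hs : 1 < s.re) {r : ℂ} (hr : 0 < r.re) :
    ∫ x in Set.Ioi (0:ℝ), (x:ℂ)^(s-1) * cexp (-(r*x)) = cexp (-s*Complex.log r) * Complex.Gamma s := by
  set U : Set ℂ := {r | 0 < r.re}
  have hUo : IsOpen U := isOpen_lt continuous_const continuous_re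
  have hUc : IsPreconnected U := (convex_halfSpace_re_gt 0).isPreconnected
  have d1 : DifferentiableOn ℂ (fun r : ℂ => ∫ x in Set.Ioi (0:ℝ), (x:ℂ)^(s-1) * cexp (-(r*x))) U :=
    fun r hr => ((lap_int hs r hr).2).differentiableAt.differentiableWithinAt
  have d2 : DifferentiableOn ℂ (fun r : ℂ => cexp (-s*Complex.log r) * Complex.Gamma s) U := by
    intro r hr
    have : DifferentiableAt ℂ Complex.log r := differentiableAt_id.clog (Or.inl hr)
    exact DifferentiableAt.differentiableWithinAt (by fun_prop)
  refine (d1.analyticOnNhd hUo).eqOn_of_preconnected_of_frequently_eq (d2.analyticOnNhd hUo) hUc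
    (z₀ := 1) (by simp [U]) ?_ hr
  have hreal : ∀ x : ℝ, 0 < x → ∫ y in Set.Ioi (0:ℝ), (y:ℂ)^(s-1) * cexp (-((x:ℂ)*y)) =
      cexp (-s*Complex.log x) * Complex.Gamma s := by
    intro x hx
    have hx0 : (x:ℂ) ≠ 0 := by exact_mod_cast hx.ne'
    rw [integral_cpow_mul_exp_neg_mul_Ioi (by linarith) hx, one_div,
      inv_cpow _ _ (by rw [arg_ofReal_of_nonneg hx.le]; exact pi_pos.ne), ← cpow_neg,
      cpow_def_of_ne_zero hx0, mul_comm (Complex.log _)]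
  have ht : Tendsto (fun n : ℕ => ((1+1/((n:ℝ)+1) : ℝ):ℂ)) atTop (𝓝[≠] 1) := by
    refine tendsto_nhdsWithin_iff.2 ⟨?_, Eventually.of_forall fun n => ?_⟩
    · have := (tendsto_one_div_add_atTop_nhds_zero_nat (𝕜 := ℝ)).const_add 1
      rw [add_zero] at this
      exact_mod_cast (continuous_ofReal.tendsto 1).comp this
    · have : (0:ℝ) < 1/((n:ℝ)+1) := by positivity
      simp only [Set.mem_compl_iff, Set.mem_singleton_iff]
      intro h
      have : (1+1/((n:ℝ)+1) : ℝ) = 1 := by exact_mod_cast h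
      linarith
  exact ht.frequently (Eventually.frequently (Eventually.of_forall fun n => hreal _ (by positivity)))

end P14

section P15
open Filter Topology

lemma Ee_big {c : ℝ} (hc : 1 ≤ c) {j : ℕ} (hj : 1 ≤ j) {s : ℂ} (hs : 1 < s.re) :
    ‖Ee j c s‖ ≤ (VV c)^s.re * rexp (-(π/4*s.im) + π*j*c) := by
  set h := VV c with hh
  have hh0 : 1/2 ≤ h := (VV_half hc).1
  have hc2 : √2*h = c := by rw [hh, VV]; linear_combination c/2*r2
  have hj' : (1:ℝ) ≤ j := by exact_mod_cast hj
  have hr2 : 0 < √2 := by positivity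
  have hpi := pi_gt_three
  set F : ℂ → ℂ := fun u => (-ww*u)^(s-1) * cexp (-2*π*I*(j:ℝ)*(-ww*u)) with hF
  have hs1 : 0 < (s-1).re := by simp; linarith
  have hre : ∀ u : ℂ, (-ww*u).re = √2/2*(u.re+u.im) := by
    intro u; simp [ww_re, ww_im]; ring
  -- pointwise bound
  obtain ⟨C, hC0, hC⟩ : ∃ C, 0 ≤ C ∧ ∀ x y : ℝ, 0 ≤ x → 0 ≤ y → y ≤ h → ‖F (x+y*I)‖ ≤ C*rexp (-1*|x|) := by
    obtain ⟨M, hM⟩ := exists_nat_ge (s.re-1)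
    obtain ⟨D, hD0, hD⟩ := poly_exp M one_pos
    refine ⟨D*rexp h*rexp (π*|s.im|)*rexp (√2*π*j*h), by positivity, fun x y hx hy hyh => ?_⟩
    have h1 := cpow_bd (-ww*(x+y*I)) (s-1)
    have h2 : ‖-ww*((x:ℂ)+y*I)‖ ≤ x+h := by
      rw [norm_mul, norm_neg, ww_norm, one_mul]
      refine (norm_add_le _ _).trans ?_
      simp [abs_of_nonneg hx, abs_of_nonneg hy]; exact hyh
    have h3 : ‖-ww*((x:ℂ)+y*I)‖^(s-1).re ≤ D*rexp (x+h) := by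
      calc _ ≤ (1+(x+h))^(s-1).re := rpow_le_rpow (norm_nonneg _) (by linarith) hs1.le
        _ ≤ (1+(x+h))^(M:ℝ) := rpow_le_rpow_of_exponent_le (by linarith) (by simpa using hM)
        _ ≤ _ := by rw [rpow_natCast]; simpa using hD (x+h) (by linarith)
    rw [hF]; dsimp only
    rw [norm_mul]
    have h4 : ‖cexp (-2*π*I*(j:ℝ)*(-ww*(x+y*I)))‖ ≤ rexp (√2*π*j*h) * rexp (-2*x) := by
      rw [nww_mul, ye_norm, ← Real.exp_add]
      refine exp_le_exp.2 ?_
      have h5 : 2 ≤ √2*π*j := by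
        have : 1 ≤ √2 := by rw [one_le_sqrt]; norm_num
        nlinarith [mul_nonneg (by linarith : (0:ℝ) ≤ √2-1) pi_pos.le, mul_nonneg (by positivity : 0 ≤ √2*π) (by linarith : (0:ℝ) ≤ j-1)]
      nlinarith [mul_nonneg (by linarith : 0 ≤ √2*π*j - 2) hx, mul_nonneg (by positivity : 0 ≤ √2*π*j) (by linarith : 0 ≤ h-y)]
    simp only [sub_im, one_im, sub_zero] at h1
    calc _ ≤ (D*rexp (x+h) * rexp (π*|s.im|)) * (rexp (√2*π*j*h) * rexp (-2*x)) := by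
          refine mul_le_mul (h1.trans ?_) h4 (norm_nonneg _) (by positivity)
          gcongr
      _ = D*rexp h*rexp (π*|s.im|)*rexp (√2*π*j*h)*(rexp (-1*|x|)) := by
          rw [abs_of_nonneg hx, Real.exp_add, show -1*x = x + -2*x by ring, Real.exp_add x]; ring
  have hcont : ContinuousOn F {u | 0 ≤ u.re ∧ 0 ≤ u.im} := by
    intro u hu
    refine ContinuousAt.continuousWithinAt (ContinuousAt.mul ?_ (by fun_prop))
    refine ContinuousAt.comp (g := fun z : ℂ => z^(s-1)) (f := fun u => -ww*u)
      (continuousAt_cpow_const_of_re_pos (Or.inl ?_) hs1) (by fun_prop)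
    rw [hre]; have := hu.1; have := hu.2; positivity
  have hdiff : ∀ u : ℂ, 0 < u.re → 0 < u.im → DifferentiableAt ℂ F u := by
    intro u h1 h2
    refine DifferentiableAt.mul ?_ (by fun_prop)
    refine DifferentiableAt.cpow_const (by fun_prop) (Or.inl ?_)
    rw [hre]; positivity
  have hint : ∀ y : ℝ, 0 ≤ y → y ≤ h → IntegrableOn (fun x : ℝ => F (x+y*I)) (Set.Ioi 0) := by
    intro y hy hyh
    refine ((exp_abs_int one_pos).const_mul C).restrict.mono' ?_
      ((ae_restrict_iff' measurableSet_Ioi).2 (ae_of_all _ fun x hx => hC x y (le_of_lt hx) hy hyh))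
    refine ContinuousOn.aestronglyMeasurable ?_ measurableSet_Ioi
    refine hcont.comp (by fun_prop) fun x hx => ?_
    simpa using ⟨le_of_lt hx, hy⟩
  have hrect : ∀ X : ℝ, 0 ≤ X → (∫ x in (0:ℝ)..X, F (x+(0:ℝ)*I)) - (∫ x in (0:ℝ)..X, F (x+h*I))
      + I*(∫ y in (0:ℝ)..h, F (X+y*I)) - I*(∫ y in (0:ℝ)..h, F ((0:ℝ)+y*I)) = 0 := by
    intro X hX
    have := integral_boundary_rect_eq_zero_of_continuousOn_of_differentiableOn F 0 (X+h*I) ?_ ?_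
    · simpa using this
    · refine hcont.mono fun u hu => ?_
      rw [mem_reProdIm] at hu
      simp [Set.uIcc_of_le hX, Set.uIcc_of_le (by linarith : 0 ≤ h)] at hu
      exact ⟨hu.1.1, hu.2.1⟩
    · intro u hu
      rw [mem_reProdIm] at hu
      simp [hX, (by linarith : 0 ≤ h)] at hu
      exact (hdiff u hu.1.1 hu.2.1).differentiableWithinAt
  have hlim : (∫ x in Set.Ioi (0:ℝ), F (x+(0:ℝ)*I)) - (∫ x in Set.Ioi (0:ℝ), F (x+h*I))
      + I*0 - I*(∫ y in (0:ℝ)..h, F ((0:ℝ)+y*I)) = 0 := by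
    have t1 := intervalIntegral_tendsto_integral_Ioi 0 (hint 0 le_rfl (by linarith)) tendsto_id
    have t2 := intervalIntegral_tendsto_integral_Ioi 0 (hint h (by linarith) le_rfl) tendsto_id
    have t3 : Tendsto (fun X : ℝ => ∫ y in (0:ℝ)..h, F (X+y*I)) atTop (𝓝 0) := by
      have t4 : Tendsto (fun X : ℝ => C*rexp (-1*X)*h) atTop (𝓝 (C*0*h)) := by
        refine ((tendsto_exp_atBot.comp (g := rexp) (f := fun X => -1*X) ?_).const_mul C).mul_const h
        simpa [neg_one_mul] using (tendsto_neg_atTop_atBot : Tendsto (fun x : ℝ => -x) atTop atBot)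
      rw [mul_zero, zero_mul] at t4
      refine squeeze_zero_norm' ?_ t4
      filter_upwards [eventually_ge_atTop 0] with X hX
      have := intervalIntegral.norm_integral_le_of_norm_le_const (a := 0) (b := h)
        (f := fun y : ℝ => F (X+y*I)) (C := C*rexp (-1*X)) (fun y hy => by
          rw [Set.uIoc_of_le (by linarith)] at hy
          have := hC X y hX hy.1.le hy.2
          rwa [abs_of_nonneg hX] at this)
      rwa [sub_zero, abs_of_nonneg (by linarith : 0 ≤ h)] at this
    have := ((t1.sub t2).add (t3.const_mul I)).sub (tendsto_const_nhds (x := I*(∫ y in (0:ℝ)..h, F ((0:ℝ)+y*I))))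
    refine tendsto_nhds_unique this (tendsto_const_nhds.congr' ?_)
    filter_upwards [eventually_ge_atTop 0] with X hX
    exact (hrect X hX).symm
  have hB : TI j c s = ww * ∫ x in Set.Ioi (0:ℝ), F (x+h*I) := by
    rw [TI, ← hh, ← integral_const_mul]
    have := integral_comp_neg_Ioi 0 (fun x : ℝ => (yl c (x+h))^(s-1) * (ww * cexp (-2*π*I*(j:ℝ)*yl c (x+h))))
    have e2 := (measurePreserving_add_right volume h).setIntegral_preimage_emb
      (MeasurableEquiv.addRight h).measurableEmbedding
      (fun x : ℝ => (yl c x)^(s-1) * (ww * cexp (-2*π*I*(j:ℝ)*yl c x))) (Set.Iic h)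
    rw [← e2, show (fun x => x+h) ⁻¹' Set.Iic h = Set.Iic (-0) by ext x; simp, ← this]
    refine setIntegral_congr_fun measurableSet_Ioi fun x _ => ?_
    simp only [hF]
    rw [nww_mul, hc2, show -x+h = h-x by ring]; ring
  have hA : ww * ∫ x in Set.Ioi (0:ℝ), F (x+(0:ℝ)*I) = -Gj j s := by
    have hw0 : -ww ≠ 0 := by intro h; have := congrArg norm h; simp [ww_norm] at this
    have e1 : ∫ x in Set.Ioi (0:ℝ), F (x+(0:ℝ)*I) = cexp ((s-1)*(((-(π/4):ℝ):ℂ)*I)) *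
        ∫ x in Set.Ioi (0:ℝ), (x:ℂ)^(s-1) * cexp (-((2*π*I*j*(-ww))*x)) := by
      rw [← integral_const_mul]
      refine setIntegral_congr_fun measurableSet_Ioi fun x hx => ?_
      have hx0 : (x:ℂ) ≠ 0 := by exact_mod_cast (ne_of_gt hx)
      have hxc : (-ww*x)^(s-1) = (x:ℂ)^(s-1) * cexp ((s-1)*(((-(π/4):ℝ):ℂ)*I)) := by
        rw [mul_comm (-ww), cpow_def_of_ne_zero (mul_ne_zero hx0 hw0), log_ofReal_mul hx hw0, nww_log,
          cpow_def_of_ne_zero hx0, ← Complex.exp_add, ofReal_log (le_of_lt hx)]; congr 1; ring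
      simp only [hF, ofReal_zero, zero_mul, add_zero]
      rw [hxc, show -2*π*I*(j:ℝ)*(-ww*x) = -((2*π*I*j*(-ww))*x) by push_cast; ring]; ring
    have hj0 : 0 < 2*π*(j:ℝ) := by positivity
    have hlr : Complex.log (2*π*I*j*(-ww)) = (Real.log (2*π*j):ℂ) + ((π/4:ℝ):ℂ)*I := by
      rw [show (2*π*I*j*(-ww):ℂ) = ((2*π*j:ℝ):ℂ)*(-ww*I) by push_cast; ring, log_ofReal_mul hj0
        (mul_ne_zero hw0 I_ne_zero), nwI_log]
    have hrr : 0 < (2*π*I*j*(-ww):ℂ).re := by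
      rw [show (2*π*I*j*(-ww):ℂ) = ((2*π*j:ℝ):ℂ)*(-ww*I) by push_cast; ring, re_ofReal_mul]
      have : (-ww*I).re = √2/2 := by simp [ww_im]
      rw [this]; positivity
    rw [e1, lap hs hrr, hlr, Gj, cpow_def_of_ne_zero (by exact_mod_cast hj0.ne'), ← ofReal_log hj0.le]
    have e3 : ww = -cexp (((-(π/4):ℝ):ℂ)*I) := by rw [← nww_exp]; ring
    rw [e3, neg_mul, neg_inj]
    have e4 : cexp (((-(π/4):ℝ):ℂ)*I) * (cexp ((s-1)*(((-(π/4):ℝ):ℂ)*I)) *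
      cexp (-s*((Real.log (2*π*j):ℂ) + ((π/4:ℝ):ℂ)*I))) = cexp (-I*π*s/2) * cexp ((Real.log (2*π*j):ℂ)*-s) := by
      rw [← Complex.exp_add, ← Complex.exp_add, ← Complex.exp_add]; congr 1; push_cast; ring
    linear_combination Complex.Gamma s * e4
  have hE : Ee j c s = -I*ww*∫ y in (0:ℝ)..h, F ((0:ℝ)+y*I) := by
    rw [Ee, hB]; linear_combination hA - ww*hlim
  rw [hE, norm_mul, norm_mul, norm_neg, norm_I, ww_norm, one_mul, one_mul]
  have := intervalIntegral.norm_integral_le_of_norm_le_const (a := 0) (b := h)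
        (f := fun y : ℝ => F ((0:ℝ)+y*I)) (C := h^(s.re-1) * rexp (-(π/4*s.im) + π*j*c)) (fun y hy => by
      rw [Set.uIoc_of_le (by linarith)] at hy
      simp only [hF]
      rw [norm_mul, nww_mul, ye_norm, ← nww_mul, ofReal_zero, zero_add, diag_norm hy.1, Real.exp_add, ← mul_assoc]
      have h1 : y^(s-1).re ≤ h^(s.re-1) := by
        simpa using rpow_le_rpow hy.1.le hy.2 hs1.le
      have h2 : rexp (√2*π*j*(y-0)) ≤ rexp (π*j*c) := exp_le_exp.2 (by
        rw [← hc2]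
        nlinarith [mul_nonneg (by positivity : 0 ≤ √2*π*j) (by linarith [hy.2] : 0 ≤ h-y)])
      have h3 : (s-1).im = s.im := by simp
      rw [h3]
      gcongr)
  rw [sub_zero, abs_of_nonneg (by linarith : 0 ≤ h)] at this
  refine this.trans (le_of_eq ?_)
  rw [rpow_sub_one (by linarith)]; field_simp

lemma Ee_bd {c : ℝ} (hc : 1 ≤ c) {j : ℕ} (hj : 1 ≤ j) (M : ℕ) : ∀ (k : ℕ) (s : ℂ), 2*π ≤ s.im → 1 < s.re + k →
    |s.re| + k ≤ M → ‖Ee j c s‖ ≤ (k+1)*(j:ℝ)^k*((2*c)^M*rexp (-(π/4*s.im) + π*j*c)) := by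
  have hj' : (1:ℝ) ≤ j := by exact_mod_cast hj
  intro k
  induction k with
  | zero =>
    intro s _ h1 h2
    simp only [Nat.cast_zero, add_zero, zero_add, pow_zero, mul_one, one_mul] at h1 h2 ⊢
    refine (Ee_big hc hj h1).trans ?_
    have := rpow_bd (VV_half hc).1 hc (VV_half hc).2 h2
    gcongr
  | succ k ih =>
    intro s ht h1 h2
    push_cast at h1 h2
    have hpi := pi_gt_three
    have hs0 : s ≠ 0 := by intro h; rw [h] at ht; simp at ht; linarith
    have hn : 2*π ≤ ‖s‖ := ht.trans ((le_abs_self _).trans (abs_im_le_norm s))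
    have e : s*Ee j c s = (yl c (VV c))^s * cexp (-2*π*I*(j:ℝ)*yl c (VV c)) + 2*π*I*j*Ee j c (s+1) := by
      rw [Ee, Ee]; linear_combination TI_rec hc hj s + Gj_rec j hj hs0
    have h3 := ih (s+1) (by simpa using ht) (by simp; linarith) (by
      have := abs_add_le s.re 1; rw [abs_one] at this; simp only [add_re, one_re]; linarith)
    simp only [add_im, one_im, add_zero] at h3
    set W := (2*c)^M*rexp (-(π/4*s.im) + π*j*c) with hW
    have hW0 : 0 ≤ W := by positivity
    have h4 : ‖(yl c (VV c))^s * cexp (-2*π*I*(j:ℝ)*yl c (VV c))‖ ≤ W := by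
      rw [norm_mul, pt_exp, hW, Real.exp_add, ← mul_assoc]
      have := pt_norm hc (M := M) (s := s) (by have : (0:ℝ) ≤ k := by positivity
                                               linarith)
      gcongr
    have h5 : ‖s‖*‖Ee j c s‖ ≤ W + 2*π*j*((k+1)*(j:ℝ)^k*W) := by
      rw [← norm_mul, e]
      refine (norm_add_le _ _).trans (add_le_add h4 ?_)
      rw [norm_mul, show ‖(2*π*I*j:ℂ)‖ = 2*π*j by simp [abs_of_pos pi_pos]]
      gcongr
    have h6 : 2*π*‖Ee j c s‖ ≤ W + 2*π*j*((k+1)*(j:ℝ)^k*W) :=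
      (mul_le_mul_of_nonneg_right hn (norm_nonneg _)).trans h5
    have h7 : (1:ℝ) ≤ (j:ℝ)^(k+1) := one_le_pow₀ hj'
    have h8 : W ≤ 2*π*((j:ℝ)^(k+1)*W) := by
      have h9 : W ≤ (j:ℝ)^(k+1)*W := le_mul_of_one_le_left hW0 h7
      have : 0 ≤ (j:ℝ)^(k+1)*W := by positivity
      nlinarith
    have h10 : 2*π*‖Ee j c s‖ ≤ 2*π*(((k+1:ℕ)+1)*(j:ℝ)^(k+1)*W) := by
      refine h6.trans ((add_le_add h8 le_rfl).trans (le_of_eq ?_))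
      push_cast; ring
    exact le_of_mul_le_mul_left h10 (by positivity)

lemma yl_arg {c v : ℝ} (hc : 1 ≤ c) (hv : VV c < v) : π/4 ≤ (yl c v).arg := by
  have hv0 : 0 < v := lt_of_le_of_lt (VV_nonneg hc) hv
  have h1 : (yl c v).im = √2/2*v := ln_im c v
  have h2 : (yl c v).re = c - √2/2*v := ln_re c v
  have h3 : (yl c v).re ≤ (yl c v).im := by
    rw [h1, h2]; rw [VV] at hv
    have : 0 < √2 := by positivity
    nlinarith [r2]
  have h4 : 0 < (yl c v).im := by rw [h1]; positivity
  by_contra hlt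
  push Not at hlt
  have h5 : 0 < (yl c v).arg := by
    rcases (arg_nonneg_iff.2 h4.le).lt_or_eq with h | h
    · exact h
    · have := arg_eq_zero_iff.1 h.symm; linarith [this.2]
  have h6 := norm_mul_cos_arg (yl c v)
  have h7 := norm_mul_sin_arg (yl c v)
  have h8 : Real.sin (yl c v).arg < Real.sin (π/4) := sin_lt_sin_of_lt_of_le_pi_div_two (by linarith [pi_pos]) (by linarith [pi_pos]) hlt
  have h9 : Real.cos (π/4) < Real.cos (yl c v).arg := cos_lt_cos_of_nonneg_of_le_pi_div_two h5.le (by linarith [pi_pos]) hlt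
  rw [sin_pi_div_four] at h8; rw [cos_pi_div_four] at h9
  have h10 : 0 < ‖yl c v‖ := by have := yl_half hc v; linarith
  nlinarith

lemma TT_bd (M : ℕ) : ∃ C, 0 ≤ C ∧ ∀ (c η : ℝ) (s : ℂ), 0 < η → η ≤ 1/4 → 1 ≤ c → inStrip η c → |s.re-1| ≤ M →
    0 ≤ s.im → ‖TT c s‖ ≤ C*(1/η*(2*c)^M*rexp (-(π/4*s.im))) := by
  obtain ⟨D, hD0, hD⟩ := poly_exp M (half_pos one_pos)
  have hi := (exp_abs_int (half_pos one_pos)).const_mul D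
  refine ⟨∫ v : ℝ, D*rexp (-(1/2)*|v|), integral_nonneg fun v => by positivity, fun c η s h0 h4 hc hst hM ht => ?_⟩
  have hc0 : 0 < c := by linarith
  have hb : ∀ v ∈ Set.Ioi (VV c), ‖(yl c v)^(s-1) * (ww * (Kk (yl c v) + 1))‖ ≤
      (1/η*(2*c)^M*rexp (-(π/4*s.im))) * (D*rexp (-(1/2)*|v|)) := by
    intro v hv
    rw [norm_mul, norm_cpow_of_ne_zero (slitPlane_ne_zero (yl_slit hc0 v))]
    have h1 := TT_k h0 h4 hc hst hv
    have h2 := rpow_bd (yl_half hc v) (by nlinarith [abs_nonneg v]) (yl_ub hc v) hM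
    have h3 : rexp (-((yl c v).arg*s.im)) ≤ rexp (-(π/4*s.im)) := exp_le_exp.2 (by
      nlinarith [yl_arg hc hv])
    have h5 := hD |v| (abs_nonneg v)
    simp only [sub_im, one_im, sub_zero, sub_re, one_re, div_eq_mul_inv, ← Real.exp_neg]
    calc _ ≤ ((2*(c*(1+|v|)))^M * rexp (-(π/4*s.im))) * (1/η*rexp (-1*|v|)) := by gcongr
      _ = (1/η*(2*c)^M*rexp (-(π/4*s.im))) * ((1+|v|)^M * rexp (-1*|v|)) := by
          rw [← mul_assoc 2 c, mul_pow]; ring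
      _ ≤ (1/η*(2*c)^M*rexp (-(π/4*s.im))) * (D*rexp (1/2*|v|) * rexp (-1*|v|)) := by gcongr
      _ = _ := by
          rw [mul_assoc D, ← Real.exp_add, show 1/2*|v| + -1*|v| = -(1/2)*|v| by ring]; simp [div_eq_mul_inv]
  rw [TT]
  refine (norm_integral_le_of_norm_le (hi.const_mul _).integrableOn ((ae_restrict_iff' measurableSet_Ioi).2 (ae_of_all _ hb))).trans ?_
  rw [integral_const_mul, mul_comm]
  refine mul_le_mul_of_nonneg_right ?_ (by positivity)
  exact setIntegral_le_integral hi (ae_of_all _ fun v => by positivity)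
end P15

section P16
open Filter Topology

lemma im_ne {s : ℂ} (hs : s.im ≠ 0) (x : ℝ) : s ≠ x := by
  intro h; rw [h] at hs; simp at hs

lemma inv_chi {s : ℂ} (hs : s.im ≠ 0) :
    (chi s)⁻¹ = 2*(2*π)^(-s)*Complex.Gamma s*Complex.cos (π*s/2) := by
  have h := Gammaℝ_div_Gammaℝ_one_sub (s := s) (fun n => by
    have := im_ne hs (-(2*n+1)); push_cast at this; exact this)
  rw [Gammaℂ] at h
  rw [← h, Gammaℝ_def, Gammaℝ_def, chi, inv_div]
  have hp : (π:ℂ) ≠ 0 := by exact_mod_cast pi_ne_zero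
  have e : (π:ℂ)^(-s/2) = ((π:ℂ)^(s-1/2))⁻¹ * (π:ℂ)^(-(1-s)/2) := by
    rw [← cpow_neg, ← cpow_add _ _ hp]; congr 1; ring
  have h1 : (π:ℂ)^(-(1-s)/2) ≠ 0 := by rw [cpow_def_of_ne_zero hp]; exact Complex.exp_ne_zero _
  have h2 : (π:ℂ)^(s-1/2) ≠ 0 := by rw [cpow_def_of_ne_zero hp]; exact Complex.exp_ne_zero _
  rw [e]
  field_simp

lemma exp_th {ϑ : ℂ → ℂ} (hϑ : IsRSTheta ϑ) {s : ℂ} (hs : s.im ≠ 0) :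
    cexp (I*ϑ s) = cexp (-I*ϑ s) * (chi s)⁻¹ := by
  rw [← hϑ.2.1 s (Or.inl hs), ← Complex.exp_neg, ← Complex.exp_add]; congr 1; ring

lemma zeta_fe {s : ℂ} (hs : s.im ≠ 0) : riemannZeta (1-s) = (chi s)⁻¹ * riemannZeta s := by
  rw [inv_chi hs, riemannZeta_one_sub (fun n => by have := im_ne hs (-n); push_cast at this; exact this)
    (by have := im_ne hs 1; push_cast at this; exact this)]

lemma Yj_bd {s : ℂ} (ht : 2*π ≤ s.im) {j : ℕ} (hj : 1 ≤ j) :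
    ‖(chi s)⁻¹*(j:ℂ)^(-s) - Gj j s‖ ≤ 2*rexp (-(π*s.im))*(‖(chi s)⁻¹‖*‖(j:ℂ)^(-s)‖) := by
  have hpi := pi_gt_three
  have hs : s.im ≠ 0 := by linarith
  set g := (2*π:ℂ)^(-s)*Complex.Gamma s with hg
  set a := cexp (I*π*s/2) with ha
  set b := cexp (-I*π*s/2) with hb
  have hX : (chi s)⁻¹ = g*(a+b) := by
    rw [inv_chi hs, Complex.cos, ha, hb, show (π*s/2*I:ℂ) = I*π*s/2 by ring, show (-(π*s/2)*I:ℂ) = -I*π*s/2 by ring]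
    ring
  have hG : Gj j s = g*b*(j:ℂ)^(-s) := by
    rw [Gj, show (2*π*j:ℝ) = (2*π)*(j:ℝ) by ring, ofReal_mul,
      mul_cpow_ofReal_nonneg (by positivity) (by positivity), hg]
    push_cast; ring
  have hna : ‖a‖ = rexp (-(π*s.im/2)) := by
    rw [ha, norm_exp]; congr 1
    rw [show I*π*s/2 = ((π/2:ℝ):ℂ)*(I*s) by push_cast; ring, re_ofReal_mul, I_mul_re]; ring
  have hnb : ‖b‖ = rexp (π*s.im/2) := by
    rw [hb, norm_exp]; congr 1
    rw [show -I*π*s/2 = ((-π/2:ℝ):ℂ)*(I*s) by push_cast; ring, re_ofReal_mul, I_mul_re]; ring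
  have e1 : (chi s)⁻¹*(j:ℂ)^(-s) - Gj j s = g*a*(j:ℂ)^(-s) := by rw [hX, hG]; ring
  have h1 : ‖a‖ ≤ 2*rexp (-(π*s.im))*‖a+b‖ := by
    have h2 : ‖b‖ - ‖a‖ ≤ ‖a+b‖ := by
      have := norm_sub_norm_le b (-a); rw [norm_neg, sub_neg_eq_add, add_comm b] at this; exact this
    have h3 : rexp (-(π*s.im))*‖b‖ = ‖a‖ := by rw [hna, hnb, ← Real.exp_add]; congr 1; ring
    have h4 : rexp (-(π*s.im)) ≤ 1/2 := by
      rw [Real.exp_neg, ← one_div]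
      refine one_div_le_one_div_of_le (by norm_num) ?_
      have := add_one_le_exp (π*s.im); nlinarith
    nlinarith [exp_pos (-(π*s.im)), norm_nonneg a]
  clear_value g a b
  rw [e1, hX, norm_mul (g*a), norm_mul g a, norm_mul g (a+b)]
  have h5 := mul_le_mul_of_nonneg_left h1 (mul_nonneg (norm_nonneg g) (norm_nonneg ((j:ℂ)^(-s))))
  linarith

lemma eth_bd {ϑ : ℂ → ℂ} (hϑ : IsRSTheta ϑ) (A B : ℝ) : ∃ C, 0 ≤ C ∧ ∃ M : ℕ, ∀ s : ℂ, s.re ∈ Set.Icc A B →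
    2*π ≤ s.im → |s.re| + 1 ≤ M ∧ ‖cexp (-I*ϑ s)‖ ≤ C*(2*s.im)^M ∧ ‖cexp (I*ϑ s)‖ ≤ C*(2*s.im)^M := by
  obtain ⟨C, hC0, hC⟩ := theta_bdd hϑ A B
  obtain ⟨M, hM⟩ := exists_nat_ge (|A|+|B|+1)
  refine ⟨rexp C, by positivity, M, fun s hs ht => ?_⟩
  have hpi := pi_gt_three
  have hσ : |s.re| ≤ |A|+|B| := by
    rw [abs_le]; constructor
    · linarith [neg_abs_le A, hs.1, abs_nonneg B]
    · linarith [le_abs_self B, hs.2, abs_nonneg A]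
  have h1 := hC s hs ht
  set x := s.im/(2*π) with hx
  have hx1 : 1 ≤ x := by rw [hx, le_div_iff₀ (by positivity)]; linarith
  have hxt : x ≤ s.im := div_le_self (by linarith) (by linarith)
  have hre : (th0 s 0).re = Real.log x * ((1/2-s.re)/2) := by
    rw [th0]
    simp only [Icc_eq_empty_of_lt (show 0 < 1 by norm_num), sum_empty, add_zero, add_re]
    rw [re_mul_ofReal, I_mul_re]
    have h5 : ((s.im:ℂ)/2+π/8).im = 0 := by
      rw [show (s.im:ℂ)/2+π/8 = ((s.im/2+π/8:ℝ):ℂ) by push_cast; ring, ofReal_im]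
    have h6 : ((1/2-s)/2).re = (1/2-s.re)/2 := by
      rw [show (1/2-s)/2 = ((1/2:ℝ):ℂ)*(((1/2:ℝ):ℂ)-s) by push_cast; ring, re_ofReal_mul, sub_re, ofReal_re]; ring
    rw [h5, h6]; ring
  have h2 := abs_le.1 ((abs_re_le_norm _).trans h1)
  rw [sub_re, hre] at h2
  have hpw : ∀ τ : ℝ, |τ| ≤ M → rexp (C + Real.log x*τ) ≤ rexp C*(2*s.im)^M := by
    intro τ hτ
    rw [Real.exp_add, ← rpow_def_of_pos (by linarith)]
    have := rpow_bd (by linarith : 1/2 ≤ x) (by linarith) hxt hτ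
    gcongr
  have hτ : |(1/2-s.re)/2| ≤ M := by
    rw [abs_le] at hσ ⊢; constructor <;> linarith
  refine ⟨by linarith, ?_, ?_⟩
  · rw [norm_exp]
    exact (exp_le_exp.2 (by linarith)).trans (hpw _ hτ)
  · rw [norm_exp]
    refine (exp_le_exp.2 ?_).trans (hpw (-((1/2-s.re)/2)) (by rwa [abs_neg]))
    have : (I*ϑ s).re = -(-I*ϑ s).re := by rw [neg_mul, neg_re, neg_neg]
    rw [this]; linarith

set_option maxHeartbeats 1000000 in
lemma tiny {ϑ : ℂ → ℂ} (hϑ : IsRSTheta ϑ) (A B : ℝ) : ∃ C, 0 ≤ C ∧ ∀ s : ℂ, s.re ∈ Set.Icc A B →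
    2*π ≤ s.im → ∀ (c η : ℝ) (q m : ℕ), 0 < η → η ≤ 1/4 → 1 ≤ q → q+η ≤ c → c ≤ q+1-η →
    c ≤ s.im → m ≤ s.im → 1/η ≤ 4*s.im → m*c ≤ 5/4*(s.im/(2*π)) →
    ‖cexp (I*ϑ s)*riemannZeta s - cexp (I*ϑ s)*(∑ n ∈ Icc 1 m, (n:ℂ)^(-s))
      - cexp (-I*ϑ s)*(∑ n ∈ Icc 1 q, (n:ℂ)^(s-1)) + cexp (-I*ϑ s)*TA m c s‖
      ≤ C*rexp (-(s.im/10)) := by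
  obtain ⟨C1, hC1, M, hM⟩ := eth_bd hϑ A B
  obtain ⟨C2, hC2, hTT⟩ := TT_bd M
  set L := 4*M+2 with hL
  obtain ⟨C3, hC3, hP⟩ := poly_exp L (show (0:ℝ) < 1/40 by norm_num)
  refine ⟨C1*(M+10+2*C2)*C3, by positivity, fun s hs ht c η q m h0 h4 hq h1 h2 hct hmt hηt hmc => ?_⟩
  have hpi := pi_gt_d2
  have ht0 : s.im ≠ 0 := by linarith
  have hq' : (1:ℝ) ≤ q := by exact_mod_cast hq
  have hc : 1 ≤ c := by linarith
  have hst : inStrip η c := ⟨q, by push_cast; linarith, by push_cast; linarith⟩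
  obtain ⟨m1, m2, m3⟩ := hM s hs ht
  set t := s.im with htd
  have hT1 : 1 ≤ 2*t := by linarith
  set E := rexp (-(3/20*t)) with hE
  have hk : 1 < s.re + (M+1:ℕ) := by push_cast; linarith [neg_abs_le s.re]
  have hexp1 : rexp (-(π/4*t)) ≤ E := exp_le_exp.2 (by nlinarith)
  have hexp2 : rexp (-(π*t)) ≤ E := exp_le_exp.2 (by nlinarith)
  have hpow : ∀ {a b : ℕ}, a ≤ b → (2*t)^a ≤ (2*t)^b := fun h => pow_le_pow_right₀ hT1 h
  have e1 : cexp (I*ϑ s)*riemannZeta s - cexp (I*ϑ s)*(∑ n ∈ Icc 1 m, (n:ℂ)^(-s))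
      - cexp (-I*ϑ s)*(∑ n ∈ Icc 1 q, (n:ℂ)^(s-1)) + cexp (-I*ϑ s)*TA m c s =
      -(cexp (-I*ϑ s)*(∑ j ∈ Icc 1 m, Ee j c s)
      + cexp (-I*ϑ s)*(∑ j ∈ Icc 1 m, ((chi s)⁻¹*(j:ℂ)^(-s) - Gj j s))
      + cexp (-I*ϑ s)*TT c s + cexp (-I*ϑ s)*((yl c (VV c))^s/s)) := by
    have r := rep h0 h4 hq h1 h2 m (s := s) (by linarith)
    rw [zeta_fe ht0] at r
    simp only [Ee, sum_add_distrib, sum_sub_distrib, ← mul_sum]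
    rw [exp_th hϑ ht0]
    linear_combination cexp (-I*ϑ s)*r
  have hE0 : 0 ≤ E := (exp_pos _).le
  have hcard : ∀ (f : ℕ → ℂ) (K : ℝ), (∀ j ∈ Icc 1 m, ‖f j‖ ≤ K) → 0 ≤ K →
      ‖∑ j ∈ Icc 1 m, f j‖ ≤ (2*t)*K := by
    intro f K h hK
    refine (norm_sum_le_of_le _ h).trans ?_
    rw [sum_const, Nat.card_Icc, nsmul_eq_mul, Nat.add_sub_cancel]
    exact mul_le_mul_of_nonneg_right (by linarith) hK
  have hjt : ∀ j ∈ Icc 1 m, (1:ℝ) ≤ j ∧ (j:ℝ) ≤ m ∧ 1 ≤ j := fun j hj => by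
    rw [mem_Icc] at hj; exact ⟨by exact_mod_cast hj.1, by exact_mod_cast hj.2, hj.1⟩
  have hc2 : ∀ k : ℕ, (2*c)^k ≤ (2*t)^k := fun k => pow_le_pow_left₀ (by linarith) (by linarith) k
  have b1 : ‖∑ j ∈ Icc 1 m, Ee j c s‖ ≤ (2*t)*((M+2)*(2*t)^(M+1)*((2*t)^(2*M)*E)) := by
    refine hcard _ _ (fun j hj => ?_) (by positivity)
    obtain ⟨j1, j2, j3⟩ := hjt j hj
    have h := Ee_bd hc j3 (2*M) (M+1) s ht hk (by push_cast; linarith)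
    refine h.trans ?_
    have hx : rexp (-(π/4*t)+π*j*c) ≤ E := by
      refine exp_le_exp.2 ?_
      have h7 : (j:ℝ)*c ≤ 5/4*(t/(2*π)) := (mul_le_mul_of_nonneg_right j2 (by linarith)).trans hmc
      have h8 : π*(5/4*(t/(2*π))) = 5/8*t := by field_simp; ring
      have h9 := mul_le_mul_of_nonneg_left h7 (by linarith : 0 ≤ π)
      rw [h8] at h9
      nlinarith
    have hjp : (j:ℝ)^(M+1) ≤ (2*t)^(M+1) := pow_le_pow_left₀ (by linarith) (by linarith) _
    have h10 : (2*c)^(2*M)*rexp (-(π/4*t)+π*j*c) ≤ (2*t)^(2*M)*E :=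
      mul_le_mul (hc2 _) hx (exp_pos _).le (by positivity)
    have h11 : (((M+1:ℕ):ℝ)+1)*(j:ℝ)^(M+1) ≤ (M+2)*(2*t)^(M+1) := by
      push_cast; rw [show (M:ℝ)+1+1 = M+2 by ring]
      exact mul_le_mul_of_nonneg_left hjp (by positivity)
    exact mul_le_mul h11 h10 (by positivity) (by positivity)
  have b2 : ‖cexp (-I*ϑ s)*(∑ j ∈ Icc 1 m, ((chi s)⁻¹*(j:ℂ)^(-s) - Gj j s))‖
      ≤ (2*t)*(2*E*(C1*(2*t)^M*(2*t)^M)) := by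
    rw [mul_sum]
    refine hcard _ _ (fun j hj => ?_) (by positivity)
    obtain ⟨j1, j2, j3⟩ := hjt j hj
    rw [norm_mul]
    have h := mul_le_mul_of_nonneg_left (Yj_bd ht j3) (norm_nonneg (cexp (-I*ϑ s)))
    refine h.trans ?_
    have h5 : ‖cexp (-I*ϑ s)‖*‖(chi s)⁻¹‖ ≤ C1*(2*t)^M := by
      rw [← norm_mul, ← exp_th hϑ ht0]; exact m3
    have h6 : ‖(j:ℂ)^(-s)‖ ≤ (2*t)^M := by
      rw [norm_natCast_cpow_of_pos (by omega), neg_re]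
      exact rpow_bd (by linarith) (by linarith) (by linarith) (by rw [abs_neg]; linarith)
    calc _ = 2*rexp (-(π*t))*((‖cexp (-I*ϑ s)‖*‖(chi s)⁻¹‖)*‖(j:ℂ)^(-s)‖) := by ring
      _ ≤ _ := mul_le_mul (by linarith) (mul_le_mul h5 h6 (norm_nonneg _) (by positivity)) (by positivity) (by positivity)
  have b3 : ‖TT c s‖ ≤ C2*(4*t*(2*t)^M*E) := by
    refine (hTT c η s h0 h4 hc hst ?_ (by linarith)).trans ?_
    · have := abs_sub s.re 1; rw [abs_one] at this; linarith
    · have ht4 : 0 ≤ t := by linarith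
      have hc4 : 0 ≤ c := by linarith
      refine mul_le_mul_of_nonneg_left ?_ hC2
      exact mul_le_mul (mul_le_mul hηt (hc2 _) (by positivity) (by positivity)) hexp1 (exp_pos _).le (by positivity)
  have b4 : ‖(yl c (VV c))^s/s‖ ≤ (2*t)^M*E := by
    rw [norm_div]
    have hs1 : 1 ≤ ‖s‖ := by
      refine le_trans ?_ (abs_im_le_norm s)
      rw [← htd, abs_of_pos (by linarith)]; linarith
    refine (div_le_self (norm_nonneg _) hs1).trans ?_
    exact (pt_norm hc (by linarith : |s.re| ≤ M)).trans (mul_le_mul (hc2 _) hexp1 (exp_pos _).le (by positivity))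
  have hfin : (2*t)^L*E ≤ C3*rexp (-(t/10)) := by
    have h1 := hP (2*t) (by linarith)
    have h2 : (2*t)^L ≤ (1+2*t)^L := pow_le_pow_left₀ (by linarith) (by linarith) _
    calc _ ≤ C3*rexp (1/40*(2*t))*E := mul_le_mul_of_nonneg_right (h2.trans h1) hE0
      _ = _ := by rw [hE, mul_assoc, ← Real.exp_add]; congr 2; ring
  set T := 2*t with hT
  have key : ∀ (x : ℂ) (K : ℝ) (k : ℕ), ‖x‖ ≤ K*(T^k*E) → 0 ≤ K → k ≤ 3*M+2 →
      ‖cexp (-I*ϑ s)*x‖ ≤ C1*K*(T^L*E) := by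
    intro x K k hx hK hkL
    rw [norm_mul]
    calc _ ≤ (C1*T^M)*(K*(T^(3*M+2)*E)) := by
          refine mul_le_mul m2 (hx.trans ?_) (norm_nonneg _) (by positivity)
          exact mul_le_mul_of_nonneg_left (mul_le_mul_of_nonneg_right (hpow hkL) hE0) hK
      _ = _ := by rw [hL, show 4*M+2 = M+(3*M+2) by ring, pow_add]; ring
  have k1 := key _ (M+2) (3*M+2) (b1.trans (le_of_eq (by rw [show 3*M+2 = 1+(M+1)+2*M by ring, pow_add, pow_add]; ring))) (by positivity) le_rfl
  have k2 : ‖cexp (-I*ϑ s)*(∑ j ∈ Icc 1 m, ((chi s)⁻¹*(j:ℂ)^(-s) - Gj j s))‖ ≤ C1*2*(T^L*E) := by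
    refine b2.trans ?_
    have : T*(2*E*(C1*T^M*T^M)) = C1*2*(T^(2*M+1)*E) := by
      rw [show 2*M+1 = M+M+1 by ring, pow_succ, pow_add]; ring
    rw [this]
    exact mul_le_mul_of_nonneg_left (mul_le_mul_of_nonneg_right (hpow (by omega)) hE0) (by positivity)
  have k3 := key _ (2*C2) (M+1) (b3.trans (le_of_eq (by rw [pow_succ, hT]; ring))) (by positivity) (by omega)
  have k4 := key _ 1 M (b4.trans (by rw [one_mul])) (by norm_num) (by omega)
  rw [e1, norm_neg]
  refine (norm_add_le_of_le (norm_add_le_of_le (norm_add_le_of_le k1 k2) k3) k4).trans ?_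
  have : C1*(M+2)*(T^L*E) + C1*2*(T^L*E) + C1*(2*C2)*(T^L*E) + C1*1*(T^L*E) ≤ C1*(M+10+2*C2)*(T^L*E) := by
    have h5 : 0 ≤ C1*(T^L*E) := by positivity
    generalize T^L*E = w at h5 ⊢
    linarith
  refine this.trans ?_
  rw [mul_assoc _ C3]
  exact mul_le_mul_of_nonneg_left hfin (by positivity)
end P16

section P17
open Filter Topology

def kn (a b : ℝ) (ζ : ℂ) : ℂ := cexp (2*π*I*a*(ζ-b)) * Kk ζ
def zc (lam b : ℝ) (ζ : ℂ) : ℂ := (√(2*π):ℝ)*lam*(ζ-b)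

lemma kn_bd {a b η : ℝ} {y : ℂ} (ha0 : 0 ≤ a) (ha1 : a ≤ 1) (h0 : 0 < η) (h4 : η ≤ 1/4)
    (h1 : inStrip η (y.re+y.im)) : ‖kn a b y‖ ≤ 2/η := by
  have hn : ‖cexp (2*π*I*a*(y-b))‖ = rexp (-(2*π*a*y.im)) := by
    rw [norm_exp]; congr 1
    rw [show 2*π*I*a*(y-b) = ((2*π*a:ℝ):ℂ)*(I*(y-b)) by push_cast; ring, re_ofReal_mul,
      I_mul_re, sub_im, ofReal_im]; ring
  have hK := Kk_bdd h0 h4 h1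
  have hη : 1 ≤ 1/η := by rw [le_div_iff₀ h0]; linarith
  have e2 : 2/η = 1/η + 1/η := by ring
  have hpi := pi_pos
  rw [kn, norm_mul, hn]
  rcases le_total 0 y.im with h | h
  · have h6 : 0 ≤ 2*π*a*y.im := by positivity
    have : rexp (-(2*π*a*y.im)) ≤ 1 := exp_le_one_iff.2 (by linarith)
    nlinarith [norm_nonneg (Kk y)]
  · have h5 : rexp (-(2*π*a*y.im)) ≤ ‖cexp (2*(π:ℂ)*I*y)‖ := by
      rw [norm_exp, show 2*(π:ℂ)*I*y = ((2*π:ℝ):ℂ)*(I*y) by push_cast; ring, re_ofReal_mul,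
        I_mul_re]
      refine exp_le_exp.2 ?_
      have : 0 ≤ (1-a)*(2*π)*(-y.im) := mul_nonneg (mul_nonneg (by linarith) (by linarith)) (by linarith)
      nlinarith
    refine (mul_le_mul_of_nonneg_right h5 (norm_nonneg _)).trans ?_
    rw [← norm_mul, Kk_exp h0 h4 h1]
    refine (norm_add_le _ _).trans ?_
    rw [norm_one]; linarith

lemma pw_TA {s : ℂ} {lam β a b p v : ℝ} {m q : ℕ} (hl : 0 < lam) (hβ : 0 < β)
    (hsq : √s.im = √(2*π)*lam*β) (hα : m + a = lam^2*β) (hb : β = q + b) (hc : 0 < q+p) :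
    (yl (q+p) v)^(s-1) * (ww * (cexp (-2*π*I*(m:ℝ)*yl (q+p) v) * Kk (yl (q+p) v))) =
    (β:ℂ)^(s-1) * cexp (-2*π*I*m*β) *
      (ww * (Wz s (zc lam b (p+ww*v)) * kn a b (p+ww*v))) := by
  set ζ : ℂ := p+ww*v with hζ
  have hy : yl (q+p) v = q + ζ := by rw [yl, hζ]; push_cast; ring
  have hy0 : yl (q+p) v ≠ 0 := slitPlane_ne_zero (yl_slit hc v)
  rw [hy] at hy0 ⊢
  have hβ0 : (β:ℂ) ≠ 0 := by exact_mod_cast hβ.ne'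
  have hbc : (β:ℂ) = q + b := by exact_mod_cast hb
  have hαc : (m:ℂ) + a = lam^2*β := by exact_mod_cast hα
  have hr : (√(2*π):ℝ) ≠ 0 := by positivity
  have hrc : ((√(2*π):ℝ):ℂ) ≠ 0 := by exact_mod_cast hr
  have hr2 : ((√(2*π):ℝ):ℂ)*((√(2*π):ℝ):ℂ) = 2*π := by
    have := mul_self_sqrt (show 0 ≤ 2*π by positivity); exact_mod_cast this
  have hlc : (lam:ℂ) ≠ 0 := by exact_mod_cast hl.ne'
  have e1 : 1 + zc lam b ζ/((√s.im:ℝ):ℂ) = ((β⁻¹:ℝ):ℂ)*(q+ζ) := by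
    rw [hsq, zc]; push_cast; field_simp; rw [hbc]; ring
  have e2 : I*((√s.im:ℝ):ℂ)*zc lam b ζ = 2*π*I*(m+a)*(ζ-b) := by
    rw [hsq, zc, hαc]; push_cast; linear_combination I*lam^2*β*(ζ-b)*hr2
  have eK : Kk (q+ζ) = Kk ζ := by
    rw [Kk, Kk, show 2*(π:ℂ)*I*(q+ζ) = 2*π*I*ζ + q*(2*π*I) by ring, Complex.exp_add,
      exp_nat_mul_two_pi_mul_I, mul_one]
  rw [Wz, e1, e2, log_ofReal_mul (by positivity) hy0, eK, kn,
    cpow_def_of_ne_zero hy0, cpow_def_of_ne_zero hβ0, Real.log_inv, ← ofReal_log hβ.le]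
  have e3 : ∀ A B C D E : ℂ, A + B = C + D + E + (2*π*I*a*(ζ-b)) → E = E →
      cexp A * (ww * (cexp B * Kk ζ)) = cexp C*cexp D*
      (ww*(cexp E*(cexp (2*π*I*a*(ζ-b))*Kk ζ))) := by
    intro A B C D E h _
    calc _ = cexp (A+B)*(ww*Kk ζ) := by rw [Complex.exp_add]; ring
      _ = _ := by rw [h, Complex.exp_add, Complex.exp_add, Complex.exp_add]; ring
  refine e3 _ _ _ _ _ ?_ rfl
  rw [hbc]; push_cast; ring

lemma pw_mF (n : ℕ) (σ : ℝ) {lam a b : ℝ} (hl : 0 < lam) (ζ : ℂ) :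
    ∑ r ∈ range (3*n+1), (ww * mF r lam ((a/lam+b*lam:ℝ):ℂ) ζ) *
      PP n (3*n-r) ((√(π/2)*(a/lam-b*lam):ℝ):ℂ) σ =
    cexp (-(π:ℂ)*I*((a/lam+b*lam:ℝ):ℂ)^2/2 + π*I*lam^2*b^2 + 2*π*I*a*b) *
      (ww * (pn n σ (zc lam b ζ) * cexp (-I*(zc lam b ζ)^2/2) * kn a b ζ)) := by
  have hlc : (lam:ℂ) ≠ 0 := by exact_mod_cast hl.ne'
  have hr2 : ((√(2*π):ℝ):ℂ)^2 = 2*π := by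
    have := sq_sqrt (show 0 ≤ 2*π by positivity); exact_mod_cast this
  have hr3 : √(2*π) = 2*√(π/2) := by
    rw [show 2*π = 2^2*(π/2) by ring, sqrt_mul (by norm_num), sqrt_sq (by norm_num)]
  have hX : mX lam ((a/lam+b*lam:ℝ):ℂ) ζ = zc lam b ζ - ((√(π/2)*(a/lam-b*lam):ℝ):ℂ) := by
    rw [mX, zc, hr3]; push_cast; ring
  have e : cexp (-(π:ℂ)*I*((a/lam+b*lam:ℝ):ℂ)^2/2 + 2*(π:ℂ)*I*lam*((a/lam+b*lam:ℝ):ℂ)*ζ - π*I*lam^2*ζ^2) =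
      cexp (-(π:ℂ)*I*((a/lam+b*lam:ℝ):ℂ)^2/2 + π*I*lam^2*b^2 + 2*π*I*a*b) *
      (cexp (-I*(zc lam b ζ)^2/2)*cexp (2*π*I*a*(ζ-b))) := by
    rw [← Complex.exp_add, ← Complex.exp_add]; congr 1
    have h1 : (lam:ℂ)*((a/lam+b*lam:ℝ):ℂ) = a + b*lam^2 := by push_cast; field_simp
    rw [zc]
    linear_combination 2*π*I*ζ*h1 + I/2*lam^2*(ζ-b)^2*hr2
  have h := PP_sum n σ ((√(π/2)*(a/lam-b*lam):ℝ):ℂ) (zc lam b ζ)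
  rw [← h, sum_mul, sum_mul, mul_sum, mul_sum]
  refine sum_congr rfl fun r _ => ?_
  rw [mF, hX, e, kn]; ring

lemma main_sum (N : ℕ) {s : ℂ} (hs : 0 < s.im) {lam a b p η : ℝ} (hl : 0 < lam) (h0 : 0 < η) (h4 : η ≤ 1/4)
    (hp : p ∈ Set.Icc η (1-η)) :
    Integrable (fun v : ℝ => ww * ((∑ n ∈ range N, pn n s.re (zc lam b (p+ww*v)) * ((1/√s.im:ℝ):ℂ)^n) *
      cexp (-I*(zc lam b (p+ww*v))^2/2) * kn a b (p+ww*v))) ∧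
    ∑ n ∈ range N, ((lam : ℂ) ^ ((1:ℂ)/2 - s) * ((s.im ^ (-(n:ℝ)/2) : ℝ) : ℂ) *
        ∑ r ∈ range (3*n + 1), Gderiv r ((a/lam + b*lam : ℝ) : ℂ) ((lam^2 : ℝ) : ℂ) *
          ((((2*π) ^ (-(r:ℝ)/2) : ℝ)) : ℂ) *
          PP n (3*n - r) ((Real.sqrt (π/2) * (a/lam - b*lam) : ℝ) : ℂ) s.re) =
    (lam : ℂ) ^ ((1:ℂ)/2 - s) * ((lam^((1:ℝ)/2):ℝ):ℂ) * cexp (π*I/8) *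
      cexp (-(π:ℂ)*I*((a/lam+b*lam:ℝ):ℂ)^2/2 + π*I*lam^2*b^2 + 2*π*I*a*b) *
      ∫ v : ℝ, ww * ((∑ n ∈ range N, pn n s.re (zc lam b (p+ww*v)) * ((1/√s.im:ℝ):ℂ)^n) *
      cexp (-I*(zc lam b (p+ww*v))^2/2) * kn a b (p+ww*v)) := by
  set u : ℂ := ((a/lam+b*lam:ℝ):ℂ) with hu
  set E0 := cexp (-(π:ℂ)*I*u^2/2 + π*I*lam^2*b^2 + 2*π*I*a*b) with hE0
  have hE00 : E0 ≠ 0 := Complex.exp_ne_zero _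
  set P : ℕ → ℝ → ℂ := fun n v => ww * (pn n s.re (zc lam b (p+ww*v)) * cexp (-I*(zc lam b (p+ww*v))^2/2)
    * kn a b (p+ww*v)) with hP
  have hi : ∀ n, ∀ r ∈ range (3*n+1), Integrable (fun v : ℝ => (ww * mF r lam u (p+ww*v)) *
      PP n (3*n-r) ((√(π/2)*(a/lam-b*lam):ℝ):ℂ) s.re) := fun n r _ => (mF_int r hl u h0 h4 hp).mul_const _
  have hPe : ∀ n, P n = fun v : ℝ => E0⁻¹ * ∑ r ∈ range (3*n+1), (ww * mF r lam u (p+ww*v)) *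
      PP n (3*n-r) ((√(π/2)*(a/lam-b*lam):ℝ):ℂ) s.re := by
    intro n; funext v
    rw [pw_mF n s.re hl, ← hu, ← hE0, inv_mul_cancel_left₀ hE00]
  have hPi : ∀ n, Integrable (P n) := fun n => by
    rw [hPe n]; exact (integrable_finsetSum _ (hi n)).const_mul _
  have hF : (fun v : ℝ => ww * ((∑ n ∈ range N, pn n s.re (zc lam b (p+ww*v)) * ((1/√s.im:ℝ):ℂ)^n) *
      cexp (-I*(zc lam b (p+ww*v))^2/2) * kn a b (p+ww*v))) =
      fun v => ∑ n ∈ range N, ((1/√s.im:ℝ):ℂ)^n * P n v := by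
    funext v
    rw [sum_mul, sum_mul, mul_sum]
    refine sum_congr rfl fun n _ => ?_
    rw [hP]; ring
  rw [hF]
  refine ⟨integrable_finsetSum _ fun n _ => (hPi n).const_mul _, ?_⟩
  rw [integral_finsetSum _ fun n _ => (hPi n).const_mul _, mul_sum]
  refine sum_congr rfl fun n _ => ?_
  rw [integral_const_mul, hPe n, integral_const_mul, integral_finsetSum _ (hi n)]
  have ht : ((s.im ^ (-(n:ℝ)/2) : ℝ) : ℂ) = ((1/√s.im:ℝ):ℂ)^n := by
    rw [← ofReal_pow, one_div, inv_pow, sqrt_eq_rpow, ← rpow_natCast, ← rpow_mul hs.le,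
      ← rpow_neg hs.le]; congr 2; ring
  rw [ht]
  have e : ∑ r ∈ range (3*n + 1), Gderiv r u ((lam^2 : ℝ) : ℂ) *
          ((((2*π) ^ (-(r:ℝ)/2) : ℝ)) : ℂ) *
          PP n (3*n - r) ((Real.sqrt (π/2) * (a/lam - b*lam) : ℝ) : ℂ) s.re =
      ((lam^((1:ℝ)/2):ℝ):ℂ) * cexp (π*I/8) * ∑ r ∈ range (3*n+1),
        ∫ v : ℝ, (ww * mF r lam u (p+ww*v)) * PP n (3*n-r) ((√(π/2)*(a/lam-b*lam):ℝ):ℂ) s.re := by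
    rw [mul_sum]
    refine sum_congr rfl fun r _ => ?_
    rw [Gderiv_eq r hl u h0 h4 hp, integral_mul_const, Gm]
    have h2 : ((√(2*π):ℝ):ℂ)^r * (((2*π) ^ (-(r:ℝ)/2) : ℝ) : ℂ) = 1 := by
      rw [← ofReal_pow, ← ofReal_mul, sqrt_eq_rpow, ← rpow_natCast,
        ← rpow_mul (by positivity), ← rpow_add (by positivity),
        show 1/2*(r:ℝ)+ -(r:ℝ)/2 = 0 by ring, rpow_zero, ofReal_one]
    linear_combination ((lam^((1:ℝ)/2):ℝ):ℂ) * cexp (π*I/8) * (∫ v : ℝ, ww * mF r lam u (p+ww*v)) *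
      PP n (3*n-r) ((√(π/2)*(a/lam-b*lam):ℝ):ℂ) s.re * h2
  rw [e]
  field_simp

end P17

section P18
open Filter Topology

lemma lam_log {α β : ℝ} (hα : 0 < α) (hβ : 0 < β) :
    √(α/β) = rexp ((Real.log α - Real.log β)/2) := by
  rw [← log_div hα.ne' hβ.ne', Real.exp_half, Real.exp_log (by positivity)]

lemma kap_exp {s : ℂ} {α β : ℝ} (m : ℕ) (hα : 0 < α) (hβ : 0 < β) (hs : s.im = 2*π*α*β) :
    cexp (th0 s 0) * (β:ℂ)^(s-1) * cexp (-2*π*I*m*β) =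
    cexp (((1/2-s)/2)*((Real.log α:ℂ)+(Real.log β:ℂ)) + (Real.log β:ℂ)*(s-1)
      + I*((π*α*β+π/8-2*π*m*β:ℝ):ℂ)) := by
  have hβ0 : (β:ℂ) ≠ 0 := by exact_mod_cast hβ.ne'
  rw [cpow_def_of_ne_zero hβ0, ← ofReal_log hβ.le, ← Complex.exp_add, ← Complex.exp_add, th0,
    show s.im/(2*π) = α*β by rw [hs]; field_simp, Real.log_mul hα.ne' hβ.ne', hs]
  congr 1
  simp
  ring

lemma kap_norm {s : ℂ} {α β : ℝ} (m : ℕ) (hα : 0 < α) (hβ : 0 < β) (hs : s.im = 2*π*α*β) :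
    ‖cexp (th0 s 0) * (β:ℂ)^(s-1) * cexp (-2*π*I*m*β)‖ =
      (2*π/s.im)^((1:ℝ)/4) * (√(α/β))^(1-s.re) := by
  rw [kap_exp m hα hβ hs, norm_exp]
  have h1 : 2*π/s.im = rexp (-(Real.log α+Real.log β)) := by
    rw [← Real.log_mul hα.ne' hβ.ne', Real.exp_neg, Real.exp_log (by positivity), hs]; field_simp
  rw [h1, lam_log hα hβ, ← exp_mul, ← exp_mul, ← Real.exp_add]
  congr 1
  rw [add_re, add_re, ← ofReal_add, re_mul_ofReal, re_ofReal_mul,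
    re_mul_ofReal, I_re, sub_re, one_re,
    show (1/2-s)/2 = ((1/2:ℝ):ℂ)*(((1/2:ℝ):ℂ)-s) by push_cast; ring, re_ofReal_mul, sub_re, ofReal_re]
  ring

lemma kappa {s : ℂ} {α β lam a b : ℝ} {m q : ℕ} (hα : 0 < α) (hβ : 0 < β) (hs : s.im = 2*π*α*β)
    (hl : lam = √(α/β)) (ha : α = m + a) (hb : β = q + b) :
    (-1:ℂ)^(m*q+1) * cexp ((π:ℂ) * I * ((2*a*β - 2*b*α + a^2/lam^2 - b^2*lam^2 : ℝ) : ℂ) / 2) *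
      (((2*π/s.im) ^ ((1:ℝ)/4) : ℝ) : ℂ) *
      ((lam : ℂ) ^ ((1:ℂ)/2 - s) * ((lam^((1:ℝ)/2):ℝ):ℂ) * cexp (π*I/8) *
      cexp (-(π:ℂ)*I*((a/lam+b*lam:ℝ):ℂ)^2/2 + π*I*lam^2*b^2 + 2*π*I*a*b)) =
    -(cexp (th0 s 0) * (β:ℂ)^(s-1) * cexp (-2*π*I*m*β)) := by
  rw [kap_exp m hα hβ hs]
  have hl0 : 0 < lam := by rw [hl]; positivity
  have h1 : 2*π/s.im = rexp (-(Real.log α+Real.log β)) := by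
    rw [← Real.log_mul hα.ne' hβ.ne', Real.exp_neg, Real.exp_log (by positivity), hs]; field_simp
  have hll : Real.log lam = (Real.log α - Real.log β)/2 := by rw [hl, lam_log hα hβ, Real.log_exp]
  have hlc : (lam:ℂ) ≠ 0 := by exact_mod_cast hl0.ne'
  have e1 : (lam : ℂ) ^ ((1:ℂ)/2 - s) = cexp (((Real.log α:ℂ) - (Real.log β:ℂ))/2*(1/2-s)) := by
    rw [cpow_def_of_ne_zero hlc, ← ofReal_log hl0.le, hll]; push_cast; rfl
  have e2 : ((lam^((1:ℝ)/2):ℝ):ℂ) = cexp (((Real.log α:ℂ) - (Real.log β:ℂ))/2*(1/2)) := by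
    rw [rpow_def_of_pos hl0, hll]; push_cast; rfl
  have e3 : (((2*π/s.im) ^ ((1:ℝ)/4) : ℝ) : ℂ) = cexp (-((Real.log α:ℂ)+(Real.log β:ℂ))*(1/4)) := by
    rw [h1, ← exp_mul]; push_cast; rfl
  have e4 : (-1:ℂ)^(m*q+1) = -cexp ((m*q:ℕ)*(π*I)) := by
    rw [Complex.exp_nat_mul, exp_pi_mul_I]; ring
  rw [e1, e2, e3, e4, neg_mul, neg_mul, neg_mul, ← Complex.exp_add, ← Complex.exp_add, ← Complex.exp_add,
    ← Complex.exp_add, ← Complex.exp_add, ← Complex.exp_add]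
  congr 1
  rw [exp_eq_exp_iff_exists_int]
  refine ⟨(m*q:ℕ), ?_⟩
  have hac : (α:ℂ) = m + a := by exact_mod_cast ha
  have hbc : (β:ℂ) = q + b := by exact_mod_cast hb
  have hp : (a:ℂ)/lam*lam = a := div_mul_cancel₀ _ hlc
  have hp2 : (a:ℂ)^2/lam^2 = (a/lam)^2 := by rw [div_pow]
  push_cast
  rw [hac, hbc, hp2]
  generalize (a:ℂ)/lam = P at hp ⊢
  linear_combination (-π*I*b)*hp

lemma tail_int : ∀ {κ : ℝ}, 0 < κ → ∫ v : ℝ, rexp (-|κ*v|/10) = (∫ v : ℝ, rexp (-|v|/10))/κ := by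
  intro κ hκ
  have := Measure.integral_comp_mul_left (fun v : ℝ => rexp (-|v|/10)) κ
  rw [this, abs_of_pos (by positivity), smul_eq_mul]; field_simp

end P18

section P19
open Filter Topology

lemma zc_zz (lam b p v : ℝ) : zc lam b (p+ww*v) = zz (√(2*π)*lam*(p-b)) (lam*√π*v) := by
  rw [zc, zz, ww_eq, sqrt_mul (by norm_num)]
  have h : ((√2:ℝ):ℂ)*((√2:ℝ):ℂ) = 2 := by have := r2; exact_mod_cast this
  push_cast
  linear_combination ((√π:ℝ):ℂ)*lam*(-1+I)*v/2*h

lemma core {ϑ : ℂ → ℂ} (hϑ : IsRSTheta ϑ) (A B : ℝ) (N : ℕ) : ∃ C, 0 ≤ C ∧ ∀ s : ℂ, s.re ∈ Set.Icc A B →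
    2*π ≤ s.im → ∀ (lam β a b p η : ℝ) (m q : ℕ), 0 < lam → 0 < β → √s.im = √(2*π)*lam*β → m + a = lam^2*β →
    β = q + b → 1 ≤ q → 0 ≤ a → a ≤ 1 → 0 < η → η ≤ 1/4 → p ∈ Set.Icc η (1-η) → |√(2*π)*lam*(p-b)| ≤ 7/10 →
    ‖cexp (-I*ϑ s)*TA m (q+p) s - (cexp (th0 s 0) * (β:ℂ)^(s-1) * cexp (-2*π*I*m*β)) *
      ∫ v : ℝ, ww * ((∑ n ∈ range N, pn n s.re (zc lam b (p+ww*v)) * ((1/√s.im:ℝ):ℂ)^n) *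
      cexp (-I*(zc lam b (p+ww*v))^2/2) * kn a b (p+ww*v))‖ ≤
    ‖cexp (th0 s 0) * (β:ℂ)^(s-1) * cexp (-2*π*I*m*β)‖ * (C*(1/√s.im)^N*(1/(η*lam))) := by
  obtain ⟨C, hC, hM⟩ := main_est hϑ A B N
  set J := ∫ v : ℝ, rexp (-|v|/10) with hJ
  have hJ0 : 0 ≤ J := integral_nonneg fun v => (exp_pos _).le
  refine ⟨2*C*J/√π, by positivity, fun s hs ht lam β a b p η m q hl hβ hsq hα hb hq ha0 ha1 h0 h4 hp hk => ?_⟩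
  have hpi := pi_pos
  have hq' : (1:ℝ) ≤ q := by exact_mod_cast hq
  have hc : 1 ≤ q+p := by linarith [hp.1]
  have hst : inStrip η (q+p) := ⟨q, by push_cast; linarith [hp.1], by push_cast; linarith [hp.2]⟩
  have hst0 : ∀ v : ℝ, inStrip η (((p:ℂ)+ww*v).re+((p:ℂ)+ww*v).im) := fun v =>
    ⟨0, by rw [ln_reim]; push_cast; linarith [hp.1], by rw [ln_reim]; push_cast; linarith [hp.2]⟩
  set E1 := cexp (th0 s 0) * (β:ℂ)^(s-1) * cexp (-2*π*I*m*β) with hE1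
  have hβ0 : (β:ℂ) ≠ 0 := by exact_mod_cast hβ.ne'
  set E2 := (β:ℂ)^(s-1) * cexp (-2*π*I*m*β) with hE2
  have hE20 : E2 ≠ 0 := mul_ne_zero (by rw [cpow_def_of_ne_zero hβ0]; exact Complex.exp_ne_zero _)
    (Complex.exp_ne_zero _)
  set g : ℝ → ℂ := fun v => ww * (Wz s (zc lam b (p+ww*v)) * kn a b (p+ww*v)) with hg
  have hgi : IntegrableOn g (Set.Iic (VV (q+p))) := by
    have h := ((TA_pd h0 h4 hc hst m s).1).const_mul E2⁻¹
    refine h.congr (ae_of_all _ fun v => ?_)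
    simp only [pw_TA (v := v) hl hβ hsq hα hb (by linarith : 0 < q+p)]
    rw [← hE2, inv_mul_cancel_left₀ hE20]
  have hTA : TA m (q+p) s = E2 * ∫ v in Set.Iic (VV (q+p)), g v := by
    rw [TA, ← integral_const_mul]
    refine integral_congr_ae (ae_of_all _ fun v => ?_)
    simp only [pw_TA (v := v) hl hβ hsq hα hb (by linarith : 0 < q+p)]; rfl
  have hth : cexp (-I*ϑ s) = cexp (th0 s 0)*Uf ϑ s := by
    rw [Uf, ← Complex.exp_add]; congr 1; ring
  obtain ⟨f2i, -⟩ := main_sum N (s := s) (by linarith) (a := a) (b := b) hl h0 h4 hp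
  set f2 : ℝ → ℂ := fun v : ℝ => ww * ((∑ n ∈ range N, pn n s.re (zc lam b (p+ww*v)) * ((1/√s.im:ℝ):ℂ)^n) *
      cexp (-I*(zc lam b (p+ww*v))^2/2) * kn a b (p+ww*v)) with hf2
  set f1 : ℝ → ℂ := (Set.Iio (VV (q+p))).indicator (fun v => Uf ϑ s * g v) with hf1
  have f1i : Integrable f1 :=
    (integrable_indicator_iff measurableSet_Iio).2 ((hgi.mono_set Set.Iio_subset_Iic_self).const_mul _)
  have e1 : cexp (-I*ϑ s)*TA m (q+p) s = E1*∫ v, f1 v := by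
    rw [hf1, integral_indicator measurableSet_Iio, integral_const_mul, hTA, hth, integral_Iic_eq_integral_Iio, hE1, hE2]
    ring
  rw [e1, ← mul_sub, norm_mul, ← integral_sub f1i f2i]
  refine mul_le_mul_of_nonneg_left ?_ (norm_nonneg _)
  have hκ : 0 < lam*√π := by positivity
  have hb2 : ∀ v : ℝ, ‖f1 v - f2 v‖ ≤ (2/η*(C*(1/√s.im)^N))*rexp (-|lam*√π*v|/10) := by
    intro v
    have h := hM s hs ht (√(2*π)*lam*(p-b)) (lam*√π*v) hk
    rw [← zc_zz] at h
    set D := (if lam*√π*v < (√s.im+√(2*π)*lam*(p-b))/2 then Uf ϑ s * Wz s (zc lam b (p+ww*v)) else 0) -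
      (∑ n ∈ range N, pn n s.re (zc lam b (p+ww*v)) * ((1/√s.im:ℝ):ℂ)^n) *
      cexp (-I*(zc lam b (p+ww*v))^2/2) with hD
    have hiff : lam*√π*v < (√s.im+√(2*π)*lam*(p-b))/2 ↔ v < VV (q+p) := by
      rw [hsq, sqrt_mul (by norm_num), VV, hb,
        show (√2*√π*lam*(q+b)+√2*√π*lam*(p-b))/2 = lam*√π*(√2/2*(q+p)) by ring]
      exact mul_lt_mul_iff_right₀ hκ
    have e : f1 v - f2 v = ww*(D*kn a b (p+ww*v)) := by
      rw [hf1, hf2, hD]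
      by_cases hv : v < VV (q+p)
      · rw [Set.indicator_of_mem (by exact hv), if_pos (hiff.2 hv), hg]; ring
      · rw [Set.indicator_of_notMem (by exact hv), if_neg (fun h => hv (hiff.1 h))]; ring
    rw [e, norm_mul, ww_norm, one_mul, norm_mul]
    calc _ ≤ (C*(1/√s.im)^N*rexp (-|lam*√π*v|/10))*(2/η) :=
          mul_le_mul h (kn_bd ha0 ha1 h0 h4 (hst0 v)) (norm_nonneg _) (by positivity)
      _ = _ := by ring
  have hei : Integrable (fun v : ℝ => rexp (-|lam*√π*v|/10)) := by
    have := exp_abs_int (show 0 < lam*√π/10 by positivity)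
    refine this.congr (ae_of_all _ fun v => ?_)
    simp only [abs_mul (lam*√π), abs_of_pos hκ]; congr 1; ring
  refine (norm_integral_le_of_norm_le (hei.const_mul _) (ae_of_all _ hb2)).trans (le_of_eq ?_)
  rw [integral_const_mul, tail_int hκ, ← hJ]
  field_simp

end P19

section P20
open Filter Topology

lemma nfl {x : ℝ} (h : 0 ≤ x) : x = (⌊x⌋₊:ℝ) + Int.fract x := by
  rw [natCast_floor_eq_intCast_floor h]; exact (Int.floor_add_fract x).symm

lemma rhs_bd {lam t σ : ℝ} {N : ℕ} (hl : 0 < lam) (ht : 0 < t) :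
    ((2*π/t)^((1:ℝ)/4) * lam^(1-σ))*((1/√t)^N*(4*max 1 lam/lam)) ≤
      8*(lam ^ ((1:ℝ)/2 - σ) * (lam + lam⁻¹) ^ (3*(N:ℝ) + 1/2) * t ^ (-(N:ℝ)/2 - 1/4)) := by
  set L := lam+lam⁻¹ with hL
  have hli : 0 < lam⁻¹ := by positivity
  have hL1 : 1 ≤ L := by
    rcases le_total 1 lam with h | h
    · linarith
    · have := one_le_inv_iff₀.2 ⟨hl, h⟩; linarith
  have h1 : (2*π/t)^((1:ℝ)/4) ≤ 2*t^(-(1:ℝ)/4) := by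
    rw [div_rpow (by positivity) ht.le, neg_div, rpow_neg ht.le, div_eq_mul_inv]
    refine mul_le_mul_of_nonneg_right ?_ (by positivity)
    have h2 : (2:ℝ) = ((2:ℝ)^(4:ℝ))^((1:ℝ)/4) := by rw [← rpow_mul (by norm_num)]; norm_num
    conv_rhs => rw [h2]
    refine rpow_le_rpow (by positivity) ?_ (by norm_num)
    have := pi_lt_four; norm_num; linarith
  have h2 : lam^(1-σ) = lam^((1:ℝ)/2-σ)*lam^((1:ℝ)/2) := by
    rw [← rpow_add hl]; congr 1; ring
  have h3 : (1/√t)^N*t^(-(1:ℝ)/4) = t^(-(N:ℝ)/2-1/4) := by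
    rw [one_div, inv_pow, sqrt_eq_rpow, ← rpow_natCast, ← rpow_mul ht.le, ← rpow_neg ht.le,
      ← rpow_add ht]; congr 1; ring
  have h4 : lam^((1:ℝ)/2)*(max 1 lam/lam) ≤ L^(3*(N:ℝ)+1/2) := by
    refine le_trans ?_ (rpow_le_rpow_of_exponent_le hL1 (show (1:ℝ)/2 ≤ 3*(N:ℝ)+1/2 by
      have : (0:ℝ) ≤ N := Nat.cast_nonneg N
      linarith))
    rcases le_total 1 lam with h | h
    · rw [max_eq_right h, div_self hl.ne', mul_one]
      exact rpow_le_rpow hl.le (by linarith) (by norm_num)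
    · rw [max_eq_left h]
      have : lam^((1:ℝ)/2)*(1/lam) = (lam⁻¹)^((1:ℝ)/2) := by
        rw [one_div lam, ← rpow_neg_one lam, ← rpow_add hl, ← rpow_mul hl.le]; norm_num
      rw [this]
      exact rpow_le_rpow hli.le (by linarith) (by norm_num)
  have hp1 : 0 ≤ lam^(1-σ) := by positivity
  have hp2 : 0 ≤ (1/√t)^N*(4*max 1 lam/lam) := by positivity
  calc _ ≤ (2*t^(-(1:ℝ)/4)*lam^(1-σ))*((1/√t)^N*(4*max 1 lam/lam)) :=
        mul_le_mul_of_nonneg_right (mul_le_mul_of_nonneg_right h1 hp1) hp2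
    _ = 8*(lam^((1:ℝ)/2-σ)*(lam^((1:ℝ)/2)*(max 1 lam/lam))*((1/√t)^N*t^(-(1:ℝ)/4))) := by rw [h2]; ring
    _ ≤ _ := by
      rw [h3]
      have hq1 : 0 ≤ lam^((1:ℝ)/2-σ) := by positivity
      have hq2 : 0 ≤ t^(-(N:ℝ)/2-1/4) := by positivity
      exact mul_le_mul_of_nonneg_left (mul_le_mul_of_nonneg_right (mul_le_mul_of_nonneg_left h4 hq1) hq2) (by norm_num)

lemma exp_small (A B : ℝ) (N : ℕ) : ∃ C, 0 ≤ C ∧ ∀ lam t σ : ℝ, σ ∈ Set.Icc A B → 0 < lam → 1 ≤ t → lam ≤ t →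
    lam⁻¹ ≤ t → rexp (-(t/10)) ≤
      C*(lam ^ ((1:ℝ)/2 - σ) * (lam + lam⁻¹) ^ (3*(N:ℝ) + 1/2) * t ^ (-(N:ℝ)/2 - 1/4)) := by
  obtain ⟨M, hM⟩ := exists_nat_ge (|A|+|B|+1)
  obtain ⟨C, hC, hP⟩ := poly_exp (M+(N+1)) (show (0:ℝ) < 1/10 by norm_num)
  refine ⟨C, hC, fun lam t σ hσ hl ht h1 h2 => ?_⟩
  have ht0 : 0 < t := by linarith
  set L := lam+lam⁻¹ with hL
  have hli : 0 < lam⁻¹ := by positivity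
  have hL1 : 1 ≤ L := by
    rcases le_total 1 lam with h | h
    · linarith
    · have := one_le_inv_iff₀.2 ⟨hl, h⟩; linarith
  have a1 : (t^M)⁻¹ ≤ lam^((1:ℝ)/2-σ) := by
    rw [← rpow_natCast, ← rpow_neg ht0.le, rpow_def_of_pos ht0, rpow_def_of_pos hl]
    refine exp_le_exp.2 ?_
    have g1 := log_le_log hl h1
    have g2 := log_le_log hli h2
    rw [Real.log_inv] at g2
    have g3 : |Real.log lam| ≤ Real.log t := abs_le.2 ⟨by linarith, g1⟩
    have g4 : |1/2-σ| ≤ M := by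
      rw [abs_le]; constructor
      · linarith [le_abs_self B, hσ.2, abs_nonneg A]
      · linarith [neg_abs_le A, hσ.1, abs_nonneg B]
    have g5 : |Real.log lam*(1/2-σ)| ≤ Real.log t*M := by
      rw [abs_mul]; exact mul_le_mul g3 g4 (abs_nonneg _) ((abs_nonneg _).trans g3)
    linarith [neg_abs_le (Real.log lam*(1/2-σ))]
  have a2 : 1 ≤ L^(3*(N:ℝ)+1/2) := one_le_rpow hL1 (by positivity)
  have a3 : (t^(N+1))⁻¹ ≤ t^(-(N:ℝ)/2-1/4) := by
    rw [← rpow_natCast, ← rpow_neg ht0.le]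
    refine rpow_le_rpow_of_exponent_le ht ?_
    have : (0:ℝ) ≤ N := Nat.cast_nonneg N
    push_cast; linarith
  have a4 : (t^M)⁻¹*1*(t^(N+1))⁻¹ ≤ lam^((1:ℝ)/2-σ)*L^(3*(N:ℝ)+1/2)*t^(-(N:ℝ)/2-1/4) :=
    mul_le_mul (mul_le_mul a1 a2 zero_le_one (by positivity)) a3 (by positivity) (by positivity)
  refine le_trans ?_ (mul_le_mul_of_nonneg_left a4 hC)
  rw [mul_one, ← mul_inv, ← pow_add, ← div_eq_mul_inv, le_div_iff₀ (by positivity)]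
  have h5 := hP t ht0.le
  have h6 : t^(M+(N+1)) ≤ (1+t)^(M+(N+1)) := pow_le_pow_left₀ ht0.le (by linarith) _
  calc _ ≤ rexp (-(t/10))*(C*rexp (1/10*t)) := mul_le_mul_of_nonneg_left (h6.trans h5) (exp_pos _).le
    _ = C*(rexp (-(t/10))*rexp (1/10*t)) := by ring
    _ = C := by rw [← Real.exp_add, show -(t/10)+1/10*t = 0 by ring, Real.exp_zero, mul_one]
end P20

end

theorem statement4 (A B : ℝ) (N : ℕ) (ϑ : ℂ → ℂ) (hϑ : IsRSTheta ϑ) :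
    ∃ C : ℝ, ∀ s : ℂ, s.re ∈ Set.Icc A B → 2 * π ≤ s.im →
      ∀ α β : ℝ, 1 ≤ α → 1 ≤ β → s.im = 2 * π * α * β →
      ∀ lam a b : ℝ, lam = Real.sqrt (α/β) → a = Int.fract α → b = Int.fract β →
        ‖(Complex.exp (I * ϑ s) * riemannZeta s
              - Complex.exp (I * ϑ s) * zetaSum α s
              - Complex.exp (I * ϑ (1 - s)) * zetaSum β (1 - s))
            - (-1:ℂ)^(⌊α⌋₊ * ⌊β⌋₊ + 1) *
              Complex.exp ((π:ℂ) * I *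
                ((2*a*β - 2*b*α + a^2/lam^2 - b^2*lam^2 : ℝ) : ℂ) / 2) *
              (((2*π/s.im) ^ ((1:ℝ)/4) : ℝ) : ℂ) *
              ∑ n ∈ Finset.range N,
                ((lam : ℂ) ^ ((1:ℂ)/2 - s) * ((s.im ^ (-(n:ℝ)/2) : ℝ) : ℂ) *
                  ∑ r ∈ Finset.range (3*n + 1),
                    Gderiv r ((a/lam + b*lam : ℝ) : ℂ) ((lam^2 : ℝ) : ℂ) *
                      ((((2*π) ^ (-(r:ℝ)/2) : ℝ)) : ℂ) *
                      PP n (3*n - r) ((Real.sqrt (π/2) * (a/lam - b*lam) : ℝ) : ℂ) s.re)‖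
          ≤ C * lam ^ ((1:ℝ)/2 - s.re) * (lam + lam⁻¹) ^ (3*(N:ℝ) + 1/2) *
              s.im ^ (-(N:ℝ)/2 - 1/4) := by
  obtain ⟨C1, hC1, H1⟩ := tiny hϑ A B
  obtain ⟨C2, hC2, H2⟩ := core hϑ A B N
  obtain ⟨C3, hC3, H3⟩ := exp_small A B N
  refine ⟨C1*C3+8*C2, fun s hs ht α β hα hβ hst lam a b hl ha hb => ?_⟩
  have hpi := Real.pi_gt_d2
  have hpi4 := Real.pi_lt_d2
  have hα0 : 0 < α := by linarith
  have hβ0 : 0 < β := by linarith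
  have hαe : α = (⌊α⌋₊:ℝ) + a := by rw [ha]; exact nfl hα0.le
  have hβe : β = (⌊β⌋₊:ℝ) + b := by rw [hb]; exact nfl hβ0.le
  have hq : 1 ≤ ⌊β⌋₊ := Nat.le_floor (by exact_mod_cast hβ)
  have hq' : (1:ℝ) ≤ (⌊β⌋₊:ℝ) := by exact_mod_cast hq
  have ha0 : 0 ≤ a := by rw [ha]; exact Int.fract_nonneg _
  have ha1 : a ≤ 1 := by rw [ha]; exact (Int.fract_lt_one _).le
  have hb0 : 0 ≤ b := by rw [hb]; exact Int.fract_nonneg _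
  have hb1 : b ≤ 1 := by rw [hb]; exact (Int.fract_lt_one _).le
  have ez1 : zetaSum α s = ∑ n ∈ Finset.Icc 1 ⌊α⌋₊, (n:ℂ)^(-s) := rfl
  have ez2 : zetaSum β (1-s) = ∑ n ∈ Finset.Icc 1 ⌊β⌋₊, (n:ℂ)^(s-1) := by
    rw [zetaSum]; refine Finset.sum_congr rfl fun n _ => ?_
    rw [neg_sub]
  generalize ⌊α⌋₊ = m at *
  generalize ⌊β⌋₊ = q at *
  have hl0 : 0 < lam := by rw [hl]; positivity
  have hl2 : lam^2 = α/β := by rw [hl, Real.sq_sqrt (by positivity)]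
  have hαl : (m:ℝ) + a = lam^2*β := by rw [← hαe, hl2]; field_simp
  have hsq : √s.im = √(2*π)*lam*β := by
    have : s.im = (√(2*π)*lam*β)^2 := by
      rw [mul_pow, mul_pow, Real.sq_sqrt (by positivity), hl2, hst]; field_simp
    rw [this, Real.sqrt_sq (by positivity)]
  have hαβ : 1 ≤ α*β := by nlinarith
  have htα : 6*α ≤ s.im := by rw [hst]; nlinarith
  have htβ : 6*β ≤ s.im := by rw [hst]; nlinarith
  have ht1 : 1 ≤ s.im := by linarith
  have hlt : lam ≤ s.im := by
    refine abs_le_of_sq_le_sq' ?_ (by linarith) |>.2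
    rw [hl2]
    calc α/β ≤ α := div_le_self hα0.le hβ
      _ ≤ s.im^2 := by nlinarith
  have hlit : lam⁻¹ ≤ s.im := by
    refine abs_le_of_sq_le_sq' ?_ (by linarith) |>.2
    rw [inv_pow, hl2, inv_div]
    calc β/α ≤ β := div_le_self hβ0.le hα
      _ ≤ s.im^2 := by nlinarith
  set mx := max 1 lam with hmx
  have hmx1 : 1 ≤ mx := le_max_left _ _
  have hmxl : lam ≤ mx := le_max_right _ _
  have hmxt : mx ≤ s.im := max_le ht1 hlt
  set η := 1/(4*mx) with hη
  have h0 : 0 < η := by positivity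
  have hη4 : η ≤ 1/4 := one_div_le_one_div_of_le (by norm_num) (by linarith)
  have hηl : lam*η ≤ 1/4 := by
    rw [hη, mul_one_div, div_le_div_iff₀ (by positivity) (by norm_num)]; linarith
  set p := max η (min b (1-η)) with hp
  have hpm : p ∈ Set.Icc η (1-η) := ⟨le_max_left _ _, max_le (by linarith) (min_le_right _ _)⟩
  have hpb : |p-b| ≤ η := by
    rw [abs_le, hp]; constructor
    · have : b - η ≤ min b (1-η) := le_min (by linarith) (by linarith)
      linarith [le_max_right η (min b (1-η))]
    · have : max η (min b (1-η)) ≤ b + η := max_le (by linarith) ((min_le_left _ _).trans (by linarith))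
      linarith
  have hk : |√(2*π)*lam*(p-b)| ≤ 7/10 := by
    rw [abs_mul, abs_of_pos (by positivity)]
    have h5 : √(2*π) ≤ 14/5 := Real.sqrt_le_iff.2 ⟨by norm_num, by nlinarith⟩
    calc _ ≤ √(2*π)*lam*η := mul_le_mul_of_nonneg_left hpb (by positivity)
      _ = √(2*π)*(lam*η) := by ring
      _ ≤ 14/5*(1/4) := mul_le_mul h5 hηl (by positivity) (by norm_num)
      _ = _ := by norm_num
  have hmα : (m:ℝ) ≤ α := by linarith
  have T := H1 s hs ht (q+p) η q m h0 hη4 hq (by linarith [hpm.1]) (by linarith [hpm.2])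
    (by linarith [hpm.2]) (by linarith) (by rw [hη, one_div_one_div]; linarith)
    (by
      have e : s.im/(2*π) = α*β := by rw [hst]; field_simp
      rw [e]
      have h5 : (q:ℝ)+p ≤ 5/4*β := by linarith [(abs_le.1 hpb).2]
      calc (m:ℝ)*(q+p) ≤ α*(5/4*β) := mul_le_mul hmα h5 (by linarith [hpm.1]) hα0.le
        _ = _ := by ring)
  have K := H2 s hs ht lam β a b p η m q hl0 hβ0 hsq hαl hβe hq ha0 ha1 h0 hη4 hpm hk
  obtain ⟨-, ms⟩ := main_sum N (s := s) (by linarith) (a := a) (b := b) hl0 h0 hη4 hpm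
  have kp := kappa hα0 hβ0 hst hl hαe hβe
  rw [kap_norm m hα0 hβ0 hst, ← hl] at K
  rw [ms, ez1, ez2, theta_neg hϑ (by linarith), mul_neg, ← neg_mul, ← mul_assoc, kp]
  clear kp ms
  set Q := ∫ v : ℝ, ww * ((∑ n ∈ Finset.range N, pn n s.re (zc lam b (p+ww*v)) * ((1/√s.im:ℝ):ℂ)^n) *
      Complex.exp (-I*(zc lam b (p+ww*v))^2/2) * kn a b (p+ww*v)) with hQ
  have h3 := H3 lam s.im s.re hs hl0 ht1 hlt hlit
  have h4 := rhs_bd (σ := s.re) (N := N) hl0 (by linarith : 0 < s.im)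
  set RR := lam ^ ((1:ℝ)/2 - s.re) * (lam + lam⁻¹) ^ (3*(N:ℝ) + 1/2) * s.im ^ (-(N:ℝ)/2 - 1/4) with hRR
  have hηm : 1/(η*lam) = 4*max 1 lam/lam := by rw [hη]; field_simp; exact hmx
  rw [hηm] at K
  have fin := norm_sub_le_of_le T K
  refine (le_of_eq ?_).trans (fin.trans ?_)
  · congr 1; ring
  · have i1 := mul_le_mul_of_nonneg_left h3 hC1
    have i2 := mul_le_mul_of_nonneg_left h4 hC2
    calc _ = C1*Real.exp (-(s.im/10)) + C2*(((2*π/s.im)^((1:ℝ)/4) * lam^(1-s.re))*((1/√s.im)^N*(4*max 1 lam/lam))) := by ring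
      _ ≤ C1*(C3*RR) + C2*(8*RR) := add_le_add i1 i2
      _ = _ := by rw [hRR]; ring

end
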